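/- For all t, there exists M = M(t) such that every graph in F_t with no heavy seagull and with treewidth more than M contains a subdivision of the t-by-t wall W_{t×t} as an induced subgraph. -/

import Mathlib

open SimpleGraph Set List

namespace Paper

variable {V : Type} {W : Type}

/-- The closed neighborhood `N[v]` of a vertex. -/
def closedNbhd (G : SimpleGraph V) (v : V) : Set V := insert v (G.neighborSet v)

/-- The degree of a vertex (as the number of its neighbors). -/
noncomputable def deg (G : SimpleGraph V) (v : V) : ℕ := (G.neighborSet v).ncard

/-- `G` contains `H` as an induced subgraph, i.e. some induced subgraph of `G` is
isomorphic to `H`. -/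
def ContainsInduced (G : SimpleGraph V) (H : SimpleGraph W) : Prop :=
  ∃ s : Set V, Nonempty (H ≃g G.induce s)

/-- `(A, C, B)` is a separation of `G`. -/
def IsSeparation (G : SimpleGraph V) (A C B : Set V) : Prop :=
  A ∪ C ∪ B = Set.univ ∧ Disjoint A C ∧ Disjoint A B ∧ Disjoint C B ∧
    ∀ a ∈ A, ∀ b ∈ B, ¬G.Adj a b

/-- `G` admits a star cutset. -/
def HasStarCutset (G : SimpleGraph V) : Prop :=
  ∃ A C B : Set V, IsSeparation G A C B ∧ A.Nonempty ∧ B.Nonempty ∧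
    ∃ v ∈ C, C ⊆ closedNbhd G v

/-- `G` admits a clique cutset. -/
def HasCliqueCutset (G : SimpleGraph V) : Prop :=
  ∃ A C B : Set V, IsSeparation G A C B ∧ A.Nonempty ∧ B.Nonempty ∧ G.IsClique C

/-- `D` is a connected component of `G \ X`: a maximal connected subset of `Xᶜ`. -/
def IsComponentOf (G : SimpleGraph V) (X : Set V) (D : Set V) : Prop :=
  D.Nonempty ∧ D ⊆ Xᶜ ∧ (G.induce D).Connected ∧
    ∀ D' : Set V, D ⊆ D' → D' ⊆ Xᶜ → (G.induce D').Connected → D' = D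

/-- An induced path in `G` ("path" in the paper always means induced path). -/
def IsIPath (G : SimpleGraph V) {u v : V} (P : G.Walk u v) : Prop :=
  P.IsPath ∧ P.toSubgraph.IsInduced

/-- A hole: an induced cycle of length at least four. -/
def IsHole (G : SimpleGraph V) {v : V} (c : G.Walk v v) : Prop :=
  c.IsCycle ∧ 4 ≤ c.length ∧ c.toSubgraph.IsInduced

/-- `G` is sparse: for every hole and every vertex not in it, there is an edge `ab` of the
hole containing all neighbors of the vertex in the hole. -/
def Sparse (G : SimpleGraph V) : Prop :=
  ∀ (v : V) (c : G.Walk v v), IsHole G c → ∀ x, x ∉ c.support →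
    ∃ a b, c.toSubgraph.Adj a b ∧ ∀ y ∈ c.support, G.Adj x y → y = a ∨ y = b

/-- `G` contains a pyramid (necessarily as an induced subgraph). -/
def ContainsPyramid (G : SimpleGraph V) : Prop :=
  ∃ (a b₁ b₂ b₃ : V) (P₁ : G.Walk a b₁) (P₂ : G.Walk a b₂) (P₃ : G.Walk a b₃),
    G.Adj b₁ b₂ ∧ G.Adj b₂ b₃ ∧ G.Adj b₁ b₃ ∧
    IsIPath G P₁ ∧ IsIPath G P₂ ∧ IsIPath G P₃ ∧
    1 ≤ P₁.length ∧ 1 ≤ P₂.length ∧ 1 ≤ P₃.length ∧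
    ¬(P₁.length = 1 ∧ P₂.length = 1) ∧ ¬(P₁.length = 1 ∧ P₃.length = 1) ∧
    ¬(P₂.length = 1 ∧ P₃.length = 1) ∧
    (∀ p ∈ P₁.support, p ≠ a → ∀ q ∈ P₂.support, q ≠ a →
      p ≠ q ∧ (G.Adj p q → p = b₁ ∧ q = b₂)) ∧
    (∀ p ∈ P₁.support, p ≠ a → ∀ q ∈ P₃.support, q ≠ a →
      p ≠ q ∧ (G.Adj p q → p = b₁ ∧ q = b₃)) ∧
    (∀ p ∈ P₂.support, p ≠ a → ∀ q ∈ P₃.support, q ≠ a →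
      p ≠ q ∧ (G.Adj p q → p = b₂ ∧ q = b₃))

/-- `G` contains a prism (necessarily as an induced subgraph). -/
def ContainsPrism (G : SimpleGraph V) : Prop :=
  ∃ (a₁ a₂ a₃ b₁ b₂ b₃ : V) (P₁ : G.Walk a₁ b₁) (P₂ : G.Walk a₂ b₂) (P₃ : G.Walk a₃ b₃),
    G.Adj a₁ a₂ ∧ G.Adj a₂ a₃ ∧ G.Adj a₁ a₃ ∧
    G.Adj b₁ b₂ ∧ G.Adj b₂ b₃ ∧ G.Adj b₁ b₃ ∧
    IsIPath G P₁ ∧ IsIPath G P₂ ∧ IsIPath G P₃ ∧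
    1 ≤ P₁.length ∧ 1 ≤ P₂.length ∧ 1 ≤ P₃.length ∧
    (∀ p ∈ P₁.support, ∀ q ∈ P₂.support,
      p ≠ q ∧ (G.Adj p q → (p = a₁ ∧ q = a₂) ∨ (p = b₁ ∧ q = b₂))) ∧
    (∀ p ∈ P₁.support, ∀ q ∈ P₃.support,
      p ≠ q ∧ (G.Adj p q → (p = a₁ ∧ q = a₃) ∨ (p = b₁ ∧ q = b₃))) ∧
    (∀ p ∈ P₂.support, ∀ q ∈ P₃.support,
      p ≠ q ∧ (G.Adj p q → (p = a₂ ∧ q = a₃) ∨ (p = b₂ ∧ q = b₃)))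

/-- `G` is very sparse: sparse, pyramid-free and prism-free. -/
def VerySparse (G : SimpleGraph V) : Prop :=
  Sparse G ∧ ¬ContainsPyramid G ∧ ¬ContainsPrism G

/-- `G ∈ 𝓕_t`: `G` is very sparse with no clique of size at least `t+1`. -/
def MemF (t : ℕ) (G : SimpleGraph V) : Prop :=
  VerySparse G ∧ ∀ s : Set V, G.IsClique s → s.ncard ≤ t

/-- `G` has a tree decomposition of width at most `k`. -/
def HasTreewidthAtMost (G : SimpleGraph V) (k : ℕ) : Prop :=
  ∃ (ι : Type) (T : SimpleGraph ι) (χ : ι → Finset V),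
    T.IsTree ∧
    (∀ v : V, ∃ t, v ∈ χ t) ∧
    (∀ u v : V, G.Adj u v → ∃ t, u ∈ χ t ∧ v ∈ χ t) ∧
    (∀ v : V, (T.induce {t | v ∈ χ t}).Connected) ∧
    ∀ t, (χ t).card ≤ k + 1

/-- The `n`-by-`n` wall, as a brick wall graph: `n` rows of `2n` vertices each,
with horizontal path edges in each row, and vertical edges between consecutive
rows placed alternately. -/
def Wall (n : ℕ) : SimpleGraph (Fin n × Fin (2 * n)) :=
  SimpleGraph.fromRel (fun a b =>
    (a.1 = b.1 ∧ a.2.val + 1 = b.2.val) ∨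
    (a.2 = b.2 ∧ a.1.val + 1 = b.1.val ∧ (a.1.val + a.2.val) % 2 = 0))

/-- The graph obtained from `G` by subdividing the edge `uv` once (the new vertex
is `none`). -/
def subdivideEdge (G : SimpleGraph V) (u v : V) : SimpleGraph (Option V) :=
  SimpleGraph.fromRel (fun a b =>
    (∃ x y : V, a = some x ∧ b = some y ∧ G.Adj x y ∧ ¬(x = u ∧ y = v) ∧ ¬(x = v ∧ y = u)) ∨
    (a = none ∧ (b = some u ∨ b = some v)))

/-- `IsSubdivision G H`: `G` is (isomorphic to) a graph obtained from `H` by repeatedly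
subdividing edges. -/
inductive IsSubdivision : {α : Type} → SimpleGraph α → {β : Type} → SimpleGraph β → Prop where
  | base {α β : Type} {G : SimpleGraph α} {H : SimpleGraph β} :
      Nonempty (G ≃g H) → IsSubdivision G H
  | step {α β : Type} {G : SimpleGraph α} {H : SimpleGraph β} (u v : β) :
      H.Adj u v → IsSubdivision G (subdivideEdge H u v) → IsSubdivision G H

/-- `G` contains a subdivision of the `t`-by-`t` wall as an induced subgraph. -/
def ContainsWallSubdiv (G : SimpleGraph V) (t : ℕ) : Prop :=
  ∃ (α : Type) (S : SimpleGraph α), IsSubdivision S (Wall t) ∧ ContainsInduced G S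

/-- `G` contains the line graph of a subdivision of the `t`-by-`t` wall as an induced
subgraph. -/
def ContainsLineWallSubdiv (G : SimpleGraph V) (t : ℕ) : Prop :=
  ∃ (α : Type) (S : SimpleGraph α), IsSubdivision S (Wall t) ∧
    ContainsInduced G S.lineGraph

/-- `G` is `𝓣₁`-free: no vertex has two or more neighbors in a hole not containing it. -/
def T1Free (G : SimpleGraph V) : Prop :=
  ∀ (v : V) (c : G.Walk v v), IsHole G c → ∀ x, x ∉ c.support →
    ∀ y z, y ∈ c.support → z ∈ c.support → G.Adj x y → G.Adj x z → y = z

/-- `G` is `𝓣₂`-free: no vertex has two non-adjacent neighbors in a hole not containing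
it, and `G` is pyramid-free and prism-free. -/
def T2Free (G : SimpleGraph V) : Prop :=
  (∀ (v : V) (c : G.Walk v v), IsHole G c → ∀ x, x ∉ c.support →
    ∀ y z, y ∈ c.support → z ∈ c.support → G.Adj x y → G.Adj x z → y ≠ z → G.Adj y z) ∧
  ¬ContainsPyramid G ∧ ¬ContainsPrism G

/-- The weight `w(X)` of a set of vertices. -/
noncomputable def setW (w : V → ℝ) (X : Set V) : ℝ := ∑ᶠ x ∈ X, w x

/-- `w` is a weight function on `G`: values in `[0,1]` with total weight `1`. -/
def IsWeightFn (w : V → ℝ) : Prop :=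
  (∀ v, 0 ≤ w v ∧ w v ≤ 1) ∧ setW w Set.univ = 1

/-- `X` is a `(w, c)`-balanced separator. -/
def IsBalSep (G : SimpleGraph V) (w : V → ℝ) (c : ℝ) (X : Set V) : Prop :=
  ∀ D, IsComponentOf G X D → setW w D ≤ c

/-- `(G, w)` is `d`-unbalanced: `w` is a weight function and there is no
`(w, 1/2)`-balanced separator of size at most `d`. -/
def Unbalanced (G : SimpleGraph V) (w : V → ℝ) (d : ℕ) : Prop :=
  IsWeightFn w ∧ ∀ X : Set V, X.ncard ≤ d → ¬IsBalSep G w (1 / 2 : ℝ) X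

/-- `B = B(K₁,K₂)` is the (unique) component of `G ∖ (K₁ ∪ K₂)` of weight more
than `1/2`.  Then `A(K₁,K₂) = (B ∪ K₁ ∪ K₂)ᶜ` and `S(K₁,K₂) = (A, K₁ ∪ K₂, B)` is the
canonical two-clique-separation for `{K₁, K₂}`. -/
def IsCanonicalB (G : SimpleGraph V) (w : V → ℝ) (K₁ K₂ B : Set V) : Prop :=
  IsComponentOf G (K₁ ∪ K₂) B ∧ (1 / 2 : ℝ) < setW w B

/-- The open neighborhood `N(D)` of a set of vertices. -/
def nbhdOfSet (G : SimpleGraph V) (D : Set V) : Set V :=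
  {v | v ∉ D ∧ ∃ d ∈ D, G.Adj v d}

/-- The canonical two-clique-separation `S(K₁,K₂)` (with big side `B`) is proper. -/
def ProperPair (G : SimpleGraph V) (w : V → ℝ) (K₁ K₂ B : Set V) : Prop :=
  IsCanonicalB G w K₁ K₂ B ∧
  (∃ D, IsComponentOf G (K₁ ∪ K₂) D ∧ D ⊆ (B ∪ K₁ ∪ K₂)ᶜ ∧
    K₁ ∪ K₂ ⊆ nbhdOfSet G D) ∧
  (K₁.ncard = 1 → K₂.ncard = 1 →
    ¬∃ (x y : V) (P : G.Walk x y), K₁ = {x} ∧ K₂ = {y} ∧ IsIPath G P ∧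
      {v | v ∈ P.support} = (B ∪ K₁ ∪ K₂)ᶜ ∪ K₁ ∪ K₂)

/-- The canonical two-clique-separation `S(K₁,K₂)` (with big side `B`) is active,
where `K` bounds the size of the cliques considered. -/
def ActivePair (G : SimpleGraph V) (w : V → ℝ) (K : ℕ) (K₁ K₂ B : Set V) : Prop :=
  ProperPair G w K₁ K₂ B ∧
  ∀ K₁' K₂' B' : Set V, G.IsClique K₁' → G.IsClique K₂' →
    K₁'.ncard ≤ K → K₂'.ncard ≤ K → ProperPair G w K₁' K₂' B' →
    K₁ ∪ K₂ ≠ K₁' ∪ K₂' →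
      ¬(B' ∪ K₁' ∪ K₂' ⊂ B ∪ K₁ ∪ K₂) ∧
      (B' ∪ K₁' ∪ K₂' = B ∪ K₁ ∪ K₂ → B' ⊂ B)

/-- The interiors of two paths from `a` to `b` are disjoint and anticomplete. -/
def IntDisjAnti (G : SimpleGraph V) {a b : V} (P Q : G.Walk a b) : Prop :=
  ∀ x ∈ P.support, x ≠ a → x ≠ b → ∀ y ∈ Q.support, y ≠ a → y ≠ b → x ≠ y ∧ ¬G.Adj x y

/-- `Q₁, Q₂, Q₃` form a theta (as an induced subgraph of `G`) with ends `a, b`. -/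
def ThetaCfg (G : SimpleGraph V) {a b : V} (Q₁ Q₂ Q₃ : G.Walk a b) : Prop :=
  ¬G.Adj a b ∧
  IsIPath G Q₁ ∧ IsIPath G Q₂ ∧ IsIPath G Q₃ ∧
  2 ≤ Q₁.length ∧ 2 ≤ Q₂.length ∧ 2 ≤ Q₃.length ∧
  IntDisjAnti G Q₁ Q₂ ∧ IntDisjAnti G Q₁ Q₃ ∧ IntDisjAnti G Q₂ Q₃

/-- There is a theta through the seagull `a-v-u` in `G`: a theta one of whose ends is
`a` or `u` and which contains the seagull. -/
def ThetaThroughSeagull (G : SimpleGraph V) (a v u : V) : Prop :=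
  (∃ (b : V) (Q₁ Q₂ Q₃ : G.Walk a b), ThetaCfg G Q₁ Q₂ Q₃ ∧ [a, v, u] <+: Q₁.support) ∨
  (∃ (b : V) (Q₁ Q₂ Q₃ : G.Walk u b), ThetaCfg G Q₁ Q₂ Q₃ ∧ [u, v, a] <+: Q₁.support)

/-- `a-v-u` is a heavy seagull in `G`: an induced three-vertex path whose ends both
have degree at least three. -/
def HeavySeagull (G : SimpleGraph V) (a v u : V) : Prop :=
  a ≠ u ∧ G.Adj a v ∧ G.Adj v u ∧ ¬G.Adj a u ∧ 3 ≤ deg G a ∧ 3 ≤ deg G u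

end Paper


namespace GT

/-- connected set, closure form -/
def Conn {V : Type} (G : SimpleGraph V) (X : Set V) : Prop :=
  X.Nonempty ∧ ∀ A : Set V, A ⊆ X → A.Nonempty → (∀ a ∈ A, ∀ b ∈ X, G.Adj a b → b ∈ A) → X ⊆ A

variable {V : Type} {G G' : SimpleGraph V} {X Y : Set V}

lemma Conn.closed (h : Conn G X) {L : Set V} (hne : (X ∩ L).Nonempty)
    (hc : ∀ a ∈ X, a ∈ L → ∀ b ∈ X, G.Adj a b → b ∈ L) : X ⊆ L := by
  have := h.2 (X ∩ L) inter_subset_left hne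
    (fun a ha b hb hab => ⟨hb, hc a ha.1 ha.2 b hb hab⟩)
  exact fun x hx => (this hx).2

lemma conn_of_closed (hne : X.Nonempty) (h : ∀ x ∈ X, ∀ L : Set V, x ∈ L →
    (∀ a ∈ X, a ∈ L → ∀ b ∈ X, G.Adj a b → b ∈ L) → X ⊆ L) : Conn G X := by
  refine ⟨hne, fun A hA ⟨a, ha⟩ hc => h a (hA ha) A ha (fun a _ ha b hb hab => hc a ha b hb hab)⟩

/-- it suffices that closed sets containing a fixed root contain everything -/
lemma conn_of_root {r : V} (hr : r ∈ X) (h : ∀ L : Set V, r ∈ L →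
    (∀ a ∈ X, a ∈ L → ∀ b ∈ X, G.Adj a b → b ∈ L) → X ⊆ L) : Conn G X := by
  refine conn_of_closed ⟨r, hr⟩ fun x hx L hxL hc => ?_
  by_cases hrL : r ∈ L
  · exact h L hrL hc
  · have := h Lᶜ hrL (fun a ha haL b hb hab hbL => haL (hc b hb hbL a ha hab.symm))
    exact absurd hxL (this hx)

lemma Conn.singleton (v : V) : Conn G {v} :=
  conn_of_root (mem_singleton v) (fun L hL _ => singleton_subset_iff.2 hL)

lemma Conn.mono (hG : ∀ x ∈ X, ∀ y ∈ X, G.Adj x y → G'.Adj x y) (h : Conn G X) : Conn G' X :=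
  ⟨h.1, fun A hA hne hc => h.2 A hA hne (fun a ha b hb hab => hc a ha b hb (hG a (hA ha) b hb hab))⟩

lemma Conn.mono_le (hG : G ≤ G') (h : Conn G X) : Conn G' X :=
  h.mono (fun _ _ _ _ hab => hG hab)

lemma Conn.union (hX : Conn G X) (hY : Conn G Y) (h : (X ∩ Y).Nonempty) : Conn G (X ∪ Y) := by
  obtain ⟨z, hzX, hzY⟩ := h
  refine conn_of_root (r := z) (Or.inl hzX) fun L hz hc => union_subset ?_ ?_
  · exact hX.closed ⟨z, hzX, hz⟩ (fun a ha haL b hb hab => hc a (Or.inl ha) haL b (Or.inl hb) hab)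
  · exact hY.closed ⟨z, hzY, hz⟩ (fun a ha haL b hb hab => hc a (Or.inr ha) haL b (Or.inr hb) hab)

lemma Conn.union_adj (hX : Conn G X) (hY : Conn G Y) {x y : V} (hx : x ∈ X) (hy : y ∈ Y)
    (h : G.Adj x y) : Conn G (X ∪ Y) := by
  refine conn_of_root (r := x) (Or.inl hx) fun L hz hc => ?_
  have hXL : X ⊆ L :=
    hX.closed ⟨x, hx, hz⟩ (fun a ha haL b hb hab => hc a (Or.inl ha) haL b (Or.inl hb) hab)
  refine union_subset hXL ?_
  exact hY.closed ⟨y, hy, hc x (Or.inl hx) hz y (Or.inr hy) h⟩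
    (fun a ha haL b hb hab => hc a (Or.inr ha) haL b (Or.inr hb) hab)

lemma Conn.insert_adj (hX : Conn G X) {x y : V} (hx : x ∈ X) (h : G.Adj x y) :
    Conn G (insert y X) := by
  have := hX.union_adj (Conn.singleton y) hx (mem_singleton y) h
  rwa [union_singleton] at this

/-- union of a family of connected sets, all touching a connected core -/
lemma Conn.iUnion_core {ι : Type*} (hX : Conn G X) (F : ι → Set V)
    (hF : ∀ i, Conn G (X ∪ F i)) : Conn G (X ∪ ⋃ i, F i) := by
  obtain ⟨x, hx⟩ := hX.1
  refine conn_of_root (r := x) (Or.inl hx) fun L hz hc => ?_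
  have : ∀ i, X ∪ F i ⊆ L := fun i => by
    have hsub : X ∪ F i ⊆ X ∪ ⋃ i, F i := union_subset_union_right _ (subset_iUnion F i)
    exact (hF i).closed ⟨x, Or.inl hx, hz⟩ (fun a ha haL b hb hab => hc a (hsub ha) haL b (hsub hb) hab)
  refine union_subset (fun y hy => ?_) (iUnion_subset fun i y hy => this i (Or.inr hy))
  exact hX.closed ⟨x, hx, hz⟩ (fun a ha haL b hb hab => hc a (Or.inl ha) haL b (Or.inl hb) hab) hy

/-- intervals of walks are connected -/
lemma conn_interval {f : ℕ → V} {a b : ℕ} (hab : a < b)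
    (h : ∀ i, a ≤ i → i + 1 < b → G.Adj (f i) (f (i + 1))) : Conn G (f '' {i | a ≤ i ∧ i < b}) := by
  refine conn_of_root (r := f a) ⟨a, ⟨le_rfl, hab⟩, rfl⟩ fun L hL hc => ?_
  rintro _ ⟨i, ⟨hai, hib⟩, rfl⟩
  induction i, hai using Nat.le_induction with
  | base => exact hL
  | succ i hi ih =>
    exact hc _ ⟨i, ⟨hi, by omega⟩, rfl⟩ (ih (by omega)) _ ⟨i + 1, ⟨by omega, hib⟩, rfl⟩
      (h i hi hib)

/-- existence of walks -/
lemma Conn.exists_walk (h : Conn G X) {a b : V} (ha : a ∈ X) (hb : b ∈ X) :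
    ∃ (f : ℕ → V) (n : ℕ), f 0 = a ∧ f n = b ∧ (∀ i ≤ n, f i ∈ X) ∧
      ∀ i < n, G.Adj (f i) (f (i + 1)) := by
  have := h.closed (L := {b | ∃ (f : ℕ → V) (n : ℕ), f 0 = a ∧ f n = b ∧ (∀ i ≤ n, f i ∈ X) ∧
      ∀ i < n, G.Adj (f i) (f (i + 1))}) ⟨a, ha, fun _ => a, 0, rfl, rfl, fun _ _ => ha, by simp⟩ ?_
  · exact this hb
  · rintro u - ⟨f, n, h0, hn, hX, hadj⟩ v hv huv
    refine ⟨fun i => if i ≤ n then f i else v, n + 1, by simp [h0], by simp, ?_, ?_⟩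
    · intro i _
      by_cases hi : i ≤ n <;> simp [hi, hv]
      exact hX i hi
    · intro i hi
      rcases Nat.lt_or_ge i n with h | h
      · have h1 : i ≤ n := by omega
        have h2 : i + 1 ≤ n := by omega
        simp only [h1, h2, if_true]; exact hadj i h
      · have : i = n := by omega
        subst this
        simp [hn, huv]

/-- shortest paths inside a connected set between two sets -/
lemma Conn.exists_ipath (h : Conn G X) {A B : Set V} (hA : (X ∩ A).Nonempty)
    (hB : (X ∩ B).Nonempty) :
    ∃ (f : ℕ → V) (n : ℕ), f 0 ∈ A ∧ f n ∈ B ∧ (∀ i ≤ n, f i ∈ X) ∧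
      (∀ i < n, G.Adj (f i) (f (i + 1))) ∧ (∀ i ≤ n, f i ∈ A → i = 0) ∧
      (∀ i ≤ n, f i ∈ B → i = n) ∧
      (∀ i j, i < j → j ≤ n → f i ≠ f j) ∧
      (∀ i j, i < j → j ≤ n → G.Adj (f i) (f j) → j = i + 1) := by
  classical
  let P : ℕ → Prop := fun n => ∃ f : ℕ → V, f 0 ∈ A ∧ f n ∈ B ∧ (∀ i ≤ n, f i ∈ X) ∧
      (∀ i < n, G.Adj (f i) (f (i + 1)))
  have hP : ∃ n, P n := by
    obtain ⟨a, haX, ha⟩ := hA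
    obtain ⟨b, hbX, hb⟩ := hB
    obtain ⟨f, n, h0, hn, h1, h2⟩ := h.exists_walk haX hbX
    exact ⟨n, f, by rw [h0]; exact ha, by rw [hn]; exact hb, h1, h2⟩
  obtain ⟨f, h0, hn, hX, hadj⟩ := Nat.find_spec hP
  have hmin : ∀ m, m < Nat.find hP → ¬ P m := fun m hm => Nat.find_min hP hm
  set n := Nat.find hP
  -- shortcut
  have short : ∀ i j, i < j → j ≤ n → G.Adj (f i) (f j) → j = i + 1 := by
    intro i j hij hj hA
    by_contra hne
    refine hmin (n - (j - i - 1)) (by omega)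
      ⟨fun k => if k ≤ i then f k else f (k + (j - i - 1)), by simpa using h0, ?_, ?_, ?_⟩
    · have h1 : ¬ (n - (j - i - 1) ≤ i) := by omega
      have h2 : n - (j - i - 1) + (j - i - 1) = n := by omega
      simp only [h1, if_false, h2]; exact hn
    · intro k hk
      by_cases hki : k ≤ i
      · simp only [hki, if_true]; exact hX k (by omega)
      · simp only [hki, if_false]; exact hX _ (by omega)
    · intro k hk
      rcases Nat.lt_trichotomy k i with h | h | h
      · have h1 : k ≤ i := by omega
        have h2 : k + 1 ≤ i := by omega
        simp only [h1, h2, if_true]; exact hadj k (by omega)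
      · have h1 : k ≤ i := by omega
        have h2 : ¬ (k + 1 ≤ i) := by omega
        have h3 : k + 1 + (j - i - 1) = j := by omega
        simp only [h1, h2, if_true, if_false, h3]; subst h; exact hA
      · have h1 : ¬ k ≤ i := by omega
        have h2 : ¬ (k + 1 ≤ i) := by omega
        have h3 : k + 1 + (j - i - 1) = (k + (j - i - 1)) + 1 := by omega
        simp only [h1, h2, if_false, h3]; exact hadj _ (by omega)
  have hA0 : ∀ i ≤ n, f i ∈ A → i = 0 := by
    intro i hi hiA
    by_contra hne
    refine hmin (n - i) (by omega) ⟨fun k => f (k + i), by simpa using hiA, ?_, ?_, ?_⟩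
    · have : n - i + i = n := by omega
      simp only [this]; exact hn
    · intro k hk; exact hX _ (by omega)
    · intro k hk
      have : k + 1 + i = (k + i) + 1 := by omega
      simp only [this]; exact hadj _ (by omega)
  have hBn : ∀ i ≤ n, f i ∈ B → i = n := by
    intro i hi hiB
    by_contra hne
    exact hmin i (by omega) ⟨f, h0, hiB, fun k hk => hX k (by omega), fun k hk => hadj k (by omega)⟩
  refine ⟨f, n, h0, hn, hX, hadj, hA0, hBn, ?_, short⟩
  intro i j hij hj heq
  rcases Nat.lt_or_ge j n with hjn | hjn
  · have := short i (j + 1) (by omega) (by omega) (by rw [heq]; exact hadj j hjn)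
    omega
  · have : j = n := by omega
    subst this
    have := hBn i (by omega) (by rw [heq]; exact hn)
    omega

end GT

namespace GT

variable {V : Type} {G G' : SimpleGraph V} {X Y A B : Set V} {k : ℕ}

/-- no separator of size less than k between A and B -/
def Lk (G : SimpleGraph V) (A B : Set V) (k : ℕ) : Prop :=
  ∀ S : Finset V, S.card < k → ∃ X, Conn G X ∧ Disjoint X (S : Set V) ∧ (X ∩ A).Nonempty ∧
    (X ∩ B).Nonempty

lemma Lk.symm (h : Lk G A B k) : Lk G B A k := fun S hS => by
  obtain ⟨X, h1, h2, h3, h4⟩ := h S hS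
  exact ⟨X, h1, h2, h4, h3⟩

lemma Lk.mono_le (hG : G ≤ G') (h : Lk G A B k) : Lk G' A B k := fun S hS => by
  obtain ⟨X, h1, h2, h3, h4⟩ := h S hS
  exact ⟨X, h1.mono_le hG, h2, h3, h4⟩

lemma Lk.mono {l : ℕ} (hl : l ≤ k) (h : Lk G A B k) : Lk G A B l := fun S hS => h S (by omega)

lemma lk_iff : Lk G A B k ↔ ∀ S : Finset V, S.card < k → ∀ L : Set V, (∀ a ∈ A, a ∉ S → a ∈ L) →
    (∀ a ∈ L, a ∉ S → ∀ b, b ∉ S → G.Adj a b → b ∈ L) → ∃ b ∈ B, b ∉ S ∧ b ∈ L := by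
  constructor
  · intro h S hS L hA hc
    obtain ⟨X, hX, hd, ⟨a, haX, ha⟩, ⟨b, hbX, hb⟩⟩ := h S hS
    have hd' : ∀ x ∈ X, x ∉ S := fun x hx hxS => Set.disjoint_left.1 hd hx hxS
    have := hX.closed (L := L) ⟨a, haX, hA a ha (hd' a haX)⟩
      (fun a ha haL b hb hab => hc a haL (hd' a ha) b (hd' b hb) hab)
    exact ⟨b, hb, hd' b hbX, this hbX⟩
  · intro h S hS
    have hh := h S hS
      {v | ∃ X, Conn G X ∧ Disjoint X (S : Set V) ∧ (X ∩ A).Nonempty ∧ v ∈ X}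
      (fun a ha haS => ⟨{a}, Conn.singleton a, by simpa using haS, ⟨a, rfl, ha⟩, rfl⟩) ?_
    · obtain ⟨b, hb, hbS, X, hX, hd, hXA, hbX⟩ := hh
      exact ⟨X, hX, hd, hXA, ⟨b, hbX, hb⟩⟩
    · rintro a ⟨X, hX, hd, ⟨c, hcX, hc⟩, haX⟩ haS b hbS hab
      refine ⟨insert b X, hX.insert_adj haX hab, ?_, ⟨c, Or.inr hcX, hc⟩, Or.inl rfl⟩
      rw [Set.disjoint_insert_left]
      exact ⟨by simpa using hbS, hd⟩

/-- a family of k disjoint connected sets joining A and B -/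
def IsLinkage (G : SimpleGraph V) (A B : Set V) (k : ℕ) (H : Fin k → Set V) : Prop :=
  (∀ i, Conn G (H i)) ∧ (∀ i j, i ≠ j → Disjoint (H i) (H j)) ∧
    ∀ i, (H i ∩ A).Nonempty ∧ (H i ∩ B).Nonempty

lemma IsLinkage.mono_le {H : Fin k → Set V} (hG : G ≤ G') (h : IsLinkage G A B k H) :
    IsLinkage G' A B k H := ⟨fun i => (h.1 i).mono_le hG, h.2.1, h.2.2⟩

lemma IsLinkage.lk {H : Fin k → Set V} (h : IsLinkage G A B k H) : Lk G A B k := by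
  classical
  intro S hS
  by_contra hcon
  push Not at hcon
  have : ∀ i, ∃ s ∈ S, s ∈ H i := by
    intro i
    by_contra hno
    push Not at hno
    have := hcon (H i) (h.1 i) (Set.disjoint_left.2 fun x hx hxS => hno x hxS hx) (h.2.2 i).1
    exact (h.2.2 i).2.ne_empty this
  choose f hf hfH using this
  have hinj : Function.Injective f := fun i j hij => by
    by_contra hne
    exact Set.disjoint_left.1 (h.2.1 i j hne) (hfH i) (hij ▸ hfH j)
  have := Finset.card_le_card_of_injOn f (s := Finset.univ) (t := S) (fun i _ => hf i) hinj.injOn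
  simp at this
  omega

theorem menger [Finite V] : ∀ (G : SimpleGraph V) (A B : Set V) (k : ℕ), Lk G A B k →
    ∃ H, IsLinkage G A B k H := by
  classical
  have := Fintype.ofFinite V
  intro G
  induction G using WellFoundedLT.induction with
  | ind G IH =>
  intro A B k hk
  by_cases hE : ∃ x y, G.Adj x y
  · obtain ⟨x0, y0, h0⟩ := hE
    by_cases hk' : Lk (G.deleteEdges {s(x0, y0)}) A B k
    · have hlt : G.deleteEdges {s(x0, y0)} < G := by
        refine lt_of_le_of_ne (deleteEdges_le _) fun he => ?_
        rw [← he] at h0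
        simp at h0
      obtain ⟨H, hH⟩ := IH _ hlt A B k hk'
      exact ⟨H, hH.mono_le hlt.le⟩
    rw [lk_iff] at hk'
    push Not at hk'
    obtain ⟨S, hS, L0, hA0, hc0, hB0⟩ := hk'
    obtain ⟨L, hL⟩ : ∃ L, L = {v | v ∈ L0 ∧ v ∉ S} := ⟨_, rfl⟩
    have hLS : ∀ v ∈ L, v ∉ S := fun v hv => by rw [hL] at hv; exact hv.2
    have hA : ∀ a ∈ A, a ∉ S → a ∈ L := fun a ha haS => by rw [hL]; exact ⟨hA0 a ha haS, haS⟩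
    have hc : ∀ a ∈ L, ∀ b, b ∉ S → (G.deleteEdges {s(x0, y0)}).Adj a b → b ∈ L := by
      intro a ha b hb hab
      rw [hL] at ha ⊢
      exact ⟨hc0 a ha.1 ha.2 b hb hab, hb⟩
    have hB : ∀ b ∈ B, b ∉ L := fun b hb hbL => by
      rw [hL] at hbL; exact hB0 b hb hbL.2 hbL.1
    clear hA0 hc0 hB0 hL
    -- the crossing edge
    obtain ⟨x, hxL, y, hyS, hyL, hxy⟩ : ∃ x ∈ L, ∃ y, y ∉ S ∧ y ∉ L ∧ G.Adj x y := by
      by_contra hno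
      push Not at hno
      obtain ⟨b, hb, hbS, hbL⟩ := (lk_iff.1 hk) S hS L hA (fun a ha haS b hb hab => by
        by_contra hbL
        exact hno a ha b hb hbL hab)
      exact hB b hb hbL
    have hxS := hLS x hxL
    have he : s(x0, y0) = s(x, y) := by
      by_contra hne
      exact hyL (hc x hxL y hyS (by
        rw [deleteEdges_adj]; exact ⟨hxy, fun h => hne (by simpa using h.symm)⟩))
    rw [he] at hc
    clear he h0 x0 y0
    have hG' : ∀ u v, G.Adj u v → ¬ (u = x ∧ v = y) → ¬ (u = y ∧ v = x) →
        (G.deleteEdges {s(x, y)}).Adj u v := by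
      intro u v huv h1 h2
      rw [deleteEdges_adj]
      refine ⟨huv, fun h => ?_⟩
      simp only [mem_singleton_iff, Sym2.eq_iff] at h
      tauto
    have hlt : G.deleteEdges {s(x, y)} < G := by
      refine lt_of_le_of_ne (deleteEdges_le _) fun he => ?_
      rw [← he] at hxy
      simp at hxy
    set G0 := G.deleteEdges {s(x, y)} with hG0
    let G1 : SimpleGraph V := ⟨fun u v => G0.Adj u v ∧ (u ∈ L ∨ u ∈ S) ∧ (v ∈ L ∨ v ∈ S),
      ⟨fun u v h => ⟨h.1.symm, h.2.2, h.2.1⟩⟩, ⟨fun u h => G0.loopless.irrefl u h.1⟩⟩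
    let G2 : SimpleGraph V := ⟨fun u v => G0.Adj u v ∧ u ∉ L ∧ v ∉ L,
      ⟨fun u v h => ⟨h.1.symm, h.2.2, h.2.1⟩⟩, ⟨fun u h => G0.loopless.irrefl u h.1⟩⟩
    have h10 : G1 ≤ G0 := fun u v h => h.1
    have h20 : G2 ≤ G0 := fun u v h => h.1
    have hk1 : Lk G1 A (insert x (S : Set V)) k := by
      rw [lk_iff]
      intro Z hZ Λ hAΛ hcΛ
      by_contra hno
      push Not at hno
      have hh := (lk_iff.1 hk) Z hZ {v | v ∈ Λ ∧ (v ∈ L ∨ v ∈ S)} ?_ ?_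
      · obtain ⟨b, hb, hbZ, hbΛ, hbL⟩ := hh
        have h1 : b ∉ S := fun h => hno b (Or.inr h) hbZ hbΛ
        have h2 := hB b hb
        tauto
      · intro a ha haZ
        exact ⟨hAΛ a ha haZ, by by_cases h : a ∈ S; exact Or.inr h; exact Or.inl (hA a ha h)⟩
      · rintro a ⟨haΛ, haL⟩ haZ b hbZ hab
        have h1 : a ∉ S := fun h => hno a (Or.inr h) haZ haΛ
        have h2 : a ≠ x := fun h => hno a (Or.inl h) haZ haΛ
        have h3 : a ∈ L := by tauto
        have h4 : G0.Adj a b := hG' a b hab (by tauto) (fun h => hyL (h.1 ▸ h3))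
        have h5 : b ∈ L ∨ b ∈ S := by
          by_cases h : b ∈ S; exact Or.inr h; exact Or.inl (hc a h3 b h h4)
        exact ⟨hcΛ a haΛ haZ b hbZ ⟨h4, haL, h5⟩, h5⟩
    have hk2 : Lk G2 (insert y (S : Set V)) B k := by
      apply Lk.symm
      rw [lk_iff]
      intro Z hZ Λ hAΛ hcΛ
      by_contra hno
      push Not at hno
      have hh := (lk_iff.1 hk.symm) Z hZ {v | v ∈ Λ ∧ v ∉ L} ?_ ?_
      · obtain ⟨b, hb, hbZ, hbΛ, hbL⟩ := hh
        have h1 : b ∉ S := fun h => hno b (Or.inr h) hbZ hbΛ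
        exact hbL (hA b hb h1)
      · intro a ha haZ
        exact ⟨hAΛ a ha haZ, hB a ha⟩
      · rintro a ⟨haΛ, haL⟩ haZ b hbZ hab
        have h1 : a ∉ S := fun h => hno a (Or.inr h) haZ haΛ
        have h2 : a ≠ y := fun h => hno a (Or.inl h) haZ haΛ
        have h4 : G0.Adj a b := hG' a b hab (fun h => haL (h.1 ▸ hxL)) (by tauto)
        have h5 : b ∉ L := fun h => haL (hc b h a h1 h4.symm)
        exact ⟨hcΛ a haΛ haZ b hbZ ⟨h4, haL, h5⟩, h5⟩
    obtain ⟨H1, hc1, hd1, hm1⟩ := IH G1 (lt_of_le_of_lt h10 hlt) _ _ _ hk1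
    obtain ⟨H2, hc2, hd2, hm2⟩ := IH G2 (lt_of_le_of_lt h20 hlt) _ _ _ hk2
    have hs1 : ∀ i, H1 i ⊆ L ∪ S := fun i => by
      obtain ⟨a, haH, ha⟩ := (hm1 i).1
      refine (hc1 i).closed ⟨a, haH, ?_⟩ (fun a _ _ b _ hab => hab.2.2)
      by_cases h : a ∈ S; exact Or.inr h; exact Or.inl (hA a ha h)
    have hs2 : ∀ i, H2 i ⊆ Lᶜ := fun i => by
      obtain ⟨a, haH, ha⟩ := (hm2 i).2
      exact (hc2 i).closed ⟨a, haH, hB a ha⟩ (fun a _ _ b _ hab => hab.2.2)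
    choose p hpH hpP using fun i => (hm1 i).2
    choose q hqH hqQ using fun i => (hm2 i).1
    have hd1' : ∀ i j v, v ∈ H1 i → v ∈ H1 j → i = j := fun i j v hi hj => by
      by_contra hne; exact Set.disjoint_left.1 (hd1 i j hne) hi hj
    have hd2' : ∀ i j v, v ∈ H2 i → v ∈ H2 j → i = j := fun i j v hi hj => by
      by_contra hne; exact Set.disjoint_left.1 (hd2 i j hne) hi hj
    have hpi : Function.Injective p := fun i j hij => hd1' i j _ (hpH i) (hij ▸ hpH j)
    have hqi : Function.Injective q := fun i j hij => hd2' i j _ (hqH i) (hij ▸ hqH j)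
    have hps : ∀ v ∈ insert x S, ∃ i, p i = v := by
      intro v hv
      have := Finset.surj_on_of_inj_on_of_card_le (s := Finset.univ) (t := insert x S)
        (fun i _ => p i) (fun i _ => by simpa using hpP i) (fun i j _ _ h => hpi h)
        (by simp; have := Finset.card_insert_le x S; omega) v hv
      obtain ⟨i, _, hi⟩ := this
      exact ⟨i, hi.symm⟩
    have hτ : ∀ j, ∃ i, (q j = y ∧ p i = x) ∨ (q j ∈ S ∧ p i = q j) := by
      intro j
      rcases hqQ j with h | h
      · obtain ⟨i, hi⟩ := hps x (by simp)
        exact ⟨i, Or.inl ⟨h, hi⟩⟩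
      · obtain ⟨i, hi⟩ := hps (q j) (by simp; exact Or.inr h)
        exact ⟨i, Or.inr ⟨h, hi⟩⟩
    choose σ hσ using hτ
    have hσi : ∀ j j', σ j = σ j' → j = j' := by
      intro j j' h
      apply hqi
      have h1 := hσ j
      have h2 := hσ j'
      rw [← h] at h2
      rcases h1 with h1 | h1 <;> rcases h2 with h2 | h2
      · rw [h1.1, h2.1]
      · exfalso; apply hxS; rw [← h1.2, h2.2]; exact h2.1
      · exfalso; apply hxS; rw [← h2.2, h1.2]; exact h1.1
      · rw [← h1.2, ← h2.2]
    have hcross : ∀ j j' v, v ∈ H1 (σ j) → v ∈ H2 j' → j = j' := by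
      intro j j' v h1 h2
      have hvS : v ∈ S := (hs1 _ h1).resolve_left (hs2 _ h2)
      obtain ⟨i, hi⟩ := hps v (by simp [hvS])
      have : i = σ j := hd1' i _ v (hi ▸ hpH i) h1
      subst this
      rcases hσ j with h | h
      · exfalso; apply hxS; rw [← h.2, hi]; exact hvS
      · exact hd2' _ _ v (by rw [← hi, h.2]; exact hqH j) h2
    refine ⟨fun j => H1 (σ j) ∪ H2 j, fun j => ?_, fun j j' hne => ?_, fun j => ⟨?_, ?_⟩⟩
    · have c1 := (hc1 (σ j)).mono_le (h10.trans hlt.le)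
      have c2 := (hc2 j).mono_le (h20.trans hlt.le)
      rcases hσ j with h | h
      · exact c1.union_adj c2 (hpH (σ j)) (hqH j) (by rw [h.1, h.2]; exact hxy)
      · exact c1.union c2 ⟨q j, by rw [← h.2]; exact hpH _, hqH j⟩
    · rw [Set.disjoint_left]
      rintro v (h1 | h1) (h2 | h2)
      · exact hne (hσi _ _ (hd1' _ _ v h1 h2))
      · exact hne (hcross _ _ v h1 h2)
      · exact hne (hcross _ _ v h2 h1).symm
      · exact hne (hd2' _ _ v h1 h2)
    · exact (hm1 (σ j)).1.mono (inter_subset_inter_left _ subset_union_left)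
    · exact (hm2 j).2.mono (inter_subset_inter_left _ subset_union_right)
  · -- no edges
    push Not at hE
    have hcard : k ≤ (A ∩ B).toFinset.card := by
      by_contra hlt
      push Not at hlt
      obtain ⟨b, hb, hbS, hbL⟩ := (lk_iff.1 hk) _ hlt A (fun a ha _ => ha)
        (fun a _ _ b _ hab => absurd hab (hE a b))
      apply hbS
      simp; exact ⟨hbL, hb⟩
    obtain ⟨T, hT, hTc⟩ := Finset.exists_subset_card_eq hcard
    let e := T.equivFinOfCardEq hTc
    refine ⟨fun i => {(e.symm i : V)}, fun i => Conn.singleton _, fun i j hij => ?_, fun i => ?_⟩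
    · simp only [Set.disjoint_singleton]
      intro h
      exact hij (e.symm.injective (Subtype.ext h))
    · have := hT (e.symm i).2
      simp at this
      simpa using this

end GT

namespace GT

variable {V : Type} {G : SimpleGraph V}

/-- an r by r grid minor model -/
def GridMinor (r : ℕ) (G : SimpleGraph V) : Prop :=
  ∃ φ : ℕ → ℕ → Set V, (∀ i j, i < r → j < r → Conn G (φ i j)) ∧
    (∀ i j i' j', i < r → j < r → i' < r → j' < r → ¬(i = i' ∧ j = j') →
      Disjoint (φ i j) (φ i' j')) ∧
    (∀ i j, i + 1 < r → j < r → ∃ x ∈ φ i j, ∃ y ∈ φ (i + 1) j, G.Adj x y) ∧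
    (∀ i j, i < r → j + 1 < r → ∃ x ∈ φ i j, ∃ y ∈ φ i (j + 1), G.Adj x y)

/-- large connected graphs have a long path or a large star -/
lemma path_or_star {q r : ℕ} (hq : r ^ r < q) (Γ : SimpleGraph (Fin q)) (hc : Conn Γ Set.univ) :
    (∃ ρ : Fin r → Fin q, Function.Injective ρ ∧
      ∀ a b : Fin r, a.val + 1 = b.val → Γ.Adj (ρ a) (ρ b)) ∨
    (∃ (c : Fin q) (ρ : Fin r → Fin q), Function.Injective ρ ∧ ∀ a, Γ.Adj c (ρ a)) := by
  classical
  by_cases hdeg : ∃ c, r ≤ (Finset.univ.filter fun x => Γ.Adj c x).card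
  · right
    obtain ⟨c, hcd⟩ := hdeg
    obtain ⟨T, hT, hTc⟩ := Finset.exists_subset_card_eq hcd
    refine ⟨c, fun a => ((T.equivFinOfCardEq hTc).symm a : Fin q), ?_, ?_⟩
    · intro a b h
      exact (T.equivFinOfCardEq hTc).symm.injective (Subtype.ext h)
    · intro a
      have := hT ((T.equivFinOfCardEq hTc).symm a).2
      simpa using this
  · left
    push Not at hdeg
    have hq0 : 0 < q := by omega
    let root : Fin q := ⟨0, hq0⟩
    let Bl : ℕ → Finset (Fin q) := fun n => Nat.rec {root}
      (fun _ B => B.biUnion fun v => insert v (Finset.univ.filter fun x => Γ.Adj v x)) n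
    have hBs : ∀ n, Bl (n + 1) = (Bl n).biUnion fun v =>
      insert v (Finset.univ.filter fun x => Γ.Adj v x) := fun n => rfl
    have hBc : ∀ n, (Bl n).card ≤ r ^ n := by
      intro n
      induction n with
      | zero => simp [Bl]
      | succ n ih =>
        rw [hBs]
        refine (Finset.card_biUnion_le_card_mul _ _ r ?_).trans ?_
        · intro v _
          have := Finset.card_insert_le v (Finset.univ.filter fun x => Γ.Adj v x)
          have := hdeg v
          omega
        · rw [pow_succ]; exact Nat.mul_le_mul_right _ ih
    have hBm : ∀ n, Bl n ⊆ Bl (n + 1) := fun n v hv => by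
      rw [hBs, Finset.mem_biUnion]; exact ⟨v, hv, Finset.mem_insert_self _ _⟩
    obtain ⟨v, hv⟩ : ∃ v, v ∉ Bl r := by
      by_contra hno
      push Not at hno
      have : (Finset.univ : Finset (Fin q)) ⊆ Bl r := fun v _ => hno v
      have := Finset.card_le_card this
      have := hBc r
      simp at *
      omega
    obtain ⟨f, n, h0, hn, -, hadj, -, -, hinj, -⟩ :=
      hc.exists_ipath (A := {root}) (B := {v}) (by simp) (by simp)
    have hfB : ∀ i ≤ n, f i ∈ Bl i := by
      intro i hi
      induction i with
      | zero => simpa [Bl] using h0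
      | succ i ih =>
        rw [hBs, Finset.mem_biUnion]
        exact ⟨f i, ih (by omega), Finset.mem_insert_of_mem (by simpa using hadj i (by omega))⟩
    have hmono : Monotone Bl := monotone_nat_of_le_succ hBm
    have hrn : r < n := by
      by_contra hle
      push Not at hle
      apply hv
      have h1 : f n = v := by simpa using hn
      rw [← h1]
      exact hmono hle (hfB n le_rfl)
    refine ⟨fun a => f a.val, ?_, ?_⟩
    · intro a b hab
      by_contra hne
      have : a.val ≠ b.val := fun h => hne (Fin.ext h)
      rcases Nat.lt_or_ge a.val b.val with h | h
      · exact hinj _ _ h (by omega) hab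
      · exact hinj b.val a.val (by omega) (by omega) hab.symm
    · intro a b hab
      have := hadj a.val (by omega)
      rwa [hab] at this

lemma rows_tuple {q r : ℕ} (hq : r ^ r < q) {Y : Set V} (hY : Conn G Y) (R : Fin q → Set V)
    (hd : ∀ i j, i ≠ j → Disjoint (R i) (R j)) (hR : ∀ j, Conn G (Y ∩ R j)) :
    ∃ ρ : Fin r → Fin q, Function.Injective ρ ∧ ∀ a b : Fin r, a.val + 1 = b.val →
      ∃ X, Conn G X ∧ X ⊆ Y ∧ (X ∩ R (ρ a)).Nonempty ∧ (X ∩ R (ρ b)).Nonempty ∧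
        ∀ c, c ≠ a → c ≠ b → Disjoint X (R (ρ c)) := by
  classical
  have hdd : ∀ i j v, v ∈ R i → v ∈ R j → i = j := fun i j v h1 h2 => by
    by_contra hne; exact Set.disjoint_left.1 (hd i j hne) h1 h2
  let Γ : SimpleGraph (Fin q) := ⟨fun i j => i ≠ j ∧ ∃ X, Conn G X ∧ X ⊆ Y ∧ (X ∩ R i).Nonempty ∧
    (X ∩ R j).Nonempty ∧ ∀ c, c ≠ i → c ≠ j → Disjoint X (R c),
    ⟨fun i j h => ⟨h.1.symm, by
      obtain ⟨X, h1, h2, h3, h4, h5⟩ := h.2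
      exact ⟨X, h1, h2, h4, h3, fun c hc hc' => h5 c hc' hc⟩⟩⟩, ⟨fun i h => h.1 rfl⟩⟩
  have hΓ : Conn Γ Set.univ := by
    refine ⟨⟨⟨0, by omega⟩, trivial⟩, fun C _ ⟨c, hc⟩ hcl => ?_⟩
    by_contra hno
    obtain ⟨d, -, hdC⟩ := Set.not_subset.1 hno
    obtain ⟨f, n, ⟨i, hi, h0⟩, ⟨j, hj, hn⟩, hfY, hadj, hA, hB, -, -⟩ :=
      hY.exists_ipath (A := {v | ∃ i ∈ C, v ∈ R i}) (B := {v | ∃ j, j ∉ C ∧ v ∈ R j})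
      (by obtain ⟨x, hx, hx'⟩ := (hR c).1; exact ⟨x, hx, c, hc, hx'⟩)
      (by obtain ⟨x, hx, hx'⟩ := (hR d).1; exact ⟨x, hx, d, hdC, hx'⟩)
    refine hj (hcl i hi j trivial ⟨fun h => hj (h ▸ hi), f '' {i | 0 ≤ i ∧ i < n + 1},
      conn_interval (by omega) (fun i _ h => hadj i (by omega)), ?_, ?_, ?_, ?_⟩)
    · rintro _ ⟨a, ha, rfl⟩
      have := ha.2
      exact hfY a (by omega)
    · exact ⟨f 0, ⟨0, by simp, rfl⟩, h0⟩
    · exact ⟨f n, ⟨n, by simp, rfl⟩, hn⟩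
    · intro c hci hcj
      rw [Set.disjoint_left]
      rintro _ ⟨a, ⟨-, ha⟩, rfl⟩ hac
      by_cases hcC : c ∈ C
      · have := hA a (by omega) ⟨c, hcC, hac⟩
        subst this
        exact hci (hdd _ _ _ hac h0)
      · have := hB a (by omega) ⟨c, hcC, hac⟩
        subst this
        exact hcj (hdd _ _ _ hac hn)
  rcases path_or_star hq Γ hΓ with ⟨ρ, hρ, hadj⟩ | ⟨c, ρ, hρ, hadj⟩
  · refine ⟨ρ, hρ, fun a b hab => ?_⟩
    obtain ⟨-, X, h1, h2, h3, h4, h5⟩ := hadj a b hab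
    exact ⟨X, h1, h2, h3, h4, fun c hca hcb => h5 _ (fun h => hca (hρ h)) (fun h => hcb (hρ h))⟩
  · refine ⟨ρ, hρ, fun a b hab => ?_⟩
    obtain ⟨-, X, h1, h2, ⟨x, hxX, hxc⟩, h4, h5⟩ := hadj a
    obtain ⟨hcb, X', h1', h2', ⟨x', hxX', hxc'⟩, h4', h5'⟩ := hadj b
    have hc1 : Conn G (X ∪ (Y ∩ R c)) := h1.union (hR c) ⟨x, hxX, h2 hxX, hxc⟩
    have hc2 : Conn G (X ∪ (Y ∩ R c) ∪ X') :=
      hc1.union h1' ⟨x', Or.inr ⟨h2' hxX', hxc'⟩, hxX'⟩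
    refine ⟨_, hc2, union_subset (union_subset h2 inter_subset_left) h2', ?_, ?_, ?_⟩
    · exact h4.mono (inter_subset_inter_left _ (subset_union_left.trans subset_union_left))
    · exact h4'.mono (inter_subset_inter_left _ subset_union_right)
    · intro d hda hdb
      have hdc : ρ d ≠ c := fun h => (hadj d).1 h.symm
      rw [Set.disjoint_left]
      rintro v ((hv | hv) | hv) hvd
      · exact Set.disjoint_left.1 (h5 _ hdc (fun h => hda (hρ h))) hv hvd
      · exact hdc (hdd _ _ _ hvd hv.2)
      · exact Set.disjoint_left.1 (h5' _ hdc (fun h => hdb (hρ h))) hv hvd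

/-- sorting a finite set along an injective function -/
lemma exists_sorted {ι : Type*} [hne : Nonempty ι] (I : Finset ι) (m : ι → ℕ) (hm : Set.InjOn m I) :
    ∃ u : ℕ → ι, (∀ a < I.card, u a ∈ I) ∧ ∀ a b, a < b → b < I.card → m (u a) < m (u b) := by
  classical
  have hcard : (I.image m).card = I.card := Finset.card_image_of_injOn hm
  let g := (I.image m).orderEmbOfFin hcard
  have : ∀ a : Fin I.card, ∃ i ∈ I, m i = g a := fun a => by
    have := (I.image m).orderEmbOfFin_mem hcard a
    exact Finset.mem_image.1 this
  choose v hv hv' using this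
  refine ⟨fun a => if h : a < I.card then v ⟨a, h⟩ else hne.some, ?_, ?_⟩
  · intro a ha
    simp only [ha, dif_pos]; exact hv _
  · intro a b hab hb
    have ha : a < I.card := by omega
    simp only [ha, hb, dif_pos, hv']
    exact g.strictMono (by simpa using hab)

lemma mesh_grid (r : ℕ) : ∃ q K : ℕ, ∀ (V : Type) (G : SimpleGraph V) (f : Fin q → ℕ → V)
    (len : Fin q → ℕ) (W : ℕ → Set V),
    (∀ j a, a < len j → G.Adj (f j a) (f j (a + 1))) →
    (∀ j j' a a', a ≤ len j → a' ≤ len j' → f j a = f j' a' → j = j' ∧ a = a') →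
    (∀ k < K, Conn G (W k)) → (∀ k k', k < k' → k' < K → Disjoint (W k) (W k')) →
    (∀ k < K, ∀ j, ∃ a ≤ len j, f j a ∈ W k) →
    (∀ k k', k < k' → k' < K → ∀ j a a', a ≤ len j → a' ≤ len j → f j a ∈ W k → f j a' ∈ W k' →
      a < a') → GridMinor r G := by
  classical
  refine ⟨r ^ r + 1, (r ^ r + 1) ^ r * (r * r + 1) + 1, ?_⟩
  set q := r ^ r + 1 with hq
  set Z := q ^ r * (r * r + 1) with hZ
  intro V G f len W hadj hinj hWc hWd hmeet hord
  -- first hits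
  have hlo : ∀ j k, k < Z + 1 → ∃ a, a ≤ len j ∧ f j a ∈ W k ∧
      ∀ b ≤ len j, f j b ∈ W k → a ≤ b := by
    intro j k hk
    have hex := hmeet k hk j
    exact ⟨Nat.find hex, (Nat.find_spec hex).1, (Nat.find_spec hex).2,
      fun b hb hbW => Nat.find_min' hex ⟨hb, hbW⟩⟩
  choose! lo hlol hloW hlomin using hlo
  have hlolt : ∀ j k k', k < k' → k' < Z + 1 → lo j k < lo j k' := fun j k k' h h' =>
    hord k k' h h' j _ _ (hlol j k (by omega)) (hlol j k' h') (hloW j k (by omega)) (hloW j k' h')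
  have hlole : ∀ j k k', k ≤ k' → k' < Z + 1 → lo j k ≤ lo j k' := fun j k k' h h' => by
    rcases Nat.lt_or_ge k k' with h1 | h1
    · exact (hlolt j k k' h1 h').le
    · have : k = k' := by omega
      rw [this]
  have hWlt : ∀ j k a, k < Z → a ≤ len j → f j a ∈ W k → lo j k ≤ a ∧ a < lo j (k + 1) :=
    fun j k a hk ha haW => ⟨hlomin j k (by omega) a ha haW,
      hord k (k + 1) (by omega) (by omega) j _ _ ha (hlol j (k + 1) (by omega)) haW
        (hloW j (k + 1) (by omega))⟩
  -- intervals
  let Iv : Fin q → ℕ → ℕ → Set V := fun j k k' => f j '' {i | lo j k ≤ i ∧ i < lo j k'}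
  let Y : ℕ → Set V := fun k => W k ∪ ⋃ j, Iv j k (k + 1)
  let R : Fin q → Set V := fun j => f j '' {i | i ≤ len j}
  have hIvR : ∀ j k k', k' < Z + 1 → Iv j k k' ⊆ R j := by
    rintro j k k' hk' _ ⟨i, hi, rfl⟩
    have := hlol j k' hk'
    exact ⟨i, by have := hi.2; simp; omega, rfl⟩
  have hRd : ∀ i j, i ≠ j → Disjoint (R i) (R j) := by
    intro i j hij
    rw [Set.disjoint_left]
    rintro _ ⟨a, ha, rfl⟩ ⟨b, hb, hab⟩
    exact hij (hinj _ _ _ _ ha hb hab.symm).1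
  have hRdd : ∀ i j v, v ∈ R i → v ∈ R j → i = j := fun i j v h1 h2 => by
    by_contra hne; exact Set.disjoint_left.1 (hRd i j hne) h1 h2
  have hIvc : ∀ j k k', k < k' → k' < Z + 1 → Conn G (Iv j k k') := by
    intro j k k' h h'
    have := hlol j k' h'
    exact conn_interval (hlolt j k k' h h') (fun i _ hi => hadj j i (by omega))
  have hYR : ∀ k < Z, ∀ j, Y k ∩ R j = Iv j k (k + 1) := by
    intro k hk j
    ext v
    constructor
    · rintro ⟨hv | hv, a, ha, rfl⟩
      · exact ⟨a, hWlt j k a hk ha hv, rfl⟩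
      · rw [mem_iUnion] at hv
        obtain ⟨j', hj'⟩ := hv
        have := hRdd j' j _ (hIvR j' k (k + 1) (by omega) hj') ⟨a, ha, rfl⟩
        rwa [this] at hj'
    · intro hv
      exact ⟨Or.inr (mem_iUnion.2 ⟨j, hv⟩), hIvR j k (k + 1) (by omega) hv⟩
  have hYc : ∀ k < Z, Conn G (Y k) := by
    intro k hk
    refine (hWc k (by omega)).iUnion_core _ fun j => ?_
    exact (hWc k (by omega)).union (hIvc j k (k + 1) (by omega) (by omega))
      ⟨f j (lo j k), hloW j k (by omega), lo j k,
        ⟨le_rfl, hlolt j k (k + 1) (by omega) (by omega)⟩, rfl⟩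
  have hIvd : ∀ j k1 k2 k3 k4 v, k2 ≤ k3 → k2 < Z + 1 → k3 < Z + 1 → k4 < Z + 1 →
      v ∈ Iv j k1 k2 → v ∈ Iv j k3 k4 → False := by
    rintro j k1 k2 k3 k4 v h h2 h3 h4 ⟨a, ha, rfl⟩ ⟨b, hb, hab⟩
    have e1 := ha.2
    have e2 := hb.1
    have e3 := hb.2
    have := hlole j k2 k3 h h3
    have := hlol j k2 h2
    have := hlol j k4 h4
    have := (hinj j j b a (by omega) (by omega) hab).2
    omega
  have hYd0 : ∀ k k' v, k < k' → k' < Z → v ∈ Y k → v ∈ Y k' → False := by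
    intro k k' v h h' hv hv'
    have key : ∀ j, v ∈ R j → False := fun j hj => by
      have h1 : v ∈ Iv j k (k + 1) := by rw [← hYR k (by omega) j]; exact ⟨hv, hj⟩
      have h2 : v ∈ Iv j k' (k' + 1) := by rw [← hYR k' (by omega) j]; exact ⟨hv', hj⟩
      exact hIvd j _ _ _ _ v (by omega) (by omega) (by omega) (by omega) h1 h2
    rcases hv with hv | hv
    · rcases hv' with hv' | hv'
      · exact Set.disjoint_left.1 (hWd k k' h (by omega)) hv hv'
      · obtain ⟨j, hj⟩ := mem_iUnion.1 hv'
        exact key j (hIvR _ _ _ (by omega) hj)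
    · obtain ⟨j, hj⟩ := mem_iUnion.1 hv
      exact key j (hIvR _ _ _ (by omega) hj)
  have hYd : ∀ k k' v, k < Z → k' < Z → v ∈ Y k → v ∈ Y k' → k = k' := by
    intro k k' v h h' hv hv'
    rcases Nat.lt_trichotomy k k' with h1 | h1 | h1
    · exact (hYd0 k k' v h1 h' hv hv').elim
    · exact h1
    · exact (hYd0 k' k v h1 h hv' hv).elim
  -- tuples
  have htup := fun k (hk : k < Z) => rows_tuple (G := G) (q := q) (r := r) (by omega) (hYc k hk) R hRd
    (fun j => by rw [hYR k hk j]; exact hIvc j k (k + 1) (by omega) (by omega))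
  choose ρ hρ hX using htup
  obtain ⟨ρ0, -, hfib⟩ := Finset.exists_le_card_fiber_of_mul_le_card_of_maps_to
    (s := (Finset.univ : Finset (Fin Z))) (t := (Finset.univ : Finset (Fin r → Fin q)))
    (f := fun k => ρ k.val k.2) (n := r * r + 1) (fun _ _ => Finset.mem_univ _)
    ⟨fun _ => ⟨0, by omega⟩, Finset.mem_univ _⟩ (by simp [hZ])
  set F := Finset.univ.filter (fun k : Fin Z => ρ k.val k.2 = ρ0) with hF
  have hZ0 : 0 < Z := by positivity
  have : Nonempty (Fin Z) := ⟨⟨0, hZ0⟩⟩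
  obtain ⟨u, huF, hult⟩ := exists_sorted F (fun k => k.val) (fun a _ b _ h => Fin.ext h)
  have hu : ∀ a < r * r + 1, ρ (u a).val (u a).2 = ρ0 := fun a ha => by
    have := huF a (by omega)
    simpa [hF] using this
  have hult' : ∀ a b, a < b → b < r * r + 1 → (u a).val < (u b).val := fun a b h h' =>
    hult a b h (by omega)
  have hule' : ∀ a b, a ≤ b → b < r * r + 1 → (u a).val ≤ (u b).val := fun a b h h' => by
    rcases Nat.lt_or_ge a b with h1 | h1
    · exact (hult' a b h1 h').le
    · have : a = b := by omega
      rw [this]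
  have hρ0 : Function.Injective ρ0 := by
    rw [← hu 0 (by omega)]; exact hρ _ _
  -- connecting pieces
  have hP : ∀ z < r * r + 1, ∀ a b : Fin r, a.val + 1 = b.val → ∃ P : Set V, Conn G P ∧
      P ⊆ Y (u z).val ∧ (P ∩ R (ρ0 a)).Nonempty ∧ (∀ c, c ≠ a → Disjoint P (R (ρ0 c))) ∧
      ∃ x ∈ P, ∃ y ∈ Y (u z).val ∩ R (ρ0 b), G.Adj x y := by
    intro z hz a b hab
    obtain ⟨X, hXc, hXY, hXa, hXb, hXo⟩ := hX (u z).val (u z).2 a b hab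
    rw [hu z hz] at hXa hXb hXo
    obtain ⟨g, n, g0, gn, gX, gadj, gA, gB, -, -⟩ := hXc.exists_ipath hXa hXb
    have hab' : a ≠ b := fun h => by rw [h] at hab; omega
    have hn0 : 0 < n := by
      by_contra h
      have : n = 0 := by omega
      subst this
      exact hab' (hρ0 (hRdd _ _ _ g0 gn))
    refine ⟨g '' {i | 0 ≤ i ∧ i < n}, conn_interval hn0 (fun i _ h => gadj i (by omega)), ?_,
      ⟨g 0, ⟨0, ⟨le_rfl, hn0⟩, rfl⟩, g0⟩, ?_, g (n - 1), ⟨n - 1, ⟨by omega, by omega⟩, rfl⟩, g n,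
      ⟨hXY (gX n le_rfl), gn⟩, ?_⟩
    · rintro _ ⟨i, hi, rfl⟩
      exact hXY (gX i hi.2.le)
    · intro c hc
      rw [Set.disjoint_left]
      rintro _ ⟨i, ⟨-, hi⟩, rfl⟩ hic
      by_cases hcb : c = b
      · subst hcb
        have := gB i hi.le hic
        omega
      · exact Set.disjoint_left.1 (hXo c hc hcb) (gX i hi.le) hic
    · have := gadj (n - 1) (by omega)
      rwa [show n - 1 + 1 = n by omega] at this
  let ρ1 : ℕ → Fin q := fun a => if h : a < r then ρ0 ⟨a, h⟩ else ⟨0, by omega⟩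
  have hρ1 : ∀ a (h : a < r), ρ1 a = ρ0 ⟨a, h⟩ := fun a h => by simp [ρ1, h]
  have hρ1i : ∀ a b, a < r → b < r → ρ1 a = ρ1 b → a = b := fun a b ha hb h => by
    rw [hρ1 a ha, hρ1 b hb] at h
    simpa using hρ0 h
  have hcr : ∀ c < r, c * r + r ≤ r * r := fun c hc => by
    have : (c + 1) * r ≤ r * r := Nat.mul_le_mul_right r hc
    linarith
  have hIvY : ∀ a c, a < r → c < r → ∀ j, Y (u (c * r + a)).val ∩ R j ⊆
      Iv j (u (c * r)).val (u (c * r + r)).val := by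
    intro a c ha hc j
    have := hcr c hc
    rw [hYR _ (u _).2]
    rintro _ ⟨i, hi, rfl⟩
    have h1 := hlole j (u (c * r)).val (u (c * r + a)).val (hule' _ _ (by omega) (by omega))
      (by have := (u (c * r + a)).2; omega)
    have h2 := hlole j ((u (c * r + a)).val + 1) (u (c * r + r)).val
      (hult' _ _ (by omega) (by omega)) (by have := (u (c * r + r)).2; omega)
    have h3 := hi.1
    have h4 := hi.2
    exact ⟨i, ⟨by omega, by omega⟩, rfl⟩
  have hIc : ∀ c < r, ∀ j, Conn G (Iv j (u (c * r)).val (u (c * r + r)).val) := by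
    intro c hc j
    have := hcr c hc
    exact hIvc j _ _ (hult' _ _ (by omega) (by omega)) (by have := (u (c * r + r)).2; omega)
  have hP3 : ∀ a c, ∃ P : Set V, a < r → c < r → P ⊆ Y (u (c * r + a)).val ∧
      (∀ b < r, b ≠ a → Disjoint P (R (ρ1 b))) ∧
      Conn G (Iv (ρ1 a) (u (c * r)).val (u (c * r + r)).val ∪ P) ∧
      (a + 1 < r → ∃ x ∈ P, ∃ y ∈ Y (u (c * r + a)).val ∩ R (ρ1 (a + 1)), G.Adj x y) := by
    intro a c
    by_cases ha : a + 1 < r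
    · by_cases hc : c < r
      · have := hcr c hc
        obtain ⟨P, h1, h2, ⟨x, hxP, hxR⟩, h4, h5⟩ := hP (c * r + a) (by omega) ⟨a, by omega⟩
          ⟨a + 1, ha⟩ rfl
        refine ⟨P, fun _ _ => ⟨h2, fun b hb hba => ?_, ?_, fun _ => ?_⟩⟩
        · rw [hρ1 b hb]
          exact h4 _ (by simpa using hba)
        · refine (hIc c hc _).union h1 ⟨x, hIvY a c (by omega) hc _ ⟨h2 hxP, ?_⟩, hxP⟩
          rw [hρ1 a (by omega)]; exact hxR
        · rw [hρ1 (a + 1) ha]; exact h5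
      · exact ⟨∅, fun _ h => absurd h hc⟩
    · refine ⟨∅, fun _ hc => ⟨empty_subset _, by simp, ?_, fun h => absurd h ha⟩⟩
      rw [union_empty]
      exact hIc c hc _
  choose P hPY hPd hPc hPa using hP3
  have hIP : ∀ a c a' c' v, a < r → c < r → a' < r → c' < r → ¬ (a = a' ∧ c = c') →
      v ∈ Iv (ρ1 a) (u (c * r)).val (u (c * r + r)).val → v ∈ P a' c' → False := by
    intro a c a' c' v ha hc ha' hc' hne hv hv'
    have e1 := hcr c hc
    have e2 := hcr c' hc'
    have hvR : v ∈ R (ρ1 a) := hIvR _ _ _ (by have := (u (c * r + r)).2; omega) hv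
    by_cases haa : a = a'
    · subst haa
      have h3 := hIvY a c' ha hc' _ ⟨hPY a c' ha hc' hv', hvR⟩
      have b1 := (u (c * r + r)).2
      have b2 := (u (c' * r + r)).2
      have b3 := (u (c * r)).2
      have b4 := (u (c' * r)).2
      rcases Nat.lt_trichotomy c c' with h | h | h
      · have h5 : (c + 1) * r ≤ c' * r := Nat.mul_le_mul_right r h
        have h6 : c * r + r ≤ c' * r := by linarith
        exact hIvd _ _ _ _ _ v (hule' _ _ h6 (by omega)) (by omega) (by omega) (by omega) hv h3
      · exact hne ⟨rfl, h⟩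
      · have h5 : (c' + 1) * r ≤ c * r := Nat.mul_le_mul_right r h
        have h6 : c' * r + r ≤ c * r := by linarith
        exact hIvd _ _ _ _ _ v (hule' _ _ h6 (by omega)) (by omega) (by omega) (by omega) h3 hv
    · exact Set.disjoint_left.1 (hPd a' c' ha' hc' a ha haa) hv' hvR
  refine ⟨fun a c => Iv (ρ1 a) (u (c * r)).val (u (c * r + r)).val ∪ P a c, ?_, ?_, ?_, ?_⟩
  · intro a c ha hc
    exact hPc a c ha hc
  · intro a c a' c' ha hc ha' hc' hne
    rw [Set.disjoint_left]
    have e1 := hcr c hc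
    have e2 := hcr c' hc'
    rintro v (hv | hv) (hv' | hv')
    · have b1 := (u (c * r + r)).2
      have b2 := (u (c' * r + r)).2
      have b3 := (u (c * r)).2
      have b4 := (u (c' * r)).2
      have haa : a = a' := hρ1i _ _ ha ha' (hRdd _ _ v (hIvR _ _ _ (by omega) hv)
        (hIvR _ _ _ (by omega) hv'))
      subst haa
      rcases Nat.lt_trichotomy c c' with h | h | h
      · have h5 : (c + 1) * r ≤ c' * r := Nat.mul_le_mul_right r h
        have h6 : c * r + r ≤ c' * r := by linarith
        exact hIvd _ _ _ _ _ v (hule' _ _ h6 (by omega)) (by omega) (by omega) (by omega) hv hv'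
      · exact hne ⟨rfl, h⟩
      · have h5 : (c' + 1) * r ≤ c * r := Nat.mul_le_mul_right r h
        have h6 : c' * r + r ≤ c * r := by linarith
        exact hIvd _ _ _ _ _ v (hule' _ _ h6 (by omega)) (by omega) (by omega) (by omega) hv' hv
    · exact hIP a c a' c' v ha hc ha' hc' hne hv hv'
    · exact hIP a' c' a c v ha' hc' ha hc (fun h => hne ⟨h.1.symm, h.2.symm⟩) hv' hv
    · have h := hYd _ _ v (u _).2 (u _).2 (hPY a c ha hc hv) (hPY a' c' ha' hc' hv')
      have hz : c * r + a = c' * r + a' := by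
        rcases Nat.lt_trichotomy (c * r + a) (c' * r + a') with h1 | h1 | h1
        · have := hult' _ _ h1 (by omega); omega
        · exact h1
        · have := hult' _ _ h1 (by omega); omega
      have h1 : a = a' := by
        have := congrArg (· % r) hz
        simpa [Nat.mod_eq_of_lt ha, Nat.mod_eq_of_lt ha', Nat.add_mod, Nat.mul_mod_left] using this
      subst h1
      have : c * r = c' * r := by omega
      exact hne ⟨rfl, Nat.eq_of_mul_eq_mul_right (by omega) this⟩
  · intro a c ha hc
    obtain ⟨x, hx, y, hy, hxy⟩ := hPa a c (by omega) hc ha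
    exact ⟨x, Or.inr hx, y, Or.inl (hIvY a c (by omega) hc _ hy), hxy⟩
  · intro a c ha hc
    have e1 := hcr c (by omega)
    have e2 := hcr (c + 1) hc
    have e3 : (c + 1) * r = c * r + r := by ring
    have b1 := (u (c * r + r)).2
    have b2 := (u (c * r + r + r)).2
    rw [e3] at e2
    have l1 := hlolt (ρ1 a) (u (c * r)).val (u (c * r + r)).val
      (hult' _ _ (by omega) (by omega)) (by omega)
    have l2 := hlolt (ρ1 a) (u (c * r + r)).val (u (c * r + r + r)).val
      (hult' _ _ (by omega) (by omega)) (by omega)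
    have l3 := hlol (ρ1 a) (u (c * r + r)).val (by omega)
    refine ⟨f (ρ1 a) (lo (ρ1 a) (u (c * r + r)).val - 1), Or.inl ⟨_, ⟨by omega, by omega⟩, rfl⟩,
      f (ρ1 a) (lo (ρ1 a) (u (c * r + r)).val), Or.inl ?_, ?_⟩
    · rw [e3]
      exact ⟨_, ⟨le_rfl, l2⟩, rfl⟩
    · have := hadj (ρ1 a) (lo (ρ1 a) (u (c * r + r)).val - 1) (by omega)
      rwa [Nat.sub_add_cancel (by omega)] at this

end GT

namespace GT

variable {V : Type} {G : SimpleGraph V}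

/-- deleting one edge of a linkage orders the connected sets along the other paths -/
lemma sep_step {n : ℕ} {A B : Set V} {f : Fin n → ℕ → V} {len : Fin n → ℕ}
    (hadj : ∀ j a, a < len j → G.Adj (f j a) (f j (a + 1)))
    (hinj : ∀ j j' a a', a ≤ len j → a' ≤ len j' → f j a = f j' a' → j = j' ∧ a = a')
    (hA : ∀ j, f j 0 ∈ A) (hB : ∀ j, f j (len j) ∈ B) (js : Fin n) (m : ℕ) (hm0 : 0 < m)
    (hm : m ≤ len js) (hno : ¬ Lk (G.deleteEdges {s(f js (m - 1), f js m)}) A B n) :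
    ∃ S : Finset V, S.card < n ∧ ∀ U U' : Set V, Conn G U → Conn G U' → Disjoint U S →
      Disjoint U' S → ¬ (f js (m - 1) ∈ U ∧ f js m ∈ U) → ¬ (f js (m - 1) ∈ U' ∧ f js m ∈ U') →
      (∃ p, p < m ∧ f js p ∈ U) → (∃ p, m ≤ p ∧ p ≤ len js ∧ f js p ∈ U') →
      ∀ j, j ≠ js → ∀ a a', a ≤ len j → a' ≤ len j → f j a ∈ U → f j a' ∈ U' → a < a' := by
  classical
  rw [lk_iff] at hno
  push Not at hno
  obtain ⟨S, hS, L, hAL, hcl, hBL⟩ := hno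
  set x := f js (m - 1) with hx
  set y := f js m with hy
  have hG' : ∀ u v, G.Adj u v → ¬ (u = x ∧ v = y) → ¬ (u = y ∧ v = x) →
      (G.deleteEdges {s(x, y)}).Adj u v := by
    intro u v huv h1 h2
    rw [deleteEdges_adj]
    refine ⟨huv, fun h => ?_⟩
    simp only [mem_singleton_iff, Sym2.eq_iff] at h
    tauto
  have hedge : ∀ j a, a < len j → (j ≠ js ∨ a + 1 ≠ m) →
      (G.deleteEdges {s(x, y)}).Adj (f j a) (f j (a + 1)) := by
    intro j a ha h
    refine hG' _ _ (hadj j a ha) ?_ ?_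
    · rintro ⟨-, h2⟩
      have := hinj _ _ _ _ (by omega) (by omega) h2
      tauto
    · rintro ⟨h1, h2⟩
      have e1 := hinj _ _ _ _ (by omega) (by omega) h1
      have e2 := hinj _ _ _ _ (by omega) (by omega) h2
      omega
  -- propagation along paths
  have hup : ∀ j a b, a ≤ b → b ≤ len j → (∀ c, a ≤ c → c ≤ b → f j c ∉ S) →
      (∀ c, a ≤ c → c < b → (j ≠ js ∨ c + 1 ≠ m)) → f j a ∈ L → f j b ∈ L := by
    intro j a b hab hb hcS hce haL
    induction b, hab using Nat.le_induction with
    | base => exact haL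
    | succ b hab ih =>
      have := ih (by omega) (fun c h1 h2 => hcS c h1 (by omega)) (fun c h1 h2 => hce c h1 (by omega))
      exact hcl _ this (hcS b hab (by omega)) _ (hcS (b + 1) (by omega) le_rfl)
        (hedge j b (by omega) (hce b hab (by omega)))
  have hσ : ∀ j, ∃ a, j ≠ js → a ≤ len j ∧ f j a ∈ S := by
    intro j
    by_contra hcon
    push Not at hcon
    have hj := (hcon 0).1
    have hnS : ∀ a ≤ len j, f j a ∉ S := fun a ha => (hcon a).2 ha
    exact hBL _ (hB j) (hnS _ le_rfl) (hup j 0 (len j) (by omega) le_rfl (fun c _ h => hnS c h)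
      (fun _ _ _ => Or.inl hj) (hAL _ (hA j) (hnS 0 (by omega))))
  choose σ hσ using hσ
  have hSeq : (Finset.univ.erase js).image (fun j => f j (σ j)) = S := by
    apply Finset.eq_of_subset_of_card_le
    · intro v hv
      simp only [Finset.mem_image, Finset.mem_erase] at hv
      obtain ⟨j, hj, rfl⟩ := hv
      exact (hσ j hj.1).2
    · rw [Finset.card_image_of_injOn]
      · simp; omega
      · intro j hj j' hj' h
        simp at hj hj'
        exact (hinj _ _ _ _ (hσ j hj).1 (hσ j' hj').1 h).1
  have hSm : ∀ j a, a ≤ len j → f j a ∈ S → j ≠ js ∧ a = σ j := by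
    intro j a ha h
    rw [← hSeq] at h
    simp only [Finset.mem_image, Finset.mem_erase] at h
    obtain ⟨j', hj', h⟩ := h
    have := hinj _ _ _ _ (hσ j' hj'.1).1 ha h
    obtain ⟨rfl, rfl⟩ := this
    exact ⟨hj'.1, rfl⟩
  have hjs1 : ∀ p < m, f js p ∈ L := fun p hp =>
    hup js 0 p (by omega) (by omega) (fun c _ h hc => (hSm js c (by omega) hc).1 rfl)
      (fun c _ h => Or.inr (by omega)) (hAL _ (hA js) fun hc => (hSm js 0 (by omega) hc).1 rfl)
  have hjs2 : ∀ p, m ≤ p → p ≤ len js → f js p ∉ L := fun p hp hp' hpL =>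
    hBL _ (hB js) (fun hc => (hSm js _ le_rfl hc).1 rfl)
      (hup js p (len js) hp' le_rfl (fun c _ h hc => (hSm js c (by omega) hc).1 rfl)
      (fun c _ h => Or.inr (by omega)) hpL)
  have hj1 : ∀ j, j ≠ js → ∀ a < σ j, f j a ∈ L := fun j hj a ha => by
    have := (hσ j hj).1
    have hnS : ∀ c < σ j, f j c ∉ S := fun c hc h => by
      have := (hSm j c (by omega) h).2
      omega
    exact hup j 0 a (by omega) (by omega) (fun c _ h => hnS c (by omega)) (fun _ _ _ => Or.inl hj)
      (hAL _ (hA j) (hnS 0 (by omega)))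
  have hj2 : ∀ j, j ≠ js → ∀ a, σ j < a → a ≤ len j → f j a ∉ L := fun j hj a ha ha' haL => by
    have hnS : ∀ c, σ j < c → c ≤ len j → f j c ∉ S := fun c hc hc' h => by
      have := (hSm j c (by omega) h).2
      omega
    exact hBL _ (hB j) (hnS _ (by omega) le_rfl) (hup j a (len j) ha' le_rfl
      (fun c _ h => hnS c (by omega) h) (fun _ _ _ => Or.inl hj) haL)
  refine ⟨S, hS, ?_⟩
  intro U U' hU hU' hUS hUS' hUe hUe' ⟨p, hp, hpU⟩ ⟨p', hp', hp'l, hpU'⟩ j hj a a' ha ha' haU haU'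
  have nS : ∀ v ∈ U, v ∉ S := fun v hv h => Set.disjoint_left.1 hUS hv h
  have nS' : ∀ v ∈ U', v ∉ S := fun v hv h => Set.disjoint_left.1 hUS' hv h
  have h1 : U ⊆ L := hU.closed ⟨_, hpU, hjs1 p hp⟩ fun u hu huL v hv huv =>
    hcl u huL (nS u hu) v (nS v hv) (hG' u v huv (by rintro ⟨rfl, rfl⟩; exact hUe ⟨hu, hv⟩)
      (by rintro ⟨rfl, rfl⟩; exact hUe ⟨hv, hu⟩))
  have h2 : U' ⊆ Lᶜ := hU'.closed ⟨_, hpU', hjs2 p' hp' hp'l⟩ fun u hu huL v hv huv hvL =>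
    huL (hcl v hvL (nS' v hv) u (nS' u hu) (hG' v u huv.symm
      (by rintro ⟨rfl, rfl⟩; exact hUe' ⟨hv, hu⟩) (by rintro ⟨rfl, rfl⟩; exact hUe' ⟨hu, hv⟩)))
  have e1 : a ≠ σ j := fun h => nS _ haU (h ▸ (hσ j hj).2)
  have e2 : a' ≠ σ j := fun h => nS' _ haU' (h ▸ (hσ j hj).2)
  have e3 : ¬ σ j < a := fun h => hj2 j hj a h ha (h1 haU)
  have e4 : ¬ a' < σ j := fun h => h2 haU' (hj1 j hj a' h)
  omega

open Classical in
theorem core (r : ℕ) : ∃ s : ℕ, ∀ n : ℕ, ∃ D : ℕ, ∀ (V : Type) [Finite V] (G : SimpleGraph V)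
    (A B : Set V) (N : ℕ) (Vs : Fin N → Set V), (∀ i, Conn G (Vs i)) →
    (∀ i j, i ≠ j → Disjoint (Vs i) (Vs j)) → Lk G A B n → ¬ GridMinor r G →
    ∃ H, IsLinkage G A B n H ∧ (Finset.univ.filter fun i =>
      s ≤ (Finset.univ.filter fun j => (Vs i ∩ H j).Nonempty).card).card < D := by
  obtain ⟨q, K, hmesh⟩ := mesh_grid r
  refine ⟨q + 1, fun n => ⟨2 ^ n * (1 + K * (K * n + 1)), ?_⟩⟩
  intro V _ G A B N Vs hVc hVd hLk hgrid
  have := Fintype.ofFinite V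
  obtain ⟨G0, ⟨hG0, hG0V, hG0L⟩, hmin⟩ := WellFounded.has_min
    (wellFounded_lt (α := SimpleGraph V)) {G0 | G0 ≤ G ∧ (∀ i, ∀ x ∈ Vs i, ∀ y ∈ Vs i,
      G.Adj x y → G0.Adj x y) ∧ Lk G0 A B n} ⟨G, le_rfl, fun _ _ _ _ _ h => h, hLk⟩
  have hdel : ∀ x y, G0.Adj x y → (∀ i, ¬ (x ∈ Vs i ∧ y ∈ Vs i)) →
      ¬ Lk (G0.deleteEdges {s(x, y)}) A B n := by
    intro x y hxy hni hl
    refine hmin (G0.deleteEdges {s(x, y)}) ⟨(deleteEdges_le _).trans hG0, ?_, hl⟩ ?_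
    · intro i u hu v hv huv
      rw [deleteEdges_adj]
      refine ⟨hG0V i u hu v hv huv, fun h => ?_⟩
      simp only [mem_singleton_iff, Sym2.eq_iff] at h
      rcases h with ⟨rfl, rfl⟩ | ⟨rfl, rfl⟩
      · exact hni i ⟨hu, hv⟩
      · exact hni i ⟨hv, hu⟩
    · refine lt_of_le_of_ne (deleteEdges_le _) fun he => ?_
      rw [← he] at hxy
      simp at hxy
  obtain ⟨H0, hH0c, hH0d, hH0m⟩ := menger G0 A B n hG0L
  choose f len hA hB hfH hadj _ _ hfi _ using
    fun j => (hH0c j).exists_ipath (hH0m j).1 (hH0m j).2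
  have hinj : ∀ j j' a a', a ≤ len j → a' ≤ len j' → f j a = f j' a' → j = j' ∧ a = a' := by
    intro j j' a a' ha ha' h
    have hj : j = j' := by
      by_contra hne
      exact Set.disjoint_left.1 (hH0d j j' hne) (hfH j a ha) (h ▸ hfH j' a' ha')
    subst hj
    refine ⟨rfl, ?_⟩
    rcases Nat.lt_trichotomy a a' with h1 | h1 | h1
    · exact (hfi j a a' h1 ha' h).elim
    · exact h1
    · exact (hfi j a' a h1 ha h.symm).elim
  let H : Fin n → Set V := fun j => f j '' {i | 0 ≤ i ∧ i < len j + 1}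
  have hH : IsLinkage G0 A B n H := by
    refine ⟨fun j => conn_interval (by omega) fun i _ h => hadj j i (by omega), ?_, ?_⟩
    · intro j j' hne
      rw [Set.disjoint_left]
      rintro _ ⟨a, ha, rfl⟩ ⟨b, hb, hab⟩
      exact hne (hinj _ _ _ _ (by have := ha.2; omega) (by have := hb.2; omega) hab.symm).1
    · intro j
      exact ⟨⟨_, ⟨0, by simp, rfl⟩, hA j⟩, ⟨_, ⟨len j, by simp, rfl⟩, hB j⟩⟩
  refine ⟨H, hH.mono_le hG0, ?_⟩
  by_contra hbad
  push Not at hbad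
  apply hgrid
  set Bad := Finset.univ.filter fun i : Fin N =>
      q + 1 ≤ (Finset.univ.filter fun j => (Vs i ∩ H j).Nonempty).card with hBad
  have hJ : ∀ i : Fin N, ∃ J : Finset (Fin n), i ∈ Bad → J.card = q + 1 ∧
      ∀ j ∈ J, (Vs i ∩ H j).Nonempty := by
    intro i
    by_cases hi : i ∈ Bad
    · have hi' := hi
      simp only [hBad, Finset.mem_filter, Finset.mem_univ, true_and] at hi'
      obtain ⟨T, hT, hTc⟩ := Finset.exists_subset_card_eq hi'
      exact ⟨T, fun _ => ⟨hTc, fun j hj => by simpa using hT hj⟩⟩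
    · exact ⟨∅, fun h => absurd h hi⟩
  choose J hJc hJm using hJ
  obtain ⟨J0, -, hfib⟩ := Finset.exists_le_card_fiber_of_mul_le_card_of_maps_to
    (s := Bad) (t := (Finset.univ : Finset (Finset (Fin n))))
    (f := J) (n := 1 + K * (K * n + 1)) (fun _ _ => Finset.mem_univ _)
    ⟨∅, Finset.mem_univ _⟩ (by simpa using hbad)
  set I := Bad.filter (fun i => J i = J0) with hI
  have hIp : ∀ i ∈ I, i ∈ Bad ∧ J i = J0 := fun i hi => by simpa [hI] using hi
  obtain ⟨i0, hi0⟩ : I.Nonempty := Finset.card_pos.1 (by omega)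
  have hJ0c : J0.card = q + 1 := by
    have := hJc i0 (hIp i0 hi0).1
    rwa [(hIp i0 hi0).2] at this
  have hmeet : ∀ i ∈ I, ∀ j ∈ J0, ∃ a, a ≤ len j ∧ f j a ∈ Vs i := by
    intro i hi j hj
    obtain ⟨v, hv, a, ha, rfl⟩ := hJm i (hIp i hi).1 j ((hIp i hi).2 ▸ hj)
    exact ⟨a, by have := ha.2; omega, hv⟩
  obtain ⟨js, hjs⟩ : J0.Nonempty := Finset.card_pos.1 (by omega)
  have hm : ∀ i, ∃ a, i ∈ I → a ≤ len js ∧ f js a ∈ Vs i ∧ ∀ b < a, f js b ∉ Vs i := by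
    intro i
    by_cases hi : i ∈ I
    · have hex := hmeet i hi js hjs
      refine ⟨Nat.find hex, fun _ => ⟨(Nat.find_spec hex).1, (Nat.find_spec hex).2, ?_⟩⟩
      intro b hb hbV
      exact Nat.find_min hex hb ⟨by have := (Nat.find_spec hex).1; omega, hbV⟩
    · exact ⟨0, fun h => absurd h hi⟩
  choose m hml hmV hmm using hm
  have hVdd : ∀ i i' v, v ∈ Vs i → v ∈ Vs i' → i = i' := fun i j v h1 h2 => by
    by_contra hne; exact Set.disjoint_left.1 (hVd i j hne) h1 h2
  have : Nonempty (Fin N) := ⟨i0⟩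
  obtain ⟨u, huI, hult⟩ := exists_sorted I m (fun i hi i' hi' h =>
    hVdd i i' _ (hmV i hi) (h ▸ hmV i' hi'))
  set b := K * n + 1 with hb
  -- separators
  have hsep : ∀ a, ∃ S : Finset V, 0 < a → a < 1 + K * b → S.card < n ∧
      ∀ c c', c < a → a ≤ c' → c' < 1 + K * b → Disjoint (Vs (u c)) S → Disjoint (Vs (u c')) S →
      ∀ j, j ≠ js → ∀ p p', p ≤ len j → p' ≤ len j → f j p ∈ Vs (u c) → f j p' ∈ Vs (u c') →
        p < p' := by
    intro a
    by_cases ha : 0 < a ∧ a < 1 + K * b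
    swap
    · exact ⟨∅, fun h h' => absurd ⟨h, h'⟩ ha⟩
    have haI := huI a (by omega)
    have hm0 : 0 < m (u a) := by have := hult 0 a ha.1 (by omega); omega
    have hml' := hml _ haI
    have hni : ∀ i, ¬ (f js (m (u a) - 1) ∈ Vs i ∧ f js (m (u a)) ∈ Vs i) := by
      rintro i ⟨h1, h2⟩
      have := hVdd i (u a) _ h2 (hmV _ haI)
      subst this
      exact hmm _ haI _ (by omega) h1
    have hedge : G0.Adj (f js (m (u a) - 1)) (f js (m (u a))) := by
      have := hadj js (m (u a) - 1) (by omega)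
      rwa [Nat.sub_add_cancel hm0] at this
    obtain ⟨S, hS, hSU⟩ := sep_step hadj hinj hA hB js (m (u a)) hm0 hml' (hdel _ _ hedge hni)
    refine ⟨S, fun _ _ => ⟨hS, ?_⟩⟩
    intro c c' hc hc' hc'' hd hd' j hj p p' hp hp' hpU hpU'
    have hVG : ∀ i, Conn G0 (Vs i) := fun i => (hVc i).mono (hG0V i)
    refine hSU (Vs (u c)) (Vs (u c')) (hVG _) (hVG _) hd hd' (hni _) (hni _)
      ⟨m (u c), hult _ _ hc (by omega), hmV _ (huI c (by omega))⟩
      ⟨m (u c'), ?_, hml _ (huI c' (by omega)), hmV _ (huI c' (by omega))⟩ j hj p p' hp hp' hpU hpU'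
    rcases Nat.lt_or_ge a c' with h | h
    · exact (hult _ _ h (by omega)).le
    · have : a = c' := by omega
      rw [this]
  choose S hSc hSo using hsep
  have hkb : ∀ k k', k < k' → 1 + k * b + b ≤ 1 + k' * b := fun k k' h => by
    have : (k + 1) * b ≤ k' * b := Nat.mul_le_mul_right b h
    linarith
  -- all separators together
  let SS : Finset V := (Finset.range K).biUnion fun k => S (1 + k * b)
  have hSS : SS.card ≤ K * n := by
    refine (Finset.card_biUnion_le_card_mul _ _ n ?_).trans (by simp)
    intro k hk
    have := hkb k K (by simpa using hk)
    have hb0 : 0 < b := by omega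
    exact (hSc (1 + k * b) (by omega) (by omega)).le
  -- choice of a set in each block
  have hw : ∀ k, ∃ w, k < K → 1 + k * b ≤ w ∧ w < 1 + k * b + b ∧ Disjoint (Vs (u w)) SS := by
    intro k
    by_contra hcon
    push Not at hcon
    have hk := (hcon 0).1
    have hkK := hkb k K hk
    have h1 : ∀ w : Fin b, ∃ v ∈ SS, v ∈ Vs (u (1 + k * b + w.val)) := by
      intro w
      have := (hcon (1 + k * b + w.val)).2 (by omega) (by omega)
      rw [Set.not_disjoint_iff] at this
      obtain ⟨v, hv, hv'⟩ := this
      exact ⟨v, hv', hv⟩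
    choose g hg hgV using h1
    have hgi : Function.Injective g := by
      intro w w' h
      have hu := hVdd _ _ _ (hgV w) (h ▸ hgV w')
      rcases Nat.lt_trichotomy w.val w'.val with h1 | h1 | h1
      · have := hult (1 + k * b + w.val) (1 + k * b + w'.val) (by omega) (by omega)
        rw [hu] at this; omega
      · exact Fin.ext h1
      · have := hult (1 + k * b + w'.val) (1 + k * b + w.val) (by omega) (by omega)
        rw [hu] at this; omega
    have := Finset.card_le_card_of_injOn g (s := Finset.univ) (t := SS) (fun i _ => hg i) hgi.injOn
    simp at this
    omega
  choose w hw1 hw2 hw3 using hw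
  have hcq : (J0.erase js).card = q := by rw [Finset.card_erase_of_mem hjs]; omega
  let e := (J0.erase js).equivFinOfCardEq hcq
  have heJ : ∀ j, (e.symm j : Fin n) ∈ J0 ∧ (e.symm j : Fin n) ≠ js := fun j => by
    have := (e.symm j).2
    rw [Finset.mem_erase] at this
    exact ⟨this.2, this.1⟩
  have hwb : ∀ k < K, w k < 1 + K * b := fun k hk => by
    have := hw2 k hk
    have := hkb k K hk
    omega
  refine hmesh V G (fun j => f (e.symm j)) (fun j => len (e.symm j)) (fun k => Vs (u (w k)))
    (fun j a ha => hG0 (hadj _ a ha)) ?_ (fun k _ => hVc _) ?_ ?_ ?_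
  · intro j j' a a' ha ha' h
    have := hinj _ _ _ _ ha ha' h
    exact ⟨e.symm.injective (Subtype.ext this.1), this.2⟩
  · intro k k' h h'
    refine hVd _ _ fun hu => ?_
    have h1 := hw2 k (by omega)
    have h2 := hw1 k' h'
    have h3 := hkb k k' h
    have := hult (w k) (w k') (by omega) (by have := hwb k' h'; omega)
    rw [hu] at this; omega
  · intro k hk j
    exact hmeet _ (huI _ (by have := hwb k hk; omega)) _ (heJ j).1
  · intro k k' h h' j a a' ha ha' haV haV'
    have h1 := hw2 k (by omega)
    have h2 := hw1 k' h'
    have h3 := hkb k k' h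
    have hk'K := hkb k' K h'
    have hsub : (S (1 + k' * b) : Set V) ⊆ SS := by
      have := Finset.subset_biUnion_of_mem (fun k => S (1 + k * b)) (Finset.mem_range.2 h')
      exact_mod_cast this
    exact hSo (1 + k' * b) (by omega) (by omega) (w k) (w k') (by omega) (by omega)
      (hwb k' h') ((hw3 k (by omega)).mono_right hsub) ((hw3 k' h').mono_right hsub) _ (heJ j).2
      a a' ha ha' haV haV'

end GT

namespace GT

variable {V : Type} {G : SimpleGraph V}

/-- keep only the edges inside U -/
def res (G : SimpleGraph V) (U : Set V) : SimpleGraph V :=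
  ⟨fun u v => G.Adj u v ∧ u ∈ U ∧ v ∈ U, ⟨fun _ _ h => ⟨h.1.symm, h.2.2, h.2.1⟩⟩,
    ⟨fun u h => G.loopless.irrefl u h.1⟩⟩

lemma res_le {U : Set V} : res G U ≤ G := fun _ _ h => h.1

lemma res_sub {U X A : Set V} (hX : Conn (res G U) X) (hA : A ⊆ U) (h : (X ∩ A).Nonempty) :
    X ⊆ U := by
  obtain ⟨a, haX, ha⟩ := h
  exact hX.closed ⟨a, haX, hA ha⟩ (fun _ _ _ _ _ hab => hab.2.2)

lemma GridMinor.mono_le {G' : SimpleGraph V} {r : ℕ} (hG : G ≤ G') (h : GridMinor r G) :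
    GridMinor r G' := by
  obtain ⟨φ, h1, h2, h3, h4⟩ := h
  refine ⟨φ, fun i j hi hj => (h1 i j hi hj).mono_le hG, h2, fun i j hi hj => ?_, fun i j hi hj => ?_⟩
  · obtain ⟨x, hx, y, hy, h⟩ := h3 i j hi hj
    exact ⟨x, hx, y, hy, hG h⟩
  · obtain ⟨x, hx, y, hy, h⟩ := h4 i j hi hj
    exact ⟨x, hx, y, hy, hG h⟩

lemma lk_of_family {n k : ℕ} {A B : Set V} {H : Fin n → Set V} (T : Finset (Fin n)) (hT : k ≤ T.card)
    (hc : ∀ i ∈ T, Conn G (H i)) (hd : ∀ i j, i ≠ j → Disjoint (H i) (H j))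
    (hm : ∀ i ∈ T, (H i ∩ A).Nonempty ∧ (H i ∩ B).Nonempty) : Lk G A B k := by
  obtain ⟨T', hT', hc'⟩ := Finset.exists_subset_card_eq hT
  let e := T'.equivFinOfCardEq hc'
  have : IsLinkage G A B k (fun i => H (e.symm i)) := by
    refine ⟨fun i => hc _ (hT' (e.symm i).2), fun i j hij => hd _ _ fun h => hij ?_,
      fun i => hm _ (hT' (e.symm i).2)⟩
    exact e.symm.injective (Subtype.ext h)
  exact this.lk

lemma process (r : ℕ) (p : ℕ) : ∃ F : ℕ, ∀ (V : Type) [Finite V] (G : SimpleGraph V) (U : Set V)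
    (ι : Type) [DecidableEq ι] (ps : Finset ι) (A B : ι → Set V), ps.card ≤ p → ¬ GridMinor r G →
    (∀ i ∈ ps, A i ⊆ U ∧ B i ⊆ U ∧ Lk (res G U) (A i) (B i) F) →
    ∃ R : ι → Set V, (∀ i ∈ ps, Conn G (R i) ∧ R i ⊆ U ∧ (R i ∩ A i).Nonempty ∧
      (R i ∩ B i).Nonempty) ∧ ∀ i ∈ ps, ∀ j ∈ ps, i ≠ j → Disjoint (R i) (R j) := by
  classical
  obtain ⟨s, hs⟩ := core r
  induction p with
  | zero =>
    refine ⟨0, ?_⟩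
    intro V _ G U ι _ ps A B hp hg h
    have : ps = ∅ := by simpa using hp
    subst this
    exact ⟨fun _ => ∅, by simp, by simp⟩
  | succ p ih =>
    obtain ⟨F, hF⟩ := ih
    obtain ⟨D, hD⟩ := hs (F + s)
    refine ⟨max (p * D + 1) (F + s), ?_⟩
    intro V _ G U ι _ ps A B hp hg h
    rcases ps.eq_empty_or_nonempty with rfl | ⟨i0, hi0⟩
    · exact ⟨fun _ => ∅, by simp, by simp⟩
    have hg' : ¬ GridMinor r (res G U) := fun h => hg (h.mono_le res_le)
    obtain ⟨Vs, hVc, hVd, hVm⟩ := menger _ _ _ _ ((h i0 hi0).2.2.mono (le_max_left _ _))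
    have hH : ∀ i, ∃ H : Fin (F + s) → Set V, i ∈ ps → IsLinkage (res G U) (A i) (B i) (F + s) H ∧
        (Finset.univ.filter fun l => s ≤ (Finset.univ.filter fun j =>
          (Vs l ∩ H j).Nonempty).card).card < D := by
      intro i
      by_cases hi : i ∈ ps
      · obtain ⟨H, hH⟩ := hD V (res G U) (A i) (B i) _ Vs hVc hVd
          ((h i hi).2.2.mono (le_max_right _ _)) hg'
        exact ⟨H, fun _ => hH⟩
      · exact ⟨fun _ => ∅, fun h => absurd h hi⟩
    choose H hHL hHb using hH
    set bad : ι → Finset (Fin (p * D + 1)) := fun i => Finset.univ.filter fun l =>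
      s ≤ (Finset.univ.filter fun j => (Vs l ∩ H i j).Nonempty).card with hbad
    have hpe : (ps.erase i0).card ≤ p := by rw [Finset.card_erase_of_mem hi0]; omega
    obtain ⟨l, hl⟩ : ∃ l, l ∉ (ps.erase i0).biUnion bad := by
      by_contra hno
      push Not at hno
      have h1 : (Finset.univ : Finset (Fin (p * D + 1))) ⊆ (ps.erase i0).biUnion bad :=
        fun l _ => hno l
      have h2 := Finset.card_le_card h1
      have h3 := Finset.card_biUnion_le_card_mul (ps.erase i0) bad D
        (fun i hi => (hHb i (Finset.mem_of_mem_erase hi)).le)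
      have h4 : (ps.erase i0).card * D ≤ p * D := Nat.mul_le_mul_right _ hpe
      simp at h2
      omega
    have hlU : Vs l ⊆ U := res_sub (hVc l) (h i0 hi0).1 (hVm l).1
    obtain ⟨R, hR, hRd⟩ := hF V G (U \ Vs l) ι (ps.erase i0) (fun i => A i \ Vs l)
      (fun i => B i \ Vs l) hpe hg (by
        intro i hi
        have hi' := Finset.mem_of_mem_erase hi
        refine ⟨sdiff_subset_sdiff_left (h i hi').1, sdiff_subset_sdiff_left (h i hi').2.1, ?_⟩
        have hlb : l ∉ bad i := fun hc => hl (Finset.mem_biUnion.2 ⟨i, hi, hc⟩)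
        simp only [hbad, Finset.mem_filter, Finset.mem_univ, true_and, not_le] at hlb
        obtain ⟨c1, c2, c3⟩ := hHL i hi'
        have hdis : ∀ j ∈ (Finset.univ.filter fun j => (Vs l ∩ H i j).Nonempty)ᶜ,
            Disjoint (Vs l) (H i j) := by
          intro j hj
          simp only [Finset.mem_compl, Finset.mem_filter, Finset.mem_univ, true_and] at hj
          rwa [Set.not_nonempty_iff_eq_empty, ← Set.disjoint_iff_inter_eq_empty] at hj
        refine lk_of_family (H := H i)
          (Finset.univ.filter fun j => (Vs l ∩ H i j).Nonempty)ᶜ ?_ ?_ c2 ?_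
        · rw [Finset.card_compl]
          simp only [Fintype.card_fin]
          omega
        · intro j hj
          have hjU := res_sub (c1 j) (h i hi').1 (c3 j).1
          have hd := hdis j hj
          refine (c1 j).mono fun x hx y hy (hxy : (res G U).Adj x y) => ⟨hxy.1, ⟨hjU hx, ?_⟩, ⟨hjU hy, ?_⟩⟩
          · exact fun hc => Set.disjoint_left.1 hd hc hx
          · exact fun hc => Set.disjoint_left.1 hd hc hy
        · intro j hj
          have hd := hdis j hj
          obtain ⟨⟨x, hx, hxA⟩, ⟨y, hy, hyB⟩⟩ := c3 j
          exact ⟨⟨x, hx, hxA, fun hc => Set.disjoint_left.1 hd hc hx⟩,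
            ⟨y, hy, hyB, fun hc => Set.disjoint_left.1 hd hc hy⟩⟩)
    have hR' : ∀ i ∈ ps, i ≠ i0 → Conn G (R i) ∧ R i ⊆ U \ Vs l ∧ (R i ∩ (A i \ Vs l)).Nonempty ∧
      (R i ∩ (B i \ Vs l)).Nonempty := fun i hi hne => hR i (Finset.mem_erase.2 ⟨hne, hi⟩)
    refine ⟨fun i => if i = i0 then Vs l else R i, ?_, ?_⟩
    · intro i hi
      by_cases hii : i = i0
      · subst hii
        simp only [if_true]
        exact ⟨(hVc l).mono_le res_le, hlU, (hVm l).1, (hVm l).2⟩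
      · simp only [hii, if_false]
        obtain ⟨e1, e2, e3, e4⟩ := hR' i hi hii
        exact ⟨e1, e2.trans sdiff_subset, e3.mono (inter_subset_inter_right _ sdiff_subset),
          e4.mono (inter_subset_inter_right _ sdiff_subset)⟩
    · intro i hi j hj hij
      by_cases hii : i = i0
      · have hji : j ≠ i0 := fun h => hij (hii.trans h.symm)
        simp only [hii, hji, if_true, if_false]
        rw [Set.disjoint_right]
        exact fun v hv => ((hR' j hj hji).2.1 hv).2
      · by_cases hji : j = i0
        · simp only [hii, hji, if_true, if_false]
          rw [Set.disjoint_left]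
          exact fun v hv => ((hR' i hi hii).2.1 hv).2
        · simp only [hii, hji, if_false]
          exact hRd i (Finset.mem_erase.2 ⟨hii, hi⟩) j (Finset.mem_erase.2 ⟨hji, hj⟩) hij

lemma choose_good (m D N : ℕ) (hN : m ^ 3 * D < N) (Bad : Fin N → Fin N → Finset (Fin N))
    (hc : ∀ x y, (Bad x y).card ≤ D) :
    ∃ c : Fin m → Fin N, ∀ a b d, d ≠ a → d ≠ b → c d ∉ Bad (c a) (c b) := by
  classical
  by_contra hno
  push Not at hno
  let Ev : Fin m × Fin m × Fin m → Finset (Fin m → Fin N) := fun p => Finset.univ.filter fun c =>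
    p.2.2 ≠ p.1 ∧ p.2.2 ≠ p.2.1 ∧ c p.2.2 ∈ Bad (c p.1) (c p.2.1)
  have hEv : ∀ p, (Ev p).card * N ≤ D * N ^ m := by
    rintro ⟨a, b, d⟩
    have h1 : ((Ev (a, b, d)) ×ˢ (Finset.univ : Finset (Fin N))).card ≤
        ((Finset.univ : Finset (Fin m → Fin N)).biUnion fun c =>
          (Bad (c a) (c b)).image fun x => (c, x)).card := by
      refine Finset.card_le_card_of_injOn (fun q => (Function.update q.1 d q.2, q.1 d)) ?_ ?_
      · rintro ⟨c, y⟩ hcy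
        simp only [Ev, Finset.coe_product, Set.mem_prod, Finset.mem_coe, Finset.mem_filter,
          Finset.mem_univ, true_and, and_true] at hcy
        simp only [Finset.mem_coe, Finset.mem_biUnion, Finset.mem_univ, true_and, Finset.mem_image]
        refine ⟨Function.update c d y, c d, ?_, rfl⟩
        rw [Function.update_of_ne (Ne.symm hcy.1), Function.update_of_ne (Ne.symm hcy.2.1)]
        exact hcy.2.2
      · rintro ⟨c, y⟩ - ⟨c', y'⟩ - h
        simp only [Prod.mk.injEq] at h
        have hy : y = y' := by
          have := congrFun h.1 d
          simpa using this
        have hcc : c = c' := by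
          funext z
          by_cases hz : z = d
          · rw [hz]; exact h.2
          · have := congrFun h.1 z
            simpa [Function.update_of_ne hz] using this
        rw [hy, hcc]
    have h2 := Finset.card_biUnion_le_card_mul (Finset.univ : Finset (Fin m → Fin N))
      (fun c => (Bad (c a) (c b)).image fun x => (c, x)) D
      (fun c _ => Finset.card_image_le.trans (hc _ _))
    rw [Finset.card_product] at h1
    simp at h1 h2
    calc _ ≤ _ := h1
      _ ≤ _ := h2
      _ = _ := by ring
  have h1 : (Finset.univ : Finset (Fin m → Fin N)) ⊆ Finset.univ.biUnion Ev := by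
    intro c _
    obtain ⟨a, b, d, h1, h2, h3⟩ := hno c
    rw [Finset.mem_biUnion]
    exact ⟨(a, b, d), Finset.mem_univ _, by simp [Ev, h1, h2, h3]⟩
  have h2 := (Finset.card_le_card h1).trans Finset.card_biUnion_le
  have h3 : N ^ m * N ≤ (m ^ 3 * D) * N ^ m := by
    calc N ^ m * N ≤ (∑ p, (Ev p).card) * N := Nat.mul_le_mul_right _ (by simpa using h2)
      _ = ∑ p, (Ev p).card * N := by rw [Finset.sum_mul]
      _ ≤ ∑ p : Fin m × Fin m × Fin m, D * N ^ m := Finset.sum_le_sum fun p _ => hEv p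
      _ = _ := by simp; ring
  have h4 : 0 < N ^ m := by
    have : 0 < N := by omega
    positivity
  rw [mul_comm (m ^ 3 * D)] at h3
  have := Nat.le_of_mul_le_mul_left h3 h4
  omega

end GT

namespace GT

variable {V : Type} {G : SimpleGraph V}

theorem grid_of_tangle (r : ℕ) : ∃ N n : ℕ, ∀ (V : Type) [Finite V] (G : SimpleGraph V)
    (T : Fin N → Set V), (∀ i, Conn G (T i)) → (∀ i j, i ≠ j → Disjoint (T i) (T j)) →
    (∀ i j, i ≠ j → Lk G (T i) (T j) n) → GridMinor r G := by
  classical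
  obtain ⟨s, hs⟩ := core r
  set m := r * r with hm
  obtain ⟨F, hF⟩ := process r (m * m)
  obtain ⟨D, hD⟩ := hs (F + m * s)
  refine ⟨m ^ 3 * (D + 1) + 1, F + m * s, ?_⟩
  intro V _ G T hTc hTd hTl
  by_contra hg
  have hH : ∀ i j, ∃ H : Fin (F + m * s) → Set V, i ≠ j → IsLinkage G (T i) (T j) (F + m * s) H ∧
      (Finset.univ.filter fun l => s ≤ (Finset.univ.filter fun j =>
        (T l ∩ H j).Nonempty).card).card < D := by
    intro i j
    by_cases hij : i = j
    · exact ⟨fun _ => ∅, fun h => absurd hij h⟩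
    · obtain ⟨H, hH⟩ := hD V G (T i) (T j) _ T hTc hTd (hTl i j hij) hg
      exact ⟨H, fun _ => hH⟩
  choose H hHL hHb using hH
  obtain ⟨c, hcgood⟩ := choose_good m (D + 1) _ (Nat.lt_succ_self _)
    (fun i j => if i = j then {i} else Finset.univ.filter fun l =>
      s ≤ (Finset.univ.filter fun k => (T l ∩ H i j k).Nonempty).card) (by
      intro i j
      by_cases hij : i = j
      · simp [hij]
      · simp only [hij, if_false]
        exact (hHb i j hij).le.trans (by omega))
  have hci : ∀ a b, c a = c b → a = b := by
    intro a b h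
    by_contra hne
    have := hcgood a a b (Ne.symm hne) (Ne.symm hne)
    simp [h] at this
  have hcs : ∀ a b d, a ≠ b → d ≠ a → d ≠ b →
      (Finset.univ.filter fun k => (T (c d) ∩ H (c a) (c b) k).Nonempty).card < s := by
    intro a b d hab hda hdb
    have h1 := hcgood a b d hda hdb
    have h2 : c a ≠ c b := fun h => hab (hci a b h)
    simp only [h2, if_false, Finset.mem_filter, Finset.mem_univ, true_and, not_le] at h1
    exact h1
  let U : Set V := {v | ∀ a, v ∉ T (c a)}
  let A : Fin m → Set V := fun a => {v | v ∈ U ∧ ∃ x ∈ T (c a), G.Adj x v}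
  have hTdd : ∀ a b v, v ∈ T (c a) → v ∈ T (c b) → a = b := fun a b v h1 h2 => by
    by_contra hne
    exact Set.disjoint_left.1 (hTd _ _ fun h => hne (hci _ _ h)) h1 h2
  have hlk : ∀ a b, a ≠ b → (∀ x ∈ T (c a), ∀ y ∈ T (c b), ¬ G.Adj x y) →
      Lk (res G U) (A a) (A b) F := by
    intro a b hab hna
    rw [lk_iff]
    intro Z hZ L hAL hcl
    by_contra hno
    push Not at hno
    have hca : c a ≠ c b := fun h => hab (hci a b h)
    obtain ⟨h1, h2, h3⟩ := hHL (c a) (c b) hca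
    -- a path avoiding everything
    obtain ⟨k, hk1, hk2⟩ : ∃ k, (∀ d, d ≠ a → d ≠ b → Disjoint (T (c d)) (H (c a) (c b) k)) ∧
        ∀ z ∈ Z, z ∉ H (c a) (c b) k := by
      by_contra hcon
      push Not at hcon
      let B1 : Finset (Fin (F + m * s)) := (Finset.univ.filter fun d : Fin m => d ≠ a ∧ d ≠ b).biUnion
        fun d => (Finset.univ.filter fun k => (T (c d) ∩ H (c a) (c b) k).Nonempty)
      let B2 : Finset (Fin (F + m * s)) := Z.biUnion fun z => Finset.univ.filter fun k =>
        z ∈ H (c a) (c b) k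
      have c1 : B1.card ≤ m * s := by
        refine (Finset.card_biUnion_le_card_mul _ _ s ?_).trans ?_
        · intro d hd
          simp only [Finset.mem_filter, Finset.mem_univ, true_and] at hd
          exact (hcs a b d hab hd.1 hd.2).le
        · exact Nat.mul_le_mul_right _ ((Finset.card_filter_le _ _).trans (by simp))
      have c2 : B2.card ≤ Z.card := by
        refine (Finset.card_biUnion_le_card_mul _ _ 1 ?_).trans (by simp)
        intro z _
        rw [Finset.card_le_one]
        intro k hk k' hk'
        simp only [Finset.mem_filter, Finset.mem_univ, true_and] at hk hk'
        by_contra hne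
        exact Set.disjoint_left.1 (h2 k k' hne) hk hk'
      have c3 : (Finset.univ : Finset (Fin (F + m * s))) ⊆ B1 ∪ B2 := by
        intro k _
        rw [Finset.mem_union]
        by_cases hk : ∀ d, d ≠ a → d ≠ b → Disjoint (T (c d)) (H (c a) (c b) k)
        · obtain ⟨z, hz, hzk⟩ := hcon k hk
          right
          exact Finset.mem_biUnion.2 ⟨z, hz, by simpa using hzk⟩
        · push Not at hk
          obtain ⟨d, hda, hdb, hd⟩ := hk
          left
          refine Finset.mem_biUnion.2 ⟨d, by simp [hda, hdb], ?_⟩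
          simpa [Set.not_disjoint_iff_nonempty_inter] using hd
      have c4 := (Finset.card_le_card c3).trans (Finset.card_union_le _ _)
      simp at c4
      omega
    obtain ⟨⟨x, hxH, hxa⟩, ⟨y, hyH, hyb⟩⟩ := h3 k
    have hcase : ∀ v ∈ H (c a) (c b) k, v ∉ T (c a) → v ∉ T (c b) → v ∈ U := by
      intro v hv h1 h2 d hd
      by_cases hda : d = a
      · rw [hda] at hd; exact h1 hd
      by_cases hdb : d = b
      · rw [hdb] at hd; exact h2 hd
      exact Set.disjoint_left.1 (hk1 d hda hdb) hd hv
    have hZn : ∀ v ∈ H (c a) (c b) k, v ∉ Z := fun v hv hvZ => hk2 v hvZ hv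
    have hsub := (h1 k).closed (L := {v | v ∈ T (c a) ∨ (v ∈ U ∧ v ∈ L)}) ⟨x, hxH, Or.inl hxa⟩ (by
      intro u hu huL v hv huv
      by_cases hva : v ∈ T (c a)
      · exact Or.inl hva
      right
      rcases huL with hua | ⟨huU, huL⟩
      · have hvb : v ∉ T (c b) := fun h => hna u hua v h huv
        have hvU := hcase v hv hva hvb
        exact ⟨hvU, hAL v ⟨hvU, u, hua, huv⟩ (hZn v hv)⟩
      · have hvb : v ∉ T (c b) := fun h => hno u ⟨huU, v, h, huv.symm⟩ (hZn u hu) huL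
        have hvU := hcase v hv hva hvb
        exact ⟨hvU, hcl u huL (hZn u hu) v (hZn v hv) ⟨huv, huU, hvU⟩⟩)
    rcases hsub hyH with h | h
    · exact hab (hTdd _ _ _ h hyb)
    · exact h.1 b hyb
  let ps : Finset (Fin m × Fin m) := Finset.univ.filter fun p => p.1 < p.2 ∧
    ∀ x ∈ T (c p.1), ∀ y ∈ T (c p.2), ¬ G.Adj x y
  have hps : ∀ p ∈ ps, p.1 < p.2 ∧ ∀ x ∈ T (c p.1), ∀ y ∈ T (c p.2), ¬ G.Adj x y := fun p hp => by
    simpa only [ps, Finset.mem_filter, Finset.mem_univ, true_and] using hp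
  obtain ⟨R, hR, hRd⟩ := hF V G U (Fin m × Fin m) ps (fun p => A p.1) (fun p => A p.2)
    ((Finset.card_filter_le _ _).trans (by simp)) hg (fun p hp => ⟨fun v hv => hv.1, fun v hv => hv.1,
      hlk p.1 p.2 (hps p hp).1.ne (hps p hp).2⟩)
  let Φ : Fin m → Set V := fun a => T (c a) ∪ ⋃ p : {p // p ∈ ps ∧ p.1 = a}, R p.1
  have hΦc : ∀ a, Conn G (Φ a) := by
    intro a
    refine (hTc (c a)).iUnion_core _ ?_
    rintro ⟨p, hp, rfl⟩
    obtain ⟨e1, e2, ⟨v, hv, hvU, x, hx, hxv⟩, -⟩ := hR p hp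
    exact (hTc _).union_adj e1 hx hv hxv
  have hΦd : ∀ a b, a ≠ b → Disjoint (Φ a) (Φ b) := by
    intro a b hab
    rw [Set.disjoint_left]
    rintro v (hv | hv) (hv' | hv')
    · exact hab (hTdd _ _ _ hv hv')
    · obtain ⟨⟨p, hp, hpx⟩, hvp⟩ := mem_iUnion.1 hv'
      exact (hR p hp).2.1 hvp a hv
    · obtain ⟨⟨p, hp, hpx⟩, hvp⟩ := mem_iUnion.1 hv
      exact (hR p hp).2.1 hvp b hv'
    · obtain ⟨⟨p, hp, hpa⟩, hvp⟩ := mem_iUnion.1 hv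
      obtain ⟨⟨q, hq, hqb⟩, hvq⟩ := mem_iUnion.1 hv'
      exact Set.disjoint_left.1 (hRd p hp q hq (fun h => hab (by rw [← hpa, ← hqb, h]))) hvp hvq
  have hΦa : ∀ a b, a < b → ∃ x ∈ Φ a, ∃ y ∈ Φ b, G.Adj x y := by
    intro a b hab
    by_cases hadj : ∀ x ∈ T (c a), ∀ y ∈ T (c b), ¬ G.Adj x y
    · have hp : (a, b) ∈ ps := by simpa [ps, hab] using hadj
      obtain ⟨e1, e2, -, ⟨v, hv, hvU, x, hx, hxv⟩⟩ := hR (a, b) hp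
      exact ⟨v, Or.inr (mem_iUnion.2 ⟨⟨(a, b), hp, rfl⟩, hv⟩), x, Or.inl hx, hxv.symm⟩
    · push Not at hadj
      obtain ⟨x, hx, y, hy, hxy⟩ := hadj
      exact ⟨x, Or.inl hx, y, Or.inl hy, hxy⟩
  have hlt : ∀ i j, i < r → j < r → i * r + j < m := fun i j hi hj => by
    have : (i + 1) * r ≤ r * r := Nat.mul_le_mul_right r hi
    rw [hm]
    linarith
  apply hg
  have hval : ∀ i j, ∃ X : Set V, ∀ h : i < r ∧ j < r, X = Φ ⟨i * r + j, hlt i j h.1 h.2⟩ := by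
    intro i j
    by_cases h : i < r ∧ j < r
    · exact ⟨Φ ⟨i * r + j, hlt i j h.1 h.2⟩, fun _ => rfl⟩
    · exact ⟨∅, fun h' => absurd h' h⟩
  choose φ hφ using hval
  refine ⟨φ, ?_, ?_, ?_, ?_⟩
  · intro i j hi hj
    rw [hφ i j ⟨hi, hj⟩]; exact hΦc _
  · intro i j i' j' hi hj hi' hj' hne
    rw [hφ i j ⟨hi, hj⟩, hφ i' j' ⟨hi', hj'⟩]
    apply hΦd
    intro h
    have h0 : i * r + j = i' * r + j' := by simpa using h
    have h1 : j = j' := by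
      have := congrArg (· % r) h0
      simpa [Nat.mod_eq_of_lt hj, Nat.mod_eq_of_lt hj', Nat.add_mod, Nat.mul_mod_left] using this
    subst h1
    have : i * r = i' * r := by omega
    exact hne ⟨Nat.eq_of_mul_eq_mul_right (by omega) this, rfl⟩
  · intro i j hi hj
    rw [hφ i j ⟨by omega, hj⟩, hφ (i + 1) j ⟨hi, hj⟩]
    refine hΦa _ _ ?_
    rw [Fin.lt_def]
    have : (i + 1) * r = i * r + r := by ring
    simp only
    omega
  · intro i j hi hj
    rw [hφ i j ⟨hi, by omega⟩, hφ i (j + 1) ⟨hi, hj⟩]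
    refine hΦa _ _ ?_
    rw [Fin.lt_def]
    simp only
    omega

end GT

namespace GT

lemma conn_iff {V : Type} {G : SimpleGraph V} {X : Set V} : Conn G X ↔ (G.induce X).Connected := by
  constructor
  · intro h
    obtain ⟨x, hx⟩ := h.1
    have : Nonempty X := ⟨⟨x, hx⟩⟩
    refine SimpleGraph.Connected.mk fun u v => ?_
    have := h.closed (L := {b | ∃ hb : b ∈ X, (G.induce X).Reachable u ⟨b, hb⟩})
      ⟨u.1, u.2, u.2, SimpleGraph.Reachable.refl _⟩ ?_ v.2
    · exact this.2
    · rintro a ha ⟨_, h1⟩ b hb hab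
      refine ⟨hb, h1.trans (SimpleGraph.Adj.reachable ?_)⟩
      exact hab
  · intro h
    obtain ⟨r⟩ := h.nonempty
    refine conn_of_root r.2 fun L hL hc x hx => ?_
    obtain ⟨w⟩ := h.preconnected r ⟨x, hx⟩
    have : ∀ (u v : X) (w : (G.induce X).Walk u v), u.1 ∈ L → v.1 ∈ L := by
      intro u v w
      induction w with
      | nil => exact id
      | cons hadj _ ih => exact fun hu => ih (hc _ (Subtype.coe_prop _) hu _ (Subtype.coe_prop _) hadj)
    exact this _ _ w hL

lemma conn_univ_iff {V : Type} {G : SimpleGraph V} : Conn G Set.univ ↔ G.Connected := by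
  rw [conn_iff]
  exact (SimpleGraph.induceUnivIso G).connected_iff

/-- a rank function with unique lower neighbours certifies acyclicity -/
lemma acyclic_of_rank {V : Type} {G : SimpleGraph V} (rk : V → ℕ)
    (h : ∀ v x y, G.Adj v x → G.Adj v y → rk x ≤ rk v → rk y ≤ rk v → x = y) : G.IsAcyclic := by
  classical
  intro v c hc
  obtain ⟨m, hm, hmax⟩ := Finset.exists_max_image c.support.toFinset rk
    ⟨v, by simp⟩
  have hm' : m ∈ c.support := by simpa using hm
  have hc' := hc.rotate hm'
  have hmem : ∀ x, x ∈ (c.rotate m hm').support → rk x ≤ rk m := by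
    intro x hx
    apply hmax
    simp only [List.mem_toFinset]
    have h2 := SimpleGraph.Walk.mem_support_rotate_iff c m hm' (w := x)
    exact h2.1 hx
  refine hc'.snd_ne_penultimate (h m _ _ ?_ ?_ (hmem _ ?_) (hmem _ ?_))
  · exact SimpleGraph.Walk.adj_snd hc'.not_nil
  · exact (SimpleGraph.Walk.adj_penultimate hc'.not_nil).symm
  · exact SimpleGraph.Walk.getVert_mem_support ..
  · exact SimpleGraph.Walk.getVert_mem_support ..

variable {V : Type}

def TD (G : SimpleGraph V) (K : ℕ) (U W : Set V) : Prop :=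
  ∃ (ι : Type) (T : SimpleGraph ι) (χ : ι → Finset V) (t0 : ι) (rk : ι → ℕ),
    Conn T Set.univ ∧
    (∀ v x y, T.Adj v x → T.Adj v y → rk x ≤ rk v → rk y ≤ rk v → x = y) ∧
    (∀ x, T.Adj t0 x → rk t0 < rk x) ∧
    (∀ t, (χ t : Set V) ⊆ U) ∧ (∀ v ∈ U, Conn T {t | v ∈ χ t}) ∧
    (∀ u ∈ U, ∀ v ∈ U, G.Adj u v → ∃ t, u ∈ χ t ∧ v ∈ χ t) ∧ (∀ t, (χ t).card ≤ K) ∧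
    W ⊆ (χ t0 : Set V)

lemma TD.toTw {G : SimpleGraph V} {K : ℕ} {W : Set V} (h : TD G (K + 1) Set.univ W) :
    Paper.HasTreewidthAtMost G K := by
  obtain ⟨ι, T, χ, t0, rk, h1, h2, h3, h4, h5, h6, h7, h8⟩ := h
  refine ⟨ι, T, χ, ⟨conn_univ_iff.1 h1, acyclic_of_rank rk h2⟩, fun v => (h5 v trivial).1,
    fun u v huv => h6 u trivial v trivial huv, fun v => conn_iff.1 (h5 v trivial), h7⟩

lemma TD.single (G : SimpleGraph V) {K : ℕ} (U : Finset V) (hU : U.card ≤ K) {W : Set V}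
    (hW : W ⊆ U) : TD G K U W := by
  refine ⟨Unit, ⊥, fun _ => U, (), fun _ => 0, ?_, ?_, ?_, ?_, ?_, ?_, fun _ => hU, hW⟩
  · exact conn_of_root (r := ()) trivial (fun L hL _ x _ => hL)
  · simp
  · simp
  · simp
  · intro v hv
    exact conn_of_root (r := ()) (by simpa using hv) (fun L hL _ x _ => hL)
  · intro u hu v hv _
    exact ⟨(), hu, hv⟩

lemma Conn.image {W : Type} {G : SimpleGraph V} {H : SimpleGraph W} {X : Set V} (f : V → W)
    (hf : ∀ x ∈ X, ∀ y ∈ X, G.Adj x y → H.Adj (f x) (f y)) (h : Conn G X) : Conn H (f '' X) := by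
  obtain ⟨r, hr⟩ := h.1
  refine conn_of_root (r := f r) ⟨r, hr, rfl⟩ fun L hL hc => ?_
  rintro _ ⟨x, hx, rfl⟩
  exact h.closed (L := f ⁻¹' L) ⟨r, hr, hL⟩ (fun a ha haL b hb hab =>
    hc _ ⟨a, ha, rfl⟩ haL _ ⟨b, hb, rfl⟩ (hf a ha b hb hab)) hx

lemma TD.glue {G : SimpleGraph V} {K : ℕ} {U1 U2 W1 W2 : Set V} (h1 : TD G K U1 W1)
    (h2 : TD G K U2 W2) (hW1 : U1 ∩ U2 ⊆ W1) (hW2 : U1 ∩ U2 ⊆ W2)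
    (hE : ∀ u ∈ U1 ∪ U2, ∀ v ∈ U1 ∪ U2, G.Adj u v → (u ∈ U1 ∧ v ∈ U1) ∨ (u ∈ U2 ∧ v ∈ U2)) :
    TD G K (U1 ∪ U2) W1 := by
  obtain ⟨ι1, T1, χ1, t1, rk1, a1, a2, a3, a4, a5, a6, a7, a8⟩ := h1
  obtain ⟨ι2, T2, χ2, t2, rk2, b1, b2, b3, b4, b5, b6, b7, b8⟩ := h2
  let T : SimpleGraph (ι1 ⊕ ι2) :=
    SimpleGraph.mk (fun x y => match x, y with
      | .inl a, .inl b => T1.Adj a b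
      | .inr a, .inr b => T2.Adj a b
      | .inl a, .inr b => a = t1 ∧ b = t2
      | .inr b, .inl a => a = t1 ∧ b = t2)
      ⟨by rintro (a | a) (b | b) h <;> first | exact h.symm | exact h⟩
      ⟨by rintro (a | a) h; exact T1.loopless.irrefl a h; exact T2.loopless.irrefl a h⟩
  have e11 : ∀ a b, T.Adj (.inl a) (.inl b) ↔ T1.Adj a b := fun _ _ => Iff.rfl
  have e22 : ∀ a b, T.Adj (.inr a) (.inr b) ↔ T2.Adj a b := fun _ _ => Iff.rfl
  have e12 : ∀ a b, T.Adj (.inl a) (.inr b) ↔ a = t1 ∧ b = t2 := fun _ _ => Iff.rfl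
  have e21 : ∀ a b, T.Adj (.inr b) (.inl a) ↔ a = t1 ∧ b = t2 := fun _ _ => Iff.rfl
  have hE12 : T.Adj (.inl t1) (.inr t2) := ⟨rfl, rfl⟩
  have c1 : ∀ X, Conn T1 X → Conn T (Sum.inl '' X) := fun X h =>
    h.image _ (fun x _ y _ h => h)
  have c2 : ∀ X, Conn T2 X → Conn T (Sum.inr '' X) := fun X h =>
    h.image _ (fun x _ y _ h => h)
  refine ⟨ι1 ⊕ ι2, T, Sum.elim χ1 χ2, .inl t1, Sum.elim rk1 (fun t => rk2 t + 1 + rk1 t1),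
    ?_, ?_, ?_, ?_, ?_, ?_, ?_, ?_⟩
  · have := (c1 _ a1).union_adj (c2 _ b1) ⟨t1, trivial, rfl⟩ ⟨t2, trivial, rfl⟩ hE12
    convert this using 1
    ext (x | x) <;> simp
  · rintro (v | v) (x | x) (y | y) <;>
      simp only [e11, e12, e21, e22, Sum.elim_inl, Sum.elim_inr, Sum.inl.injEq, Sum.inr.injEq]
    · exact a2 v x y
    · rintro h1 ⟨rfl, rfl⟩; omega
    · rintro ⟨rfl, rfl⟩; omega
    · rintro ⟨rfl, rfl⟩; omega
    · rintro ⟨rfl, rfl⟩ ⟨rfl, _⟩ _ _; rfl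
    · rintro ⟨rfl, rfl⟩ h _ _; have := b3 _ h; omega
    · rintro h ⟨rfl, rfl⟩ _ _; have := b3 _ h; omega
    · intro h1 h2 h3 h4
      exact b2 v x y h1 h2 (by omega) (by omega)
  · rintro (x | x) <;> simp only [e11, e12, Sum.elim_inl, Sum.elim_inr]
    · exact a3 x
    · omega
  · rintro (t | t)
    · exact (a4 t).trans subset_union_left
    · exact (b4 t).trans subset_union_right
  · intro v hv
    have key : {t | v ∈ (Sum.elim χ1 χ2 t)} = Sum.inl '' {t | v ∈ χ1 t} ∪ Sum.inr '' {t | v ∈ χ2 t} := by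
      ext (x | x) <;> simp
    rw [key]
    by_cases hv1 : v ∈ U1 <;> by_cases hv2 : v ∈ U2
    · exact (c1 _ (a5 v hv1)).union_adj (c2 _ (b5 v hv2)) ⟨t1, a8 (hW1 ⟨hv1, hv2⟩), rfl⟩
        ⟨t2, b8 (hW2 ⟨hv1, hv2⟩), rfl⟩ hE12
    · have : {t | v ∈ χ2 t} = ∅ := by
        ext t; simp only [mem_ofPred_eq, mem_empty_iff_false, iff_false]
        exact fun h => hv2 (b4 t h)
      rw [this, image_empty, union_empty]; exact c1 _ (a5 v hv1)
    · have : {t | v ∈ χ1 t} = ∅ := by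
        ext t; simp only [mem_ofPred_eq, mem_empty_iff_false, iff_false]
        exact fun h => hv1 (a4 t h)
      rw [this, image_empty, empty_union]; exact c2 _ (b5 v hv2)
    · exact absurd hv (by simp [hv1, hv2])
  · intro u hu v hv huv
    rcases hE u hu v hv huv with ⟨h1, h2⟩ | ⟨h1, h2⟩
    · obtain ⟨t, ht⟩ := a6 u h1 v h2 huv; exact ⟨.inl t, ht⟩
    · obtain ⟨t, ht⟩ := b6 u h1 v h2 huv; exact ⟨.inr t, ht⟩
  · rintro (t | t)
    · exact a7 t
    · exact b7 t
  · exact a8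

open Classical in
theorem td_of_balanced (G : SimpleGraph V) (k : ℕ) (hk : 1 ≤ k)
    (H : ∀ W : Finset V, ∃ S : Finset V, S.card ≤ k ∧ ∀ X, Conn G X → Disjoint X (S : Set V) →
      2 * (W.filter (· ∈ X)).card ≤ W.card) :
    ∀ (n : ℕ) (U W : Finset V), U.card ≤ n → W ⊆ U → W.card ≤ 3 * k → TD G (4 * k) U W := by
  intro n
  induction n with
  | zero =>
    intro U W hU hW _
    exact TD.single G U (by omega) (by exact_mod_cast hW)
  | succ n IH =>
  intro U W hU hWU hW
  by_cases hs : U.card ≤ 4 * k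
  · exact TD.single G U hs (by exact_mod_cast hWU)
  obtain ⟨W', hWW', hW'U, hW'c⟩ := Finset.exists_subsuperset_card_eq hWU hW (by omega : 3 * k ≤ U.card)
  obtain ⟨S, hSk, hS⟩ := H W'
  set S' := S ∩ U with hS'
  have hS'c : S'.card ≤ k := (Finset.card_le_card Finset.inter_subset_left).trans hSk
  have key : ∀ (m : ℕ) (Q : Finset V), Q.card ≤ m → Q ⊆ U \ S →
      (∀ a ∈ Q, ∀ b ∈ U \ S, G.Adj a b → b ∈ Q) →
      TD G (4 * k) ((Q ∪ (W' ∪ S') : Finset V) : Set V) ((W' ∪ S' : Finset V) : Set V) := by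
    intro m
    induction m with
    | zero =>
      intro Q hQ _ _
      have : Q = ∅ := by simpa using hQ
      subst this
      rw [Finset.empty_union]
      exact TD.single G _ ((Finset.card_union_le _ _).trans (by omega)) le_rfl
    | succ m ih =>
      intro Q hQ hQU hQc
      rcases Q.eq_empty_or_nonempty with rfl | ⟨x, hx⟩
      · rw [Finset.empty_union]
        exact TD.single G _ ((Finset.card_union_le _ _).trans (by omega)) le_rfl
      let C : Finset V := Q.filter (fun y => ∃ X, Conn G X ∧ X ⊆ (Q : Set V) ∧ x ∈ X ∧ y ∈ X)
      have hCQ : C ⊆ Q := Finset.filter_subset _ _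
      have hxC : x ∈ C := Finset.mem_filter.2 ⟨hx, {x}, Conn.singleton x, by simpa using hx, rfl, rfl⟩
      have hCcl : ∀ a ∈ C, ∀ b ∈ U \ S, G.Adj a b → b ∈ C := by
        intro a ha b hb hab
        obtain ⟨haQ, X, hX, hXQ, hxX, haX⟩ := Finset.mem_filter.1 ha
        have hbQ := hQc a haQ b hb hab
        exact Finset.mem_filter.2 ⟨hbQ, insert b X, hX.insert_adj haX hab,
          insert_subset hbQ hXQ, Or.inr hxX, Or.inl rfl⟩
      have hCconn : Conn G (C : Set V) := by
        refine conn_of_root (r := x) hxC fun L hL hc y hy => ?_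
        obtain ⟨hyQ, X, hX, hXQ, hxX, hyX⟩ := Finset.mem_filter.1 hy
        have hXC : ∀ z ∈ X, z ∈ C := fun z hz => Finset.mem_filter.2 ⟨hXQ hz, X, hX, hXQ, hxX, hz⟩
        exact hX.closed ⟨x, hxX, hL⟩ (fun a ha haL b hb hab => hc a (hXC a ha) haL b (hXC b hb) hab) hyX
      have hCS : ∀ y ∈ C, y ∉ S := fun y hy => (Finset.mem_sdiff.1 (hQU (hCQ hy))).2
      have hCU : C ⊆ U := fun y hy => (Finset.mem_sdiff.1 (hQU (hCQ hy))).1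
      have hbal := hS (C : Set V) hCconn (by
        rw [Finset.disjoint_coe, Finset.disjoint_left]; exact hCS)
      have hCW : (W'.filter (· ∈ (C : Set V))) = C ∩ W' := by
        ext y; simp [and_comm]
      replace hbal : 2 * (C ∩ W').card ≤ W'.card := by
        rw [← hCW]; convert hbal
      have t1 := ih (Q \ C) (by
        have := Finset.card_lt_card (s := Q \ C) (t := Q)
          ⟨Finset.sdiff_subset, fun h => (Finset.mem_sdiff.1 (h hx)).2 hxC⟩
        omega) (Finset.sdiff_subset.trans hQU) (by
        intro a ha b hb hab
        rw [Finset.mem_sdiff] at ha ⊢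
        refine ⟨hQc a ha.1 b hb hab, fun hbC => ha.2 (hCcl b hbC a (hQU ha.1) hab.symm)⟩)
      have hS'U : S' ⊆ U := Finset.inter_subset_right
      have t2 := IH (C ∪ S') ((C ∩ W') ∪ S') (by
        have : (C ∪ S').card < U.card := by
          apply Finset.card_lt_card
          refine ⟨Finset.union_subset hCU hS'U, fun h => ?_⟩
          have : W' ⊆ (C ∩ W') ∪ S' := by
            intro w hw
            rcases Finset.mem_union.1 (h (hW'U hw)) with h1 | h1
            · exact Finset.mem_union_left _ (Finset.mem_inter.2 ⟨h1, hw⟩)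
            · exact Finset.mem_union_right _ h1
          have := (Finset.card_le_card this).trans (Finset.card_union_le _ _)
          omega
        omega) (Finset.union_subset_union_left Finset.inter_subset_left)
        ((Finset.card_union_le _ _).trans (by omega))
      have hun : ((Q ∪ (W' ∪ S') : Finset V) : Set V) =
          ((Q \ C ∪ (W' ∪ S') : Finset V) : Set V) ∪ ((C ∪ S' : Finset V) : Set V) := by
        ext y
        simp only [Finset.coe_union, Finset.coe_sdiff, Set.mem_union, Set.mem_sdiff, Finset.mem_coe]
        have := @hCQ y
        tauto
      have hS'S : ∀ y ∈ S', y ∈ S := fun y hy => (Finset.mem_inter.1 hy).1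
      have hmemS' : ∀ y, y ∈ U → y ∈ S → y ∈ S' := fun y h1 h2 => Finset.mem_inter.2 ⟨h2, h1⟩
      rw [hun]
      refine t1.glue t2 ?_ ?_ ?_
      · rintro y ⟨h1, h2⟩
        have := hCS y
        simp only [Finset.coe_union, Finset.coe_sdiff, Set.mem_union, Set.mem_sdiff, Finset.mem_coe] at *
        tauto
      · rintro y ⟨h1, h2⟩
        have := hCS y
        simp only [Finset.coe_union, Finset.coe_sdiff, Finset.coe_inter, Set.mem_inter_iff, Set.mem_union, Set.mem_sdiff, Finset.mem_coe] at *
        have := hS'S y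
        tauto
      · rw [← hun]
        have hU' : ∀ y ∈ ((Q ∪ (W' ∪ S') : Finset V) : Set V), y ∈ U := by
          intro y hy
          simp only [Finset.coe_union, Set.mem_union, Finset.mem_coe] at hy
          rcases hy with h | h | h
          · exact (Finset.mem_sdiff.1 (hQU h)).1
          · exact hW'U h
          · exact hS'U h
        have hcl : ∀ u v, u ∈ C → v ∈ U → G.Adj u v → v ∈ C ∨ v ∈ S' := by
          intro u v hu hv huv
          by_cases hvS : v ∈ S
          · exact Or.inr (hmemS' v hv hvS)
          · exact Or.inl (hCcl u hu v (Finset.mem_sdiff.2 ⟨hv, hvS⟩) huv)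
        intro u hu v hv huv
        simp only [Finset.coe_union, Finset.coe_sdiff, Set.mem_union, Set.mem_sdiff, Finset.mem_coe]
        by_cases huC : u ∈ C
        · exact Or.inr ⟨Or.inl huC, hcl u v huC (hU' v hv) huv⟩
        by_cases hvC : v ∈ C
        · exact Or.inr ⟨hcl v u hvC (hU' u hu) huv.symm, Or.inl hvC⟩
        simp only [Finset.coe_union, Set.mem_union, Finset.mem_coe] at hu hv
        exact Or.inl ⟨hu.imp_left (fun h => ⟨h, huC⟩), hv.imp_left (fun h => ⟨h, hvC⟩)⟩
  have hfin := key _ (U \ S) le_rfl le_rfl (fun a _ b hb _ => hb)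
  have hUeq : U \ S ∪ (W' ∪ S') = U := by
    ext y
    have h1 := @hW'U y
    simp only [Finset.mem_union, Finset.mem_sdiff, hS', Finset.mem_inter]
    tauto
  rw [hUeq] at hfin
  obtain ⟨ι, T, χ, t0, rk, g1, g2, g3, g4, g5, g6, g7, g8⟩ := hfin
  refine ⟨ι, T, χ, t0, rk, g1, g2, g3, g4, g5, g6, g7, fun w hw => g8 ?_⟩
  simp only [Finset.coe_union, Set.mem_union, Finset.mem_coe] at hw ⊢
  exact Or.inl (hWW' hw)

end GT

namespace GT
variable {V : Type}

lemma bramble_segments (G : SimpleGraph V) (B : Set V → Prop) (f : ℕ → V) (m n : ℕ) (hn : 1 ≤ n)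
    (hadj : ∀ i, i + 1 < m → G.Adj (f i) (f (i + 1))) (hinj : ∀ i j, i < j → j < m → f i ≠ f j) :
    ∀ (N a : ℕ), (∀ S : Finset V, S.card < N * n → ∃ X, B X ∧ Disjoint X (S : Set V) ∧
        (X ∩ f '' {i | a ≤ i ∧ i < m}).Nonempty) →
      ∃ T : Fin N → Set V, (∀ i, Conn G (T i)) ∧ (∀ i, T i ⊆ f '' {i | a ≤ i ∧ i < m}) ∧
        (∀ i j, i ≠ j → Disjoint (T i) (T j)) ∧
        (∀ i, ∀ S : Finset V, S.card < n → ∃ X, B X ∧ Disjoint X (S : Set V) ∧ (X ∩ T i).Nonempty) := by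
  classical
  intro N
  induction N with
  | zero => intro a _; exact ⟨fun i => i.elim0, fun i => i.elim0, fun i => i.elim0, fun i => i.elim0, fun i => i.elim0⟩
  | succ N ih =>
    intro a ha
    let P : ℕ → Prop := fun b => b ≤ m ∧ ∀ S : Finset V, S.card < n → ∃ X, B X ∧ Disjoint X (S : Set V) ∧
      (X ∩ f '' {i | a ≤ i ∧ i < b}).Nonempty
    have hex : ∃ b, P b := ⟨m, le_rfl, fun S hS => ha S (by nlinarith)⟩
    obtain ⟨hbm, hb⟩ := Nat.find_spec hex
    have hmin := fun b (h : b < Nat.find hex) => Nat.find_min hex h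
    set b := Nat.find hex
    have hab : a < b := by
      obtain ⟨X, _, _, _, _, ⟨i, ⟨h1, h2⟩, _⟩⟩ := hb ∅ (by rw [Finset.card_empty]; omega)
      omega
    have h1 := hmin (b - 1) (by omega)
    have h2 : ∃ S : Finset V, S.card < n ∧ ∀ X, B X → Disjoint X (S : Set V) →
        ¬ (X ∩ f '' {i | a ≤ i ∧ i < b - 1}).Nonempty := by
      by_contra hcon
      push Not at hcon
      refine h1 ⟨by omega, fun S hS => ?_⟩
      obtain ⟨X, hX⟩ := hcon S hS
      exact ⟨X, hX⟩
    obtain ⟨S0, hS0, hS0'⟩ := h2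
    have := ih b ?_
    · obtain ⟨T, hT1, hT2, hT3, hT4⟩ := this
      have hdis : ∀ i, Disjoint (f '' {i | a ≤ i ∧ i < b}) (T i) := by
        intro i
        rw [Set.disjoint_left]
        rintro _ ⟨x, ⟨hx1, hx2⟩, rfl⟩ hx
        obtain ⟨y, ⟨hy1, hy2⟩, hy⟩ := hT2 i hx
        exact hinj x y (by omega) hy2 hy.symm
      refine ⟨Fin.cons (f '' {i | a ≤ i ∧ i < b}) T, ?_, ?_, ?_, ?_⟩
      · intro i
        refine Fin.cases ?_ (fun i => ?_) i
        · exact conn_interval hab (fun i _ hi => hadj i (by omega))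
        · exact hT1 i
      · intro i
        refine Fin.cases ?_ (fun i => ?_) i
        · rintro _ ⟨x, ⟨hx1, hx2⟩, rfl⟩; exact ⟨x, ⟨hx1, by omega⟩, rfl⟩
        · intro y hy
          obtain ⟨x, ⟨hx1, hx2⟩, rfl⟩ := hT2 i hy
          exact ⟨x, ⟨by omega, hx2⟩, rfl⟩
      · intro i j
        refine Fin.cases ?_ (fun i => ?_) i <;> refine Fin.cases ?_ (fun j => ?_) j
        · intro h; exact absurd rfl h
        · intro _; exact hdis j
        · intro _; exact (hdis i).symm
        · intro h; exact hT3 i j (fun h' => h (by rw [h']))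
      · intro i
        refine Fin.cases ?_ (fun i => ?_) i
        · exact hb
        · exact hT4 i
    · intro S hS
      obtain ⟨X, hX, hXS, hXh⟩ := ha (S ∪ insert (f (b - 1)) S0) (by
        have h1 := Finset.card_union_le S (insert (f (b - 1)) S0)
        have h2 := Finset.card_insert_le (f (b - 1)) S0
        have : (N + 1) * n = N * n + n := by ring
        omega)
      rw [Finset.coe_union, Finset.coe_insert, Set.disjoint_union_right, Set.disjoint_insert_right] at hXS
      refine ⟨X, hX, hXS.1, ?_⟩
      obtain ⟨y, hy, i, ⟨hi1, hi2⟩, rfl⟩ := hXh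
      refine ⟨f i, hy, i, ⟨?_, hi2⟩, rfl⟩
      by_contra hib
      rcases eq_or_ne i (b - 1) with rfl | hne
      · exact hXS.2.1 hy
      · exact hS0' X hX hXS.2.2 ⟨f i, hy, i, ⟨hi1, by omega⟩, rfl⟩

lemma bramble_path [Finite V] (G : SimpleGraph V) (B : Set V → Prop) (hB : ∀ X, B X → Conn G X)
    (hBB : ∀ X Y, B X → B Y → (X ∩ Y).Nonempty) (hne : ∃ X, B X) :
    ∃ (f : ℕ → V) (m : ℕ), (∀ i, i + 1 < m → G.Adj (f i) (f (i + 1))) ∧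
      (∀ i j, i < j → j < m → f i ≠ f j) ∧ ∀ X, B X → (X ∩ f '' {i | i < m}).Nonempty := by
  classical
  by_contra hcon
  push Not at hcon
  have key : ∀ (N : ℕ) (f : ℕ → V) (m : ℕ) (X : Set V), B X → f m ∈ X → (∀ i < m, f i ∉ X) →
      (∀ i, i < m → G.Adj (f i) (f (i + 1))) → (∀ i j, i < j → j ≤ m → f i ≠ f j) →
      {Y | B Y ∧ ∀ i ≤ m, f i ∉ Y}.ncard ≤ N → False := by
    intro N
    induction N with
    | zero =>
      intro f m X hX hm hmX hadj hinj hN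
      obtain ⟨Y, hY, hY'⟩ := hcon f (m + 1) (fun i hi => hadj i (by omega))
        (fun i j hij hj => hinj i j hij (by omega))
      have h0 : {Y | B Y ∧ ∀ i ≤ m, f i ∉ Y} = ∅ := by
        rw [← Set.ncard_eq_zero (Set.toFinite _)]; omega
      have : Y ∈ {Y | B Y ∧ ∀ i ≤ m, f i ∉ Y} := by
        refine ⟨hY, fun i hi hiY => ?_⟩
        have : f i ∈ Y ∩ f '' {i | i < m + 1} := ⟨hiY, i, Nat.lt_succ_of_le hi, rfl⟩
        rw [hY'] at this; exact this
      rw [h0] at this; exact this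
    | succ N ih =>
      intro f m X hX hm hmX hadj hinj hN
      obtain ⟨Y, hY, hY'⟩ := hcon f (m + 1) (fun i hi => hadj i (by omega))
        (fun i j hij hj => hinj i j hij (by omega))
      have hYf : ∀ i ≤ m, f i ∉ Y := by
        intro i hi hiY
        have : f i ∈ Y ∩ f '' {i | i < m + 1} := ⟨hiY, i, Nat.lt_succ_of_le hi, rfl⟩
        rw [hY'] at this; exact this
      obtain ⟨g, n, g0, gn, gX, gadj, gA, gB, ginj, _⟩ :=
        (hB X hX).exists_ipath (A := {f m}) (B := Y) ⟨f m, hm, rfl⟩ (hBB X Y hX hY)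
      have g0' : g 0 = f m := g0
      have hcat : ∀ i ≤ m, (fun i => if i ≤ m then f i else g (i - m)) i = f i := fun i hi => by simp [hi]
      have hcat2 : ∀ i, m ≤ i → (fun i => if i ≤ m then f i else g (i - m)) i = g (i - m) := by
        intro i hi
        rcases eq_or_lt_of_le hi with rfl | h
        · simp [g0']
        · simp [not_le.2 h]
      set F : ℕ → V := fun i => if i ≤ m then f i else g (i - m) with hF
      refine ih F (m + n) Y hY ?_ ?_ ?_ ?_ ?_
      · rw [hcat2 _ (by omega)]; simpa using gn
      · intro i hi
        rcases Nat.lt_or_ge i m with h | h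
        · rw [hcat i (by omega)]; exact hYf i (by omega)
        · rw [hcat2 i h]
          intro h'
          have := gB (i - m) (by omega) h'
          omega
      · intro i hi
        rcases Nat.lt_or_ge i m with h | h
        · rw [hcat i (by omega), hcat (i + 1) (by omega)]; exact hadj i h
        · rw [hcat2 i h, hcat2 (i + 1) (by omega), show i + 1 - m = (i - m) + 1 by omega]
          exact gadj _ (by omega)
      · intro i j hij hj
        rcases Nat.lt_or_ge i m with h | h
        · rw [hcat i (by omega)]
          rcases Nat.lt_or_ge j m with h' | h'
          · rw [hcat j (by omega)]; exact hinj i j hij (by omega)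
          · rw [hcat2 j h']
            intro heq
            exact hmX i h (heq ▸ gX _ (by omega))
        · rw [hcat2 i h, hcat2 j (by omega)]
          exact ginj _ _ (by omega) (by omega)
      · have : {Z | B Z ∧ ∀ i ≤ m + n, F i ∉ Z} ⊂ {Z | B Z ∧ ∀ i ≤ m, f i ∉ Z} := by
          refine ⟨fun Z hZ => ⟨hZ.1, fun i hi => ?_⟩, fun hsub => ?_⟩
          · rw [← hcat i hi]; exact hZ.2 i (by omega)
          · have := (hsub (show Y ∈ _ from ⟨hY, hYf⟩)).2 (m + n) le_rfl
            rw [hcat2 _ (by omega)] at this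
            simp only [Nat.add_sub_cancel_left] at this
            exact this gn
        have := Set.ncard_lt_ncard this (Set.toFinite _)
        omega
  obtain ⟨X, hX⟩ := hne
  obtain ⟨x, hx⟩ := (hB X hX).1
  exact key _ (fun _ => x) 0 X hX hx (by simp) (by simp) (by omega) le_rfl

open Classical in
theorem tangle_of_tw (N n : ℕ) (V : Type) [Finite V] (G : SimpleGraph V)
    (h : ¬ Paper.HasTreewidthAtMost G (4 * (N * (n + 1) + 1))) :
    ∃ T : Fin N → Set V, (∀ i, Conn G (T i)) ∧ (∀ i j, i ≠ j → Disjoint (T i) (T j)) ∧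
      (∀ i j, i ≠ j → Lk G (T i) (T j) n) := by
  have := Fintype.ofFinite V
  set k := N * (n + 1) + 1 with hk
  by_cases H : ∀ W : Finset V, ∃ S : Finset V, S.card ≤ k ∧ ∀ X, Conn G X → Disjoint X (S : Set V) →
      2 * (W.filter (· ∈ X)).card ≤ W.card
  · exfalso
    have := td_of_balanced G k (by omega) H _ Finset.univ ∅ le_rfl (by simp) (by simp)
    obtain ⟨ι, T, χ, t0, rk, g1, g2, g3, g4, g5, g6, g7, g8⟩ := this
    rw [Finset.coe_univ] at *
    exact h (TD.toTw (W := (∅ : Finset V)) ⟨ι, T, χ, t0, rk, g1, g2, g3, g4, g5, g6,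
      fun t => (g7 t).trans (by omega), g8⟩)
  push Not at H
  obtain ⟨W, hW⟩ := H
  let B : Set V → Prop := fun X => Conn G X ∧ W.card < 2 * (W.filter (· ∈ X)).card
  have hBB : ∀ X Y, B X → B Y → (X ∩ Y).Nonempty := by
    rintro X Y ⟨_, hX⟩ ⟨_, hY⟩
    by_contra hcon
    have hd : Disjoint (W.filter (· ∈ X)) (W.filter (· ∈ Y)) := by
      rw [Finset.disjoint_left]
      intro a ha hb
      exact hcon ⟨a, (Finset.mem_filter.1 ha).2, (Finset.mem_filter.1 hb).2⟩
    have h1 := Finset.card_union_of_disjoint hd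
    have h2 := Finset.card_le_card (Finset.union_subset (Finset.filter_subset (· ∈ X) W)
      (Finset.filter_subset (· ∈ Y) W))
    omega
  obtain ⟨f, m, hadj, hinj, hhit⟩ := bramble_path G B (fun X hX => hX.1) hBB (by
    obtain ⟨X, h1, _, h2⟩ := hW ∅ (by simp)
    exact ⟨X, h1, h2⟩)
  obtain ⟨T, h1, _, h3, h4⟩ := bramble_segments G B f m (n + 1) (by omega) hadj hinj N 0 (by
    intro S hS
    obtain ⟨X, h1, h2, h3⟩ := hW S (by omega)
    refine ⟨X, ⟨h1, h3⟩, h2, ?_⟩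
    simpa using hhit X ⟨h1, h3⟩)
  refine ⟨T, h1, h3, fun i j _ S hS => ?_⟩
  obtain ⟨X, hX, hXS, hXi⟩ := h4 i S (by omega)
  obtain ⟨Y, hY, hYS, hYj⟩ := h4 j S (by omega)
  refine ⟨X ∪ Y, hX.1.union hY.1 (hBB X Y hX hY), Set.disjoint_union_left.2 ⟨hXS, hYS⟩, ?_, ?_⟩
  · exact hXi.mono (inter_subset_inter_left _ subset_union_left)
  · exact hYj.mono (inter_subset_inter_left _ subset_union_right)

/-- the grid minor theorem -/
theorem grid_minor (r : ℕ) : ∃ M : ℕ, ∀ (V : Type) [Finite V] (G : SimpleGraph V),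
    ¬ Paper.HasTreewidthAtMost G M → GridMinor r G := by
  obtain ⟨N, n, h⟩ := grid_of_tangle r
  refine ⟨4 * (N * (n + 1) + 1), fun V _ G hG => ?_⟩
  obtain ⟨T, h1, h2, h3⟩ := tangle_of_tw N n V G hG
  exact h V G T h1 h2 h3

end GT

namespace GT

/-- equivalence: equal, or adjacent with both degrees at least three -/
def sat (V : Type) (G : SimpleGraph V) (hs : ¬∃ a v u : V, Paper.HeavySeagull G a v u) : Setoid V where
  r x y := x = y ∨ (G.Adj x y ∧ 3 ≤ Paper.deg G x ∧ 3 ≤ Paper.deg G y)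
  iseqv := by
    refine ⟨fun x => Or.inl rfl, ?_, ?_⟩
    · rintro x y (rfl | ⟨h1, h2, h3⟩)
      · exact Or.inl rfl
      · exact Or.inr ⟨h1.symm, h3, h2⟩
    · rintro x y z (rfl | ⟨h1, h2, h3⟩) (rfl | ⟨g1, g2, g3⟩)
      · exact Or.inl rfl
      · exact Or.inr ⟨g1, g2, g3⟩
      · exact Or.inr ⟨h1, h2, h3⟩
      · by_cases hxz : x = z
        · exact Or.inl hxz
        · refine Or.inr ⟨?_, h2, g3⟩
          by_contra hn
          exact hs ⟨x, y, z, hxz, h1, g1, hn, h2, g3⟩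

theorem sat_grid (r t : ℕ) : ∃ M : ℕ, ∀ (V : Type) [Fintype V] (G : SimpleGraph V),
    (∀ s : Set V, G.IsClique s → s.ncard ≤ t) → (¬∃ a v u : V, Paper.HeavySeagull G a v u) →
    ¬ Paper.HasTreewidthAtMost G M → ∃ ψ : ℕ → ℕ → Set V,
      (∀ i j, i < r → j < r → Conn G (ψ i j)) ∧
      (∀ i j i' j', i < r → j < r → i' < r → j' < r → ¬(i = i' ∧ j = j') →
        Disjoint (ψ i j) (ψ i' j')) ∧
      (∀ i j, i + 1 < r → j < r → ∃ x ∈ ψ i j, ∃ y ∈ ψ (i + 1) j, G.Adj x y) ∧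
      (∀ i j, i < r → j + 1 < r → ∃ x ∈ ψ i j, ∃ y ∈ ψ i (j + 1), G.Adj x y) ∧
      (∀ x y, G.Adj x y → 3 ≤ Paper.deg G x → 3 ≤ Paper.deg G y → ∀ i j, x ∈ ψ i j → y ∈ ψ i j) := by
  classical
  obtain ⟨M, hM⟩ := grid_minor r
  refine ⟨(M + 1) * t, fun V _ G hcl hs htw => ?_⟩
  let s := sat V G hs
  let π : V → Quotient s := fun v => Quotient.mk s v
  have hπ : ∀ x y, π x = π y ↔ (x = y ∨ (G.Adj x y ∧ 3 ≤ Paper.deg G x ∧ 3 ≤ Paper.deg G y)) :=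
    fun x y => Quotient.eq (r := s)
  let G' : SimpleGraph (Quotient s) :=
    SimpleGraph.mk (fun a b => a ≠ b ∧ ∃ x y, π x = a ∧ π y = b ∧ G.Adj x y)
      ⟨fun a b ⟨h, x, y, hx, hy, hxy⟩ => ⟨h.symm, y, x, hy, hx, hxy.symm⟩⟩
      ⟨fun a h => h.1 rfl⟩
  have hfib : ∀ c, G.IsClique {x | π x = c} := by
    intro c x hx y hy hne
    have : π x = π y := hx.trans hy.symm
    rcases (hπ x y).1 this with h | h
    · exact absurd h hne
    · exact h.1
  have htw' : ¬ Paper.HasTreewidthAtMost G' M := by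
    rintro ⟨ι, T, χ, h1, h2, h3, h4, h5⟩
    refine htw ⟨ι, T, fun i => Finset.univ.filter (fun v => π v ∈ χ i), h1, ?_, ?_, ?_, ?_⟩
    · intro v
      obtain ⟨i, hi⟩ := h2 (π v)
      exact ⟨i, by simpa using hi⟩
    · intro u v huv
      by_cases he : π u = π v
      · obtain ⟨i, hi⟩ := h2 (π v)
        exact ⟨i, by simpa [he] using hi, by simpa using hi⟩
      · obtain ⟨i, hi⟩ := h3 (π u) (π v) ⟨he, u, v, rfl, rfl, huv⟩
        exact ⟨i, by simpa using hi⟩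
    · intro v
      have hset : {i | v ∈ Finset.univ.filter (fun v => π v ∈ χ i)} = {i | π v ∈ χ i} := by
        ext i; simp
      have := h4 (π v)
      rw [← hset] at this
      exact this
    · intro i
      have hb : Finset.univ.filter (fun v => π v ∈ χ i) =
          (χ i).biUnion (fun c => Finset.univ.filter (fun v => π v = c)) := by
        ext v; simp
      show (Finset.univ.filter (fun v => π v ∈ χ i)).card ≤ _
      rw [hb]
      have hc := Finset.card_biUnion_le_card_mul (χ i)
        (fun c => Finset.univ.filter (fun v => π v = c)) t (fun c _ => by
          have := hcl _ (hfib c)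
          rw [Set.ncard_eq_toFinset_card'] at this
          refine le_trans (le_of_eq ?_) this
          congr 1; ext v; simp)
      have := h5 i
      have h6 : (χ i).card * t ≤ (M + 1) * t := Nat.mul_le_mul_right _ this
      omega
  obtain ⟨φ, h1, h2, h3, h4⟩ := hM _ G' htw'
  have hedge : ∀ A B : Set (Quotient s), Disjoint A B → (∃ x ∈ A, ∃ y ∈ B, G'.Adj x y) →
      ∃ x ∈ π ⁻¹' A, ∃ y ∈ π ⁻¹' B, G.Adj x y := by
    rintro A B _ ⟨a, ha, b, hb, _, x, y, rfl, rfl, hxy⟩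
    exact ⟨x, ha, y, hb, hxy⟩
  refine ⟨fun i j => π ⁻¹' (φ i j), ?_, ?_, ?_, ?_, ?_⟩
  · intro i j hi hj
    have hc := h1 i j hi hj
    obtain ⟨a, ha⟩ := hc.1
    obtain ⟨x0, rfl⟩ := Quotient.exists_rep a
    refine conn_of_root (r := x0) ha fun L hL hcl => ?_
    have hsatL : ∀ x y, π x ∈ φ i j → π x = π y → x ∈ L → y ∈ L := by
      intro x y hx hxy hxL
      rcases (hπ x y).1 hxy with rfl | h
      · exact hxL
      · exact hcl x hx hxL y (by rw [mem_preimage, ← hxy]; exact hx) h.1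
    have := hc.closed (L := {c | ∀ x, π x = c → x ∈ L}) ⟨_, ha, fun x hx => hsatL x0 x ha hx.symm hL⟩ ?_
    · intro x hx; exact this hx x rfl
    · rintro a ha haL b hb ⟨_, x, y, rfl, rfl, hxy⟩ z hz
      exact hsatL y z hb hz.symm (hcl x ha (haL x rfl) y hb hxy)
  · intro i j i' j' hi hj hi' hj' hne
    exact (h2 i j i' j' hi hj hi' hj' hne).preimage π
  · intro i j hi hj
    exact hedge _ _ (h2 i j (i + 1) j (by omega) hj hi hj (by omega)) (h3 i j hi hj)
  · intro i j hi hj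
    exact hedge _ _ (h2 i j i (j + 1) hi (by omega) hi hj (by omega)) (h4 i j hi hj)
  · intro x y hxy hx hy i j hxi
    have : π x = π y := (hπ x y).2 (Or.inr ⟨hxy, hx, hy⟩)
    rw [mem_preimage, ← this]; exact hxi

end GT

namespace GT
variable {V : Type} {G : SimpleGraph V}

/-- induced path given by a function -/
def IP (G : SimpleGraph V) (f : ℕ → V) (n : ℕ) : Prop :=
  (∀ i < n, G.Adj (f i) (f (i + 1))) ∧ (∀ i j, i ≤ n → j ≤ n → f i = f j → i = j) ∧
    (∀ i j, i ≤ n → j ≤ n → G.Adj (f i) (f j) → i + 1 = j ∨ j + 1 = i)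

def DT (G : SimpleGraph V) (A : ℕ → V) (a : ℕ) (B : ℕ → V) (b : ℕ) : Prop :=
  ∀ i j, 1 ≤ i → i ≤ a → 1 ≤ j → j ≤ b → A i ≠ B j ∧ ¬ G.Adj (A i) (B j)

def DD (G : SimpleGraph V) (A : ℕ → V) (a : ℕ) (B : ℕ → V) (b : ℕ) : Prop :=
  G.Adj (A 0) (B 0) ∧ ∀ i j, i ≤ a → j ≤ b → A i ≠ B j ∧ (G.Adj (A i) (B j) → i = 0 ∧ j = 0)

lemma IP.rev {f : ℕ → V} {n j : ℕ} (h : IP G f n) (hj : j ≤ n) : IP G (fun i => f (j - i)) j := by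
  obtain ⟨h1, h2, h3⟩ := h
  refine ⟨fun i hi => ?_, fun i k hi hk he => ?_, fun i k hi hk he => ?_⟩
  · have := h1 (j - (i + 1)) (by omega)
    rw [show j - (i + 1) + 1 = j - i by omega] at this
    exact this.symm
  · have := h2 _ _ (by omega) (by omega) he; omega
  · have := h3 _ _ (by omega) (by omega) he; omega

lemma IP.shift {f : ℕ → V} {n j : ℕ} (h : IP G f n) (hj : j ≤ n) : IP G (fun i => f (j + i)) (n - j) := by
  obtain ⟨h1, h2, h3⟩ := h
  refine ⟨fun i hi => h1 (j + i) (by omega), fun i k hi hk he => ?_, fun i k hi hk he => ?_⟩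
  · have := h2 _ _ (by omega) (by omega) he; omega
  · have := h3 _ _ (by omega) (by omega) he; omega

def consF (v : V) (f : ℕ → V) : ℕ → V
  | 0 => v
  | i + 1 => f i

lemma IP.cons {f : ℕ → V} {n : ℕ} (h : IP G f n) (v : V) (hv : G.Adj v (f 0))
    (hne : ∀ i ≤ n, v ≠ f i) (hna : ∀ i ≤ n, G.Adj v (f i) → i = 0) : IP G (consF v f) (n + 1) := by
  obtain ⟨h1, h2, h3⟩ := h
  refine ⟨?_, ?_, ?_⟩
  · rintro (_ | i) hi
    · exact hv
    · exact h1 i (by omega)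
  · rintro (_ | i) (_ | j) hi hj he
    · rfl
    · exact absurd he (hne j (by omega))
    · exact absurd he.symm (hne i (by omega))
    · rw [h2 i j (by omega) (by omega) he]
  · rintro (_ | i) (_ | j) hi hj he
    · exact absurd he (G.loopless.irrefl _)
    · have := hna j (by omega) he; omega
    · have := hna i (by omega) he.symm; omega
    · have := h3 i j (by omega) (by omega) he; omega

lemma IP.single (v : V) : IP G (fun _ => v) 0 :=
  ⟨by omega, fun i j hi hj _ => by omega, fun i j hi hj h => absurd h (G.loopless.irrefl _)⟩

def Tripod (G : SimpleGraph V) (X : Set V) (x y z : V) (A : ℕ → V) (a : ℕ) (B : ℕ → V) (b : ℕ)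
    (C : ℕ → V) (c : ℕ) : Prop :=
  IP G A a ∧ IP G B b ∧ IP G C c ∧ A a = x ∧ B b = y ∧ C c = z ∧
    (∀ i ≤ a, A i ∈ X) ∧ (∀ i ≤ b, B i ∈ X) ∧ (∀ i ≤ c, C i ∈ X) ∧
    ((A 0 = B 0 ∧ A 0 = C 0 ∧ DT G A a B b ∧ DT G A a C c ∧ DT G B b C c) ∨
      (DD G A a B b ∧ DD G A a C c ∧ DD G B b C c))

theorem tripod {X : Set V} (hX : Conn G X) {x y z : V} (hx : x ∈ X) (hy : y ∈ X) (hz : z ∈ X) :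
    ∃ A a B b C c, Tripod G X x y z A a B b C c := by
  classical
  obtain ⟨f, n, f0, fn, fX, fadj, _, _, finj, find⟩ :=
    hX.exists_ipath (A := {x}) (B := {y}) ⟨x, hx, rfl⟩ ⟨y, hy, rfl⟩
  have f0 : f 0 = x := f0
  have fn : f n = y := fn
  have hf : IP G f n := by
    refine ⟨fadj, fun i j hi hj he => ?_, fun i j hi hj he => ?_⟩
    · rcases Nat.lt_trichotomy i j with h | h | h
      · exact absurd he (finj i j h hj)
      · exact h
      · exact absurd he.symm (finj j i h hi)
    · rcases Nat.lt_trichotomy i j with h | h | h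
      · exact Or.inl (find i j h hj he).symm
      · subst h; exact absurd he (G.loopless.irrefl _)
      · exact Or.inr (find j i h hi he.symm).symm
  obtain ⟨g, m, g0, gm, gX, gadj, _, gB, ginj, gind⟩ :=
    hX.exists_ipath (A := {z}) (B := {v | ∃ i ≤ n, v = f i ∨ G.Adj v (f i)}) ⟨z, hz, rfl⟩
      ⟨f 0, fX 0 (by omega), 0, by omega, Or.inl rfl⟩
  have g0 : g 0 = z := g0
  have hg : IP G g m := by
    refine ⟨gadj, fun i j hi hj he => ?_, fun i j hi hj he => ?_⟩
    · rcases Nat.lt_trichotomy i j with h | h | h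
      · exact absurd he (ginj i j h hj)
      · exact h
      · exact absurd he.symm (ginj j i h hi)
    · rcases Nat.lt_trichotomy i j with h | h | h
      · exact Or.inl (gind i j h hj he).symm
      · subst h; exact absurd he (G.loopless.irrefl _)
      · exact Or.inr (gind j i h hi he.symm).symm
  have hgf : ∀ i j, i < m → j ≤ n → g i ≠ f j ∧ ¬ G.Adj (g i) (f j) := by
    intro i j hi hj
    constructor
    · intro h; have := gB i (by omega) ⟨j, hj, Or.inl h⟩; omega
    · intro h; have := gB i (by omega) ⟨j, hj, Or.inr h⟩; omega
  have hfirev := fun j (hj : j ≤ n) => hf.rev hj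
  have hfishift := fun j (hj : j ≤ n) => hf.shift hj
  by_cases hin : ∃ j ≤ n, g m = f j
  · obtain ⟨j, hj, hgm⟩ := hin
    have hm0 : m = 0 := by
      by_contra hne
      have h1 := gadj (m - 1) (by omega)
      rw [show m - 1 + 1 = m by omega, hgm] at h1
      exact (hgf (m - 1) j (by omega) hj).2 h1
    subst hm0
    refine ⟨_, j, _, n - j, fun _ => z, 0, hf.rev hj, hf.shift hj, IP.single z, by simpa using f0,
      by simpa [Nat.add_sub_cancel' hj] using fn, rfl, fun i hi => fX _ (by omega), fun i hi => fX _ (by omega),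
      fun i hi => hz, Or.inl ⟨rfl, by simp [← hgm, g0], ?_, ?_, ?_⟩⟩
    · intro i k hi hi' hk hk'
      constructor
      · intro h; have := hf.2.1 _ _ (by omega) (by omega) h; omega
      · intro h; have := hf.2.2 _ _ (by omega) (by omega) h; omega
    · intro i k _ _ _ _; omega
    · intro i k _ _ _ _; omega
  push Not at hin
  have hex : ∃ j, j ≤ n ∧ G.Adj (g m) (f j) := by
    obtain ⟨j, hj, h | h⟩ := gm
    · exact absurd h (hin j hj)
    · exact ⟨j, hj, h⟩
  obtain ⟨j1, ⟨hj1, hadj1⟩, hmin⟩ : ∃ j, (j ≤ n ∧ G.Adj (g m) (f j)) ∧ ∀ k, k ≤ n → G.Adj (g m) (f k) → j ≤ k :=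
    ⟨Nat.find hex, Nat.find_spec hex, fun k hk hk' => Nat.find_min' hex ⟨hk, hk'⟩⟩
  obtain ⟨j2, ⟨hj2, hadj2⟩, hmax⟩ : ∃ j, (j ≤ n ∧ G.Adj (g m) (f j)) ∧ ∀ k, k ≤ n → G.Adj (g m) (f k) → k ≤ j := by
    have hspec := Nat.findGreatest_spec (P := fun j => j ≤ n ∧ G.Adj (g m) (f j)) (n := n) hj1 ⟨hj1, hadj1⟩
    exact ⟨_, hspec, fun k hk hk' => Nat.le_findGreatest (P := fun j => j ≤ n ∧ G.Adj (g m) (f j)) hk ⟨hk, hk'⟩⟩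
  have h12 : j1 ≤ j2 := hmin j2 hj2 hadj2
  have hgf1 : ∀ i j, i ≤ m → j ≤ n → g i ≠ f j := by
    intro i j hi hj
    rcases Nat.lt_or_ge i m with h | h
    · exact (hgf i j h hj).1
    · have : i = m := by omega
      subst this; exact hin j hj
  have hgf2 : ∀ i j, i ≤ m → j ≤ n → G.Adj (g i) (f j) → i = m ∧ j1 ≤ j ∧ j ≤ j2 := by
    intro i j hi hj hadj
    rcases Nat.lt_or_ge i m with h | h
    · exact absurd hadj (hgf i j h hj).2
    · have : i = m := by omega
      subst this; exact ⟨rfl, hmin j hj hadj, hmax j hj hadj⟩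
  have hrm := hg.rev le_rfl
  have hgend : g (m - m) = z := by simpa using g0
  have hfend : f (n - n) = x := by simpa using f0
  have hAB : ∀ i k, 1 ≤ i + k → i ≤ j1 → k ≤ n - j2 → f (j1 - i) ≠ f (j2 + k) := by
    intro i k h1 h2 h3 he
    have := hf.2.1 _ _ (by omega) (by omega) he; omega
  rcases Nat.lt_or_ge j1 j2 with hlt | hge
  · rcases Nat.lt_or_ge (j1 + 1) j2 with hlt2 | hge2
    · -- apex is the last vertex of g
      have hA := (hf.rev hj1).cons (g m) (by simpa using hadj1) (fun i hi => hin _ (by omega))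
        (fun i hi h => by have := (hgf2 m _ le_rfl (by omega) h).2; omega)
      have hB := (hf.shift hj2).cons (g m) (by simpa using hadj2) (fun i hi => hin _ (by omega))
        (fun i hi h => by have := (hgf2 m _ le_rfl (by omega) h).2; omega)
      refine ⟨_, _, _, _, _, _, hA, hB, hrm, by simpa [consF] using f0,
        by simpa [consF, Nat.add_sub_cancel' hj2] using fn, hgend, ?_, ?_, fun i hi => gX _ (by omega),
        Or.inl ⟨rfl, rfl, ?_, ?_, ?_⟩⟩
      · rintro (_ | i) hi
        · exact gX m le_rfl
        · exact fX _ (by omega)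
      · rintro (_ | i) hi
        · exact gX m le_rfl
        · exact fX _ (by omega)
      · rintro (_ | i) (_ | k) h1 h2 h3 h4 <;> try omega
        constructor
        · intro h; have := hf.2.1 _ _ (by omega) (by omega) h; omega
        · intro h; have := hf.2.2 _ _ (by omega) (by omega) h; omega
      · rintro (_ | i) k h1 h2 h3 h4
        · omega
        · exact ⟨fun h => hgf1 _ _ (by omega) (by omega) h.symm, fun h => by
            have := (hgf2 _ _ (by omega) (by omega) h.symm).1; omega⟩
      · rintro (_ | i) k h1 h2 h3 h4
        · omega
        · exact ⟨fun h => hgf1 _ _ (by omega) (by omega) h.symm, fun h => by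
            have := (hgf2 _ _ (by omega) (by omega) h.symm).1; omega⟩
    · -- triangle
      have hj : j2 = j1 + 1 := by omega
      refine ⟨_, _, _, _, _, _, hf.rev hj1, hf.shift hj2, hrm, by simpa using f0,
        by simpa [Nat.add_sub_cancel' hj2] using fn, hgend, fun i hi => fX _ (by omega),
        fun i hi => fX _ (by omega), fun i hi => gX _ (by omega), Or.inr ⟨⟨?_, ?_⟩, ⟨?_, ?_⟩, ⟨?_, ?_⟩⟩⟩
      · simpa [hj] using hf.1 j1 (by omega)
      · intro i k hi hk
        constructor
        · intro h; have := hf.2.1 _ _ (by omega) (by omega) h; omega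
        · intro h; have := hf.2.2 _ _ (by omega) (by omega) h; omega
      · simpa using hadj1.symm
      · intro i k hi hk
        exact ⟨fun h => hgf1 _ _ (by omega) (by omega) h.symm, fun h => by
            have := (hgf2 _ _ (by omega) (by omega) h.symm); omega⟩
      · simpa using hadj2.symm
      · intro i k hi hk
        exact ⟨fun h => hgf1 _ _ (by omega) (by omega) h.symm, fun h => by
            have := (hgf2 _ _ (by omega) (by omega) h.symm); omega⟩
  · have hj : j2 = j1 := by omega
    subst hj
    have hC := hrm.cons (f j2) (by simpa using hadj1.symm) (fun i hi h => hgf1 _ _ (by omega) hj2 h.symm)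
      (fun i hi h => by have := (hgf2 _ _ (by omega) hj2 h.symm); omega)
    refine ⟨_, _, _, _, _, _, hf.rev hj2, hf.shift hj2, hC, by simpa using f0,
        by simpa [Nat.add_sub_cancel' hj2] using fn, hgend, fun i hi => fX _ (by omega),
        fun i hi => fX _ (by omega), ?_, Or.inl ⟨rfl, rfl, ?_, ?_, ?_⟩⟩
    · rintro (_ | i) hi
      · exact fX _ hj2
      · exact gX _ (by omega)
    · intro i k h1 h2 h3 h4
      constructor
      · intro h; have := hf.2.1 _ _ (by omega) (by omega) h; omega
      · intro h; have := hf.2.2 _ _ (by omega) (by omega) h; omega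
    · rintro i (_ | k) h1 h2 h3 h4
      · omega
      · exact ⟨fun h => hgf1 _ _ (by omega) (by omega) h.symm, fun h => by
            have := (hgf2 _ _ (by omega) (by omega) h.symm); omega⟩
    · rintro i (_ | k) h1 h2 h3 h4
      · omega
      · exact ⟨fun h => hgf1 _ _ (by omega) (by omega) h.symm, fun h => by
            have := (hgf2 _ _ (by omega) (by omega) h.symm); omega⟩

/-- induced paths as walks -/
theorem IP.walk {f : ℕ → V} {n : ℕ} (h : IP G f n) : ∃ w : G.Walk (f 0) (f n),
    Paper.IsIPath G w ∧ w.length = n ∧ ∀ x ∈ w.support, ∃ i ≤ n, x = f i := by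
  have key : ∀ (n : ℕ) (f : ℕ → V), (∀ i < n, G.Adj (f i) (f (i + 1))) →
      ∃ w : G.Walk (f 0) (f n), w.length = n ∧ ∀ i ≤ n, w.getVert i = f i := by
    intro n
    induction n with
    | zero => intro f _; exact ⟨.nil, rfl, fun i hi => by simp [show i = 0 by omega]⟩
    | succ n ih =>
      intro f hf
      obtain ⟨w, hw, hw'⟩ := ih (fun i => f (i + 1)) (fun i hi => hf (i + 1) (by omega))
      refine ⟨.cons (hf 0 (by omega)) w, by simp [hw], ?_⟩
      rintro (_ | i) hi
      · simp
      · rw [SimpleGraph.Walk.getVert_cons_succ]; exact hw' i (by omega)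
  obtain ⟨w, hw, hv⟩ := key n f h.1
  have hsupp : ∀ x ∈ w.support, ∃ i ≤ n, x = f i := by
    intro x hx
    obtain ⟨i, hi, hi'⟩ := SimpleGraph.Walk.mem_support_iff_exists_getVert.1 hx
    exact ⟨i, by omega, by rw [← hi, hv i (by omega)]⟩
  refine ⟨w, ⟨?_, ?_⟩, hw, hsupp⟩
  · rw [← SimpleGraph.Walk.IsPath.getVert_injOn_iff]
    intro i hi j hj hij
    have hi' : i ≤ n := hw ▸ hi
    have hj' : j ≤ n := hw ▸ hj
    rw [hv i hi', hv j hj'] at hij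
    exact h.2.1 _ _ hi' hj' hij
  · intro x hx y hy hxy
    rw [SimpleGraph.Walk.mem_verts_toSubgraph] at hx hy
    obtain ⟨i, hi, rfl⟩ := hsupp x hx
    obtain ⟨j, hj, rfl⟩ := hsupp y hy
    have hadj : ∀ k, k < n → w.toSubgraph.Adj (f k) (f (k + 1)) := by
      intro k hk
      have := SimpleGraph.Walk.toSubgraph_adj_getVert w (i := k) (by omega)
      rwa [hv k (by omega), hv (k + 1) (by omega)] at this
    rcases h.2.2 i j hi hj hxy with rfl | rfl
    · exact hadj i (by omega)
    · exact (hadj j (by omega)).symm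

end GT

namespace GT
variable {V : Type} {G : SimpleGraph V}

lemma DT.symm {A B : ℕ → V} {a b : ℕ} (h : DT G A a B b) : DT G B b A a :=
  fun i j h1 h2 h3 h4 => ⟨(h j i h3 h4 h1 h2).1.symm, fun he => (h j i h3 h4 h1 h2).2 he.symm⟩

lemma DD.symm {A B : ℕ → V} {a b : ℕ} (h : DD G A a B b) : DD G B b A a :=
  ⟨h.1.symm, fun i j h1 h2 => ⟨(h.2 j i h2 h1).1.symm, fun he => ((h.2 j i h2 h1).2 he.symm).symm⟩⟩

theorem tripod3 {X : Set V} (hX : Conn G X) (x : Fin 3 → V) (hx : ∀ k, x k ∈ X) :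
    ∃ (A : Fin 3 → ℕ → V) (a : Fin 3 → ℕ), (∀ k, IP G (A k) (a k)) ∧ (∀ k, A k (a k) = x k) ∧
      (∀ k i, i ≤ a k → A k i ∈ X) ∧
      ((∀ k l, A k 0 = A l 0 ∧ (k ≠ l → DT G (A k) (a k) (A l) (a l))) ∨
        (∀ k l, k ≠ l → DD G (A k) (a k) (A l) (a l))) := by
  obtain ⟨A, a, B, b, C, c, h1, h2, h3, h4, h5, h6, h7, h8, h9, h⟩ := tripod hX (hx 0) (hx 1) (hx 2)
  refine ⟨![A, B, C], ![a, b, c], ?_, ?_, ?_, ?_⟩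
  · intro k; fin_cases k <;> assumption
  · intro k; fin_cases k <;> assumption
  · intro k; fin_cases k <;> assumption
  · rcases h with ⟨e1, e2, d1, d2, d3⟩ | ⟨d1, d2, d3⟩
    · left
      intro k l
      have e3 := e1.symm.trans e2
      fin_cases k <;> fin_cases l <;> refine ⟨?_, fun hkl => ?_⟩ <;>
        first | rfl | exact absurd rfl hkl | assumption | (apply Eq.symm; assumption) | (apply DT.symm; assumption)
    · right
      intro k l
      fin_cases k <;> fin_cases l <;> simp [d1, d2, d3, d1.symm, d2.symm, d3.symm]

def Forest (G : SimpleGraph V) (X : Set V) : Prop :=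
  ∀ Y ⊆ X, ∀ x ∈ Y, Conn G (Y \ {x}) → ∀ y ∈ Y, ∀ z ∈ Y, G.Adj x y → G.Adj x z → y = z

lemma forest_of_T {X : Set V} {A : Fin 3 → ℕ → V} {a : Fin 3 → ℕ} (hA : ∀ k, IP G (A k) (a k))
    (hT : ∀ k l, A k 0 = A l 0 ∧ (k ≠ l → DT G (A k) (a k) (A l) (a l)))
    (hX : ∀ v ∈ X, ∃ k i, i ≤ a k ∧ v = A k i) : Forest G X := by
  intro Y hYX x hx hc y hy z hz hxy hxz
  by_contra hyz
  have hform : ∀ v ∈ Y, ∃ k i, i ≤ a k ∧ v = A k i := fun v hv => hX v (hYX hv)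
  obtain ⟨k, i, hi, rfl⟩ := hform x hx
  rcases Nat.eq_zero_or_pos i with rfl | hi1
  · have hn : ∀ v ∈ Y, G.Adj (A k 0) v → ∃ l, 1 ≤ a l ∧ v = A l 1 := by
      intro v hv hadj
      obtain ⟨l, j, hj, rfl⟩ := hform v hv
      rw [(hT k l).1] at hadj
      have := (hA l).2.2 0 j (by omega) hj hadj
      have : j = 1 := by omega
      subst this
      exact ⟨l, hj, rfl⟩
    obtain ⟨l, hl, rfl⟩ := hn y hy hxy
    obtain ⟨l', hl', rfl⟩ := hn z hz hxz
    have hll : l ≠ l' := fun h => hyz (by rw [h])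
    have := hc.closed (L := {v | ∃ j, 1 ≤ j ∧ j ≤ a l ∧ v = A l j}) ⟨A l 1, ⟨hy, fun h => hxy.ne h.symm⟩, 1, le_rfl, hl, rfl⟩ ?_
    · obtain ⟨j, h1, h2, h3⟩ := this (show A l' 1 ∈ _ from ⟨hz, fun h => hxz.ne h.symm⟩)
      exact ((hT l l').2 hll j 1 h1 h2 le_rfl hl').1 h3.symm
    · rintro u hu ⟨j, h1, h2, rfl⟩ v hv huv
      obtain ⟨l2, j2, hj2, rfl⟩ := hform v hv.1
      have hj2' : 1 ≤ j2 := by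
        rcases Nat.eq_zero_or_pos j2 with rfl | h
        · exact absurd (hT l2 k).1 hv.2
        · exact h
      by_cases hl2 : l = l2
      · subst hl2; exact ⟨j2, hj2', hj2, rfl⟩
      · exact absurd huv ((hT l l2).2 hl2 j j2 h1 h2 hj2' hj2).2
  · have hn : ∀ i', 1 ≤ i' → i' ≤ a k → ∀ v ∈ Y, G.Adj (A k i') v → ∃ j, j ≤ a k ∧ v = A k j ∧ (j + 1 = i' ∨ i' + 1 = j) := by
      intro i' hi1 hi v hv hadj
      obtain ⟨l, j, hj, rfl⟩ := hform v hv
      rcases Nat.eq_zero_or_pos j with rfl | hj1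
      · rw [(hT l k).1] at hadj ⊢
        exact ⟨0, by omega, rfl, ((hA k).2.2 i' 0 hi (by omega) hadj).symm⟩
      · by_cases hl : k = l
        · subst hl
          exact ⟨j, hj, rfl, ((hA k).2.2 i' j hi hj hadj).symm⟩
        · exact absurd hadj ((hT k l).2 hl i' j hi1 hi hj1 hj).2
    have main : ∀ y z, y ∈ Y → z ∈ Y → G.Adj (A k i) y → G.Adj (A k i) z → i + 1 ≤ a k →
        y = A k (i + 1) → z = A k (i - 1) → False := by
      intro y z hy hz hxy hxz hia hy' hz'
      have := hc.closed (L := {v | ∃ j, i < j ∧ j ≤ a k ∧ v = A k j}) ⟨y, ⟨hy, fun h => hxy.ne h.symm⟩, i + 1, by omega, hia, hy'⟩ ?_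
      · obtain ⟨j, h1, h2, h3⟩ := this (show z ∈ _ from ⟨hz, fun h => hxz.ne h.symm⟩)
        have := (hA k).2.1 (i - 1) j (by omega) h2 (hz' ▸ h3)
        omega
      · rintro u hu ⟨j, h1, h2, rfl⟩ v hv huv
        obtain ⟨j', hj', rfl, h⟩ := hn j (by omega) h2 v hv.1 huv
        have : j' ≠ i := fun h => hv.2 (by rw [h]; rfl)
        exact ⟨j', by omega, hj', rfl⟩
    obtain ⟨j1, h1, h2, h3⟩ := hn i hi1 hi y hy hxy
    obtain ⟨j2, g1, g2, g3⟩ := hn i hi1 hi z hz hxz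
    have hne : j1 ≠ j2 := fun h => hyz (by rw [h2, g2, h])
    rcases h3 with h3 | h3 <;> rcases g3 with g3 | g3
    · omega
    · exact main z y hz hy hxz hxy (by omega) (by rw [g2, ← g3]) (by rw [h2, ← h3]; rfl)
    · exact main y z hy hz hxy hxz (by omega) (by rw [h2, ← h3]) (by rw [g2, ← g3]; rfl)
    · omega

def Min (G : SimpleGraph V) (C P : Set V) : Prop :=
  Conn G C ∧ P ⊆ C ∧ ∀ C', C' ⊆ C → Conn G C' → P ⊆ C' → C' = C

lemma exists_min [Finite V] {X P : Set V} (hX : Conn G X) (hP : P ⊆ X) : ∃ C, C ⊆ X ∧ Min G C P := by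
  obtain ⟨C, hC, hmin⟩ := Set.exists_min_image {C : Set V | C ⊆ X ∧ Conn G C ∧ P ⊆ C} Set.ncard
    (Set.toFinite _) ⟨X, le_rfl, hX, hP⟩
  refine ⟨C, hC.1, hC.2.1, hC.2.2, fun C' h1 h2 h3 => ?_⟩
  exact Set.eq_of_subset_of_ncard_le h1 (hmin C' ⟨h1.trans hC.1, h2, h3⟩) (Set.toFinite _)

lemma Conn.remove_leaf {X : Set V} (hX : Conn G X) {u w : V} (hw : w ∈ X) (hwu : w ≠ u)
    (h : ∀ y ∈ X, G.Adj u y → y = w) : Conn G (X \ {u}) := by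
  refine conn_of_root (r := w) ⟨hw, hwu⟩ fun L hL hc => ?_
  have := hX.closed (L := L ∪ {u}) ⟨w, hw, Or.inl hL⟩ ?_
  · intro x hx
    exact (this hx.1).resolve_right hx.2
  · intro a ha haL b hb hab
    by_cases hau : a = u
    · subst hau; rw [h b hb hab]; exact Or.inl hL
    by_cases hbu : b = u
    · exact Or.inr hbu
    · exact Or.inl (hc a ⟨ha, hau⟩ (haL.resolve_right hau) b ⟨hb, hbu⟩ hab)

lemma Conn.exists_nbr {X : Set V} (hX : Conn G X) {u w : V} (hu : u ∈ X) (hw : w ∈ X) (hwu : w ≠ u) :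
    ∃ y ∈ X, G.Adj u y := by
  by_contra hcon
  push Not at hcon
  have := hX.closed (L := {u}) ⟨u, hu, rfl⟩ (by
    rintro a _ rfl b hb hab; exact absurd hab (hcon b hb))
  exact hwu (this hw)

lemma deg_two [Finite V] {u x y z : V} (h : Paper.deg G u ≤ 2) (hx : G.Adj u x) (hy : G.Adj u y)
    (hz : G.Adj u z) (hxy : x ≠ y) : z = x ∨ z = y := by
  classical
  by_contra hcon
  push Not at hcon
  have h1 : ({x, y, z} : Set V) ⊆ G.neighborSet u := by
    rintro v (rfl | rfl | rfl) <;> assumption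
  have h2 := Set.ncard_le_ncard h1 (Set.toFinite _)
  have h3 : ({x, y, z} : Set V).ncard = 3 := Set.ncard_eq_three.2 ⟨x, y, z, hxy, hcon.1.symm, hcon.2.symm, rfl⟩
  unfold Paper.deg at h
  omega

lemma port_of_deg [Finite V] {C : Set V} {p q : Fin 3 → V} (hC : Min G C (Set.range p))
    (hq : ∀ k, q k ∉ C) (hqi : Function.Injective q) (hpq : ∀ k, G.Adj (p k) (q k)) {u v : V}
    (hu : u ∈ C) (hv : v ∉ C) (huv : G.Adj u v) (hd : Paper.deg G u ≤ 2) :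
    ∃ k, u = p k ∧ v = q k := by
  obtain ⟨hconn, hp, hmin⟩ := hC
  by_cases hs : ∃ w ∈ C, w ≠ u
  · obtain ⟨w', hw', hne⟩ := hs
    obtain ⟨w, hw, huw⟩ := hconn.exists_nbr hu hw' hne
    have hwv : w ≠ v := fun h => hv (h ▸ hw)
    have hnb : ∀ y, G.Adj u y → y = w ∨ y = v := fun y hy => deg_two hd huw huv hy hwv
    have hc := hconn.remove_leaf hw huw.ne.symm (fun y hy huy => (hnb y huy).resolve_right (fun h => hv (h ▸ hy)))
    by_cases hur : u ∈ Set.range p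
    · obtain ⟨k, rfl⟩ := hur
      refine ⟨k, rfl, ?_⟩
      rcases hnb _ (hpq k) with h | h
      · exact absurd hw (h ▸ hq k)
      · exact h.symm
    · have := hmin (C \ {u}) sdiff_subset hc (fun x hx => ⟨hp hx, fun h => hur (h ▸ hx)⟩)
      rw [← this] at hu
      exact absurd rfl hu.2
  · push Not at hs
    have hpu : ∀ k, p k = u := fun k => hs _ (hp ⟨k, rfl⟩)
    have h01 : q 0 ≠ q 1 := fun h => by simpa using hqi h
    rcases deg_two hd (hpu 0 ▸ hpq 0) (hpu 1 ▸ hpq 1) (hpu 2 ▸ hpq 2) h01 with h | h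
    · have := hqi h; simp at this
    · have := hqi h; simp at this

def joinF (A B : ℕ → V) (a b i : ℕ) : V := if i ≤ a then A i else B (a + b + 1 - i)

/-- joining two induced paths across an edge -/
lemma IP.join {A B : ℕ → V} {a b : ℕ} (hA : IP G A a) (hB : IP G B b) (hab : G.Adj (A a) (B b))
    (hne : ∀ i j, i ≤ a → j ≤ b → A i ≠ B j)
    (hadj : ∀ i j, i ≤ a → j ≤ b → G.Adj (A i) (B j) → i = a ∧ j = b) :
    IP G (joinF A B a b) (a + b + 1) := by
  unfold joinF
  refine ⟨fun i hi => ?_, fun i j hi hj he => ?_, fun i j hi hj he => ?_⟩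
  · rcases Nat.lt_trichotomy i a with h | h | h
    · simp only [show i ≤ a by omega, show i + 1 ≤ a by omega, if_true]; exact hA.1 i h
    · subst h
      simp only [le_refl, if_true, show ¬ (i + 1 ≤ i) by omega, if_false,
        show i + b + 1 - (i + 1) = b by omega]; exact hab
    · simp only [show ¬ i ≤ a by omega, show ¬ i + 1 ≤ a by omega, if_false]
      have := hB.1 (a + b + 1 - (i + 1)) (by omega)
      rw [show a + b + 1 - (i + 1) + 1 = a + b + 1 - i by omega] at this
      exact this.symm
  · by_cases h1 : i ≤ a <;> by_cases h2 : j ≤ a <;> simp only [h1, h2, if_true, if_false] at he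
    · exact hA.2.1 i j h1 h2 he
    · exact absurd he (hne _ _ h1 (by omega))
    · exact absurd he.symm (hne _ _ h2 (by omega))
    · have := hB.2.1 _ _ (by omega) (by omega) he; omega
  · by_cases h1 : i ≤ a <;> by_cases h2 : j ≤ a <;> simp only [h1, h2, if_true, if_false] at he
    · exact hA.2.2 i j h1 h2 he
    · have := hadj _ _ h1 (by omega) he; omega
    · have := hadj _ _ h2 (by omega) he.symm; omega
    · have := hB.2.2 _ _ (by omega) (by omega) he; omega

lemma IP.walk' {f : ℕ → V} {n : ℕ} (h : IP G f n) {u v : V} (hu : f 0 = u) (hv : f n = v) :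
    ∃ w : G.Walk u v, Paper.IsIPath G w ∧ w.length = n ∧ ∀ x ∈ w.support, ∃ i ≤ n, x = f i := by
  subst hu hv; exact h.walk

theorem cell [Finite V] (hpy : ¬ Paper.ContainsPyramid G) (hpr : ¬ Paper.ContainsPrism G)
    {C E' : Set V} (hE' : Conn G E') (hdisj : Disjoint C E')
    (hsat : ∀ x ∈ C, ∀ y ∈ E', G.Adj x y → Paper.deg G x ≤ 2 ∨ Paper.deg G y ≤ 2)
    (p q : Fin 3 → V) (hq : ∀ k, q k ∈ E') (hqi : Function.Injective q)
    (hpq : ∀ k, G.Adj (p k) (q k)) (hC : Min G C (Set.range p)) : Forest G C := by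
  have hpC : ∀ k, p k ∈ C := fun k => hC.2.1 ⟨k, rfl⟩
  obtain ⟨B, b, hB, hBp, hBC, hT | hD⟩ := tripod3 hC.1 p hpC
  · refine forest_of_T hB hT ?_
    have hU : Conn G {v | ∃ k i, i ≤ b k ∧ v = B k i} := by
      refine conn_of_root (r := B 0 0) ⟨0, 0, by omega, rfl⟩ fun L hL hc => ?_
      rintro _ ⟨k, i, hi, rfl⟩
      induction i with
      | zero => rw [(hT k 0).1]; exact hL
      | succ i ih =>
        exact hc _ ⟨k, i, by omega, rfl⟩ (ih (by omega)) _ ⟨k, i + 1, hi, rfl⟩ ((hB k).1 i (by omega))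
    have := hC.2.2 _ (by rintro _ ⟨k, i, hi, rfl⟩; exact hBC k i hi) hU
      (by rintro _ ⟨k, rfl⟩; exact ⟨k, b k, le_rfl, (hBp k).symm⟩)
    intro v hv
    rw [← this] at hv
    exact hv
  exfalso
  have hpi : Function.Injective p := by
    intro k l hkl
    by_contra hne
    exact ((hD k l hne).2 (b k) (b l) le_rfl le_rfl).1 (by rw [hBp, hBp, hkl])
  obtain ⟨E, hEE, hE⟩ := exists_min hE' (P := Set.range q) (by rintro _ ⟨k, rfl⟩; exact hq k)
  have hCE : ∀ u ∈ C, ∀ v ∈ E, u ≠ v := fun u hu v hv h =>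
    Set.disjoint_left.1 hdisj hu (h ▸ hEE hv)
  have hcr : ∀ u ∈ C, ∀ v ∈ E, G.Adj u v → ∃ k, u = p k ∧ v = q k := by
    intro u hu v hv huv
    rcases hsat u hu v (hEE hv) huv with h | h
    · exact port_of_deg hC (fun k hk => Set.disjoint_left.1 hdisj hk (hq k)) hqi hpq hu
        (fun h => hCE v h v hv rfl) huv h
    · obtain ⟨k, h1, h2⟩ := port_of_deg hE (fun k hk => hCE _ (hpC k) _ hk rfl) hpi
        (fun k => (hpq k).symm) hv (fun h => hCE u hu u h rfl) huv.symm h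
      exact ⟨k, h2, h1⟩
  obtain ⟨A, a, hA, hAq, hAE, hAD⟩ := tripod3 hE.1 q (fun k => hE.2.1 ⟨k, rfl⟩)
  -- cross edges
  have hx : ∀ k l i j, i ≤ a k → j ≤ b l → A k i ≠ B l j ∧ (G.Adj (A k i) (B l j) → A k i = q l ∧ j = b l) := by
    intro k l i j hi hj
    refine ⟨(hCE _ (hBC l j hj) _ (hAE k i hi)).symm, fun hadj => ?_⟩
    obtain ⟨m, h1, h2⟩ := hcr _ (hBC l j hj) _ (hAE k i hi) hadj.symm
    have hlm : l = m := by
      by_contra hne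
      exact ((hD l m hne).2 j (b m) hj le_rfl).1 (by rw [h1, hBp])
    subst hlm
    exact ⟨h2, (hB l).2.1 j (b l) hj le_rfl (by rw [h1, hBp])⟩
  have hJ := fun k => (hA k).join (hB k) (by rw [hAq, hBp]; exact (hpq k).symm)
    (fun i j hi hj => (hx k k i j hi hj).1)
    (fun i j hi hj h => ⟨(hA k).2.1 i (a k) hi le_rfl (by rw [((hx k k i j hi hj).2 h).1, hAq]),
      ((hx k k i j hi hj).2 h).2⟩)
  have hend : ∀ k, joinF (A k) (B k) (a k) (b k) (a k + b k + 1) = B k 0 := by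
    intro k
    simp [joinF, show ¬ (a k + b k + 1 ≤ a k) by omega]
  have hform : ∀ k i, i ≤ a k + b k + 1 →
      (∃ i', i' ≤ a k ∧ joinF (A k) (B k) (a k) (b k) i = A k i') ∨
      (∃ j, j ≤ b k ∧ joinF (A k) (B k) (a k) (b k) i = B k j) := by
    intro k i hi
    by_cases h : i ≤ a k
    · left; exact ⟨i, h, by simp [joinF, h]⟩
    · right; exact ⟨a k + b k + 1 - i, by omega, by simp [joinF, h]⟩
  rcases hAD with hT | hD'
  · choose w hw1 hw2 hw3 using fun k => (hJ k).walk' (u := A 0 0) (v := B k 0) (by simp [joinF, (hT k 0).1]) (hend k)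
    have hpair : ∀ k l, k ≠ l → ∀ x ∈ (w k).support, x ≠ A 0 0 → ∀ y ∈ (w l).support, y ≠ A 0 0 →
        x ≠ y ∧ (G.Adj x y → x = B k 0 ∧ y = B l 0) := by
      have hAB : ∀ k l, k ≠ l → ∀ i j, i ≤ a k → j ≤ b l → A k i ≠ A 0 0 → ¬ G.Adj (A k i) (B l j) := by
        intro k l hkl i j hi hj hne hadj
        have h1 := ((hx k l i j hi hj).2 hadj).1
        rw [← hAq l] at h1
        have hi1 : i ≠ 0 := by rintro rfl; exact hne (hT k 0).1
        rcases Nat.eq_zero_or_pos (a l) with h0 | h0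
        · rw [h0, (hT l 0).1] at h1; exact hne h1
        · exact ((hT k l).2 hkl i (a l) (by omega) hi h0 le_rfl).1 h1
      intro k l hkl x hxs hx0 y hys hy0
      obtain ⟨i, hi, rfl⟩ := hw3 k x hxs
      obtain ⟨j, hj, rfl⟩ := hw3 l y hys
      rcases hform k i hi with ⟨i', hi', he⟩ | ⟨i', hi', he⟩ <;>
        rcases hform l j hj with ⟨j', hj', he'⟩ | ⟨j', hj', he'⟩ <;> rw [he] at hx0 ⊢ <;> rw [he'] at hy0 ⊢
      · have h1 : i' ≠ 0 := by rintro rfl; exact hx0 (hT k 0).1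
        have h2 : j' ≠ 0 := by rintro rfl; exact hy0 (hT l 0).1
        have := (hT k l).2 hkl i' j' (by omega) hi' (by omega) hj'
        exact ⟨this.1, fun h => absurd h this.2⟩
      · exact ⟨(hx k l i' j' hi' hj').1, fun h => absurd h (hAB k l hkl i' j' hi' hj' hx0)⟩
      · exact ⟨(hx l k j' i' hj' hi').1.symm, fun h => absurd h.symm (hAB l k hkl.symm j' i' hj' hi' hy0)⟩
      · have := (hD k l hkl).2 i' j' hi' hj'
        exact ⟨this.1, fun h => by obtain ⟨rfl, rfl⟩ := this.2 h; exact ⟨rfl, rfl⟩⟩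
    have hlen : ∀ k l, k ≠ l → ¬ ((w k).length = 1 ∧ (w l).length = 1) := by
      rintro k l hkl ⟨h1, h2⟩
      rw [hw2] at h1 h2
      have e1 : a k = 0 := by omega
      have e2 : a l = 0 := by omega
      apply hkl
      apply hqi
      rw [← hAq, ← hAq, e1, e2]; exact (hT k l).1
    refine hpy ⟨A 0 0, B 0 0, B 1 0, B 2 0, w 0, w 1, w 2, (hD 0 1 (by decide)).1, (hD 1 2 (by decide)).1,
      (hD 0 2 (by decide)).1, hw1 0, hw1 1, hw1 2, ?_, ?_, ?_, hlen 0 1 (by decide), hlen 0 2 (by decide),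
      hlen 1 2 (by decide), hpair 0 1 (by decide), hpair 0 2 (by decide), hpair 1 2 (by decide)⟩
    all_goals rw [hw2]; omega
  · choose w hw1 hw2 hw3 using fun k => (hJ k).walk' (u := A k 0) (v := B k 0) (by simp [joinF]) (hend k)
    have hpair : ∀ k l, k ≠ l → ∀ x ∈ (w k).support, ∀ y ∈ (w l).support,
        x ≠ y ∧ (G.Adj x y → (x = A k 0 ∧ y = A l 0) ∨ (x = B k 0 ∧ y = B l 0)) := by
      have hAB : ∀ k l, k ≠ l → ∀ i j, i ≤ a k → j ≤ b l → ¬ G.Adj (A k i) (B l j) := by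
        intro k l hkl i j hi hj hadj
        have h1 := ((hx k l i j hi hj).2 hadj).1
        rw [← hAq l] at h1
        exact ((hD' k l hkl).2 i (a l) hi le_rfl).1 h1
      intro k l hkl x hxs y hys
      obtain ⟨i, hi, rfl⟩ := hw3 k x hxs
      obtain ⟨j, hj, rfl⟩ := hw3 l y hys
      rcases hform k i hi with ⟨i', hi', he⟩ | ⟨i', hi', he⟩ <;>
        rcases hform l j hj with ⟨j', hj', he'⟩ | ⟨j', hj', he'⟩ <;> rw [he, he']
      · have := (hD' k l hkl).2 i' j' hi' hj'
        exact ⟨this.1, fun h => by obtain ⟨rfl, rfl⟩ := this.2 h; exact Or.inl ⟨rfl, rfl⟩⟩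
      · exact ⟨(hx k l i' j' hi' hj').1, fun h => absurd h (hAB k l hkl i' j' hi' hj')⟩
      · exact ⟨(hx l k j' i' hj' hi').1.symm, fun h => absurd h.symm (hAB l k hkl.symm j' i' hj' hi')⟩
      · have := (hD k l hkl).2 i' j' hi' hj'
        exact ⟨this.1, fun h => by obtain ⟨rfl, rfl⟩ := this.2 h; exact Or.inr ⟨rfl, rfl⟩⟩
    refine hpr ⟨A 0 0, A 1 0, A 2 0, B 0 0, B 1 0, B 2 0, w 0, w 1, w 2,
      (hD' 0 1 (by decide)).1, (hD' 1 2 (by decide)).1, (hD' 0 2 (by decide)).1,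
      (hD 0 1 (by decide)).1, (hD 1 2 (by decide)).1,
      (hD 0 2 (by decide)).1, hw1 0, hw1 1, hw1 2, ?_, ?_, ?_,
      hpair 0 1 (by decide), hpair 0 2 (by decide), hpair 1 2 (by decide)⟩
    all_goals rw [hw2]; omega

end GT

namespace GT
variable {V : Type} {G : SimpleGraph V}

lemma Forest.mono {X Y : Set V} (h : Forest G X) (hY : Y ⊆ X) : Forest G Y :=
  fun Z hZ => h Z (hZ.trans hY)

lemma Conn.noncut [Finite V] {X : Set V} (hX : Conn G X) {a b : V} (ha : a ∈ X) (hb : b ∈ X)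
    (hab : b ≠ a) : ∃ u ∈ X, u ≠ a ∧ Conn G (X \ {u}) := by
  obtain ⟨Y, ⟨haY, hYX, hY, hne⟩, hmax⟩ := Set.exists_max_image {Y : Set V | a ∈ Y ∧ Y ⊆ X ∧ Conn G Y ∧ Y ≠ X}
    Set.ncard (Set.toFinite _) ⟨{a}, rfl, by simpa using ha, Conn.singleton a, fun h => by
      rw [← h] at hb; exact hab hb⟩
  have : ∃ y ∈ Y, ∃ x ∈ X, x ∉ Y ∧ G.Adj y x := by
    by_contra hcon
    push Not at hcon
    exact hne (hYX.antisymm (hX.closed (L := Y) ⟨a, ha, haY⟩ (fun y _ hy x hx hyx => by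
      by_contra hxY; exact hcon y hy x hx hxY hyx)))
  obtain ⟨y, hy, x, hx, hxY, hyx⟩ := this
  have h1 : Conn G (insert x Y) := by
    refine conn_of_root (r := a) (Or.inr haY) fun L hL hc => ?_
    have h2 := hY.closed (L := L) ⟨a, haY, hL⟩ (fun c hc' hcL d hd hcd => hc c (Or.inr hc') hcL d (Or.inr hd) hcd)
    rintro z (rfl | hz)
    · exact hc y (Or.inr hy) (h2 hy) _ (Or.inl rfl) hyx
    · exact h2 hz
  have h2 : insert x Y = X := by
    by_contra h
    have := hmax _ ⟨Or.inr haY, Set.insert_subset hx hYX, h1, h⟩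
    rw [Set.ncard_insert_of_notMem hxY (Set.toFinite _)] at this
    omega
  refine ⟨x, hx, fun h => hxY (h ▸ haY), ?_⟩
  have : X \ {x} = Y := by rw [← h2]; exact Set.insert_sdiff_self_of_notMem hxY
  rw [this]; exact hY

structure SubMap {α β : Type} (S : SimpleGraph α) (H : SimpleGraph β) (f : α → β) : Prop where
  conn : ∀ p, Conn S (f ⁻¹' {p})
  forest : ∀ p, Forest S (f ⁻¹' {p})
  cross : ∀ x y, f x ≠ f y → S.Adj x y → H.Adj (f x) (f y)
  ex : ∀ p q, H.Adj p q → ∃ x y, f x = p ∧ f y = q ∧ S.Adj x y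
  uniq : ∀ x y x' y', f x ≠ f y → S.Adj x y → S.Adj x' y' → f x = f x' → f y = f y' → x = x' ∧ y = y'
  deg : ∀ p (a : Fin 4 → β), (∀ i, H.Adj p (a i)) → ¬ Function.Injective a
  ext : ∀ u, Conn S (f ⁻¹' {f u} \ {u}) → ∃ v, f v ≠ f u ∧ S.Adj u v

lemma sub_some {β : Type} {H : SimpleGraph β} {p q a b : β} :
    (Paper.subdivideEdge H p q).Adj (some a) (some b) ↔ H.Adj a b ∧ ¬(a = p ∧ b = q) ∧ ¬(a = q ∧ b = p) := by
  simp only [Paper.subdivideEdge, SimpleGraph.fromRel_adj]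
  constructor
  · rintro ⟨h, ⟨⟨x, y, hx, hy, h1, h2, h3⟩ | ⟨h1, h2⟩⟩ | ⟨⟨x, y, hx, hy, h1, h2, h3⟩ | ⟨h1, h2⟩⟩⟩
    · cases hx; cases hy; exact ⟨h1, h2, h3⟩
    · cases h1
    · cases hx; cases hy; exact ⟨h1.symm, fun h => h3 ⟨h.2, h.1⟩, fun h => h2 ⟨h.2, h.1⟩⟩
    · cases h1
  · rintro ⟨h1, h2, h3⟩
    exact ⟨fun h => h1.ne (Option.some_injective _ h), Or.inl (Or.inl ⟨a, b, rfl, rfl, h1, h2, h3⟩)⟩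

lemma sub_none {β : Type} {H : SimpleGraph β} {p q : β} {b : Option β} :
    (Paper.subdivideEdge H p q).Adj none b ↔ b = some p ∨ b = some q := by
  simp only [Paper.subdivideEdge, SimpleGraph.fromRel_adj]
  constructor
  · rintro ⟨h, ⟨⟨x, y, hx, hy, h1, h2, h3⟩ | ⟨h1, h2⟩⟩ | ⟨⟨x, y, hx, hy, h1, h2, h3⟩ | ⟨h1, h2⟩⟩⟩
    · cases hx
    · exact h2
    · cases hy
    · subst h1; exact absurd rfl h
  · rintro h
    exact ⟨by rintro rfl; simp at h, Or.inl (Or.inr ⟨trivial, h⟩)⟩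

lemma SubMap.pick {α β : Type} [Finite α] {S : SimpleGraph α} {H : SimpleGraph β} {f : α → β}
    (h : SubMap S H f) (hf : ¬ Function.Injective f) :
    ∃ u v w, f v ≠ f u ∧ f w = f u ∧ S.Adj u v ∧ S.Adj u w ∧ Conn S (f ⁻¹' {f u} \ {u}) ∧
      ∀ x, S.Adj u x → x = v ∨ x = w := by
  simp only [Function.Injective] at hf
  push Not at hf
  obtain ⟨a, b, hab, hne⟩ := hf
  have hcn := h.conn (f a)
  obtain ⟨u1, h1, -, c1⟩ := hcn.noncut (a := a) (b := b) rfl hab.symm hne.symm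
  obtain ⟨u2, h2, h12, c2⟩ : ∃ u ∈ f ⁻¹' {f a}, u ≠ u1 ∧ Conn S (f ⁻¹' {f a} \ {u}) := by
    by_cases hu : a = u1
    · exact hcn.noncut (b := b) h1 hab.symm (by rw [← hu]; exact hne.symm)
    · exact hcn.noncut (b := a) h1 rfl hu
  have key : ∃ u, f u = f a ∧ Conn S (f ⁻¹' {f a} \ {u}) ∧
      ∀ x y, f x ≠ f u → f y ≠ f u → S.Adj u x → S.Adj u y → x = y := by
    by_contra hcon
    push Not at hcon
    obtain ⟨x1, y1, a1, a2, a3, a4, a5⟩ := hcon u1 h1 c1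
    obtain ⟨x2, y2, b1, b2, b3, b4, b5⟩ := hcon u2 h2 c2
    have h1 : f u1 = f a := h1
    have h2 : f u2 = f a := h2
    refine h.deg (f a) ![f x1, f y1, f x2, f y2] ?_ ?_
    · intro i
      fin_cases i
      · rw [← h1]; exact h.cross _ _ a1.symm a3
      · rw [← h1]; exact h.cross _ _ a2.symm a4
      · rw [← h2]; exact h.cross _ _ b1.symm b3
      · rw [← h2]; exact h.cross _ _ b2.symm b4
    · have U := h.uniq
      have e1 : f x1 ≠ f y1 := fun e => a5 (U _ _ _ _ a1.symm a3 a4 rfl e).2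
      have e2 : f x1 ≠ f x2 := fun e => h12 (U _ _ _ _ a1.symm a3 b3 (h1.trans h2.symm) e).1.symm
      have e3 : f x1 ≠ f y2 := fun e => h12 (U _ _ _ _ a1.symm a3 b4 (h1.trans h2.symm) e).1.symm
      have e4 : f y1 ≠ f x2 := fun e => h12 (U _ _ _ _ a2.symm a4 b3 (h1.trans h2.symm) e).1.symm
      have e5 : f y1 ≠ f y2 := fun e => h12 (U _ _ _ _ a2.symm a4 b4 (h1.trans h2.symm) e).1.symm
      have e6 : f x2 ≠ f y2 := fun e => b5 (U _ _ _ _ b1.symm b3 b4 rfl e).2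
      intro i j hij
      fin_cases i <;> fin_cases j <;> first | rfl | exact absurd hij (by assumption) | exact absurd hij.symm (by assumption)
  obtain ⟨u, hu, hc, huniq⟩ := key
  rw [← hu] at hc hcn
  obtain ⟨v, hv, huv⟩ := h.ext u hc
  obtain ⟨w', hw', hne'⟩ : ∃ w ∈ f ⁻¹' {f u}, w ≠ u := hc.1
  obtain ⟨w, hw, huw⟩ := hcn.exists_nbr rfl hw' hne'
  refine ⟨u, v, w, hv, hw, huv, huw, hc, fun x hx => ?_⟩
  by_cases hxu : f x = f u
  · right; exact h.forest (f u) _ le_rfl u rfl hc x hxu w hw hx huw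
  · left; exact huniq x v hxu hv hx huv

open Classical in
noncomputable def upd {α β : Type} (f : α → β) (u x : α) : Option β := if x = u then none else some (f x)

open Classical in
lemma SubMap.step {α β : Type} {S : SimpleGraph α} {H : SimpleGraph β} {f : α → β}
    (h : SubMap S H f) {u v w : α} (hv : f v ≠ f u) (hw : f w = f u) (huv : S.Adj u v)
    (huw : S.Adj u w) (hc : Conn S (f ⁻¹' {f u} \ {u})) (hn : ∀ x, S.Adj u x → x = v ∨ x = w) :
    SubMap S (Paper.subdivideEdge H (f u) (f v)) (upd f u) := by
  have f0 : upd f u u = none := by simp [upd]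
  have f1 : ∀ x, x ≠ u → upd f u x = some (f x) := fun x hx => by simp [upd, hx]
  have hvu := huv.ne.symm
  have hwu := huw.ne.symm
  have p0 : upd f u ⁻¹' {none} = {u} := by
    ext x; by_cases hx : x = u <;> simp [upd, hx]
  have p1 : ∀ p, upd f u ⁻¹' {some p} = f ⁻¹' {p} \ {u} := by
    intro p; ext x; by_cases hx : x = u <;> simp [upd, hx]
  have p2 : ∀ p, p ≠ f u → upd f u ⁻¹' {some p} = f ⁻¹' {p} := by
    intro p hp; rw [p1]; exact sdiff_singleton_eq_self (fun hh => hp hh.symm)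
  refine ⟨?_, ?_, ?_, ?_, ?_, ?_, ?_⟩
  · rintro (_ | p)
    · rw [p0]; exact Conn.singleton u
    · by_cases hp : p = f u
      · rw [p1, hp]; exact hc
      · rw [p2 p hp]; exact h.conn p
  · rintro (_ | p)
    · rw [p0]; exact (h.forest (f u)).mono (by simp)
    · rw [p1]; exact (h.forest p).mono sdiff_subset
  · have hu : ∀ y, S.Adj u y → (Paper.subdivideEdge H (f u) (f v)).Adj none (upd f u y) := by
      intro y hy
      rcases hn y hy with rfl | rfl
      · rw [f1 _ hvu, sub_none]; exact Or.inr rfl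
      · rw [f1 _ hwu, sub_none, hw]; exact Or.inl rfl
    intro x y hxy hadj
    by_cases hx : x = u
    · subst hx; rw [f0]; exact hu y hadj
    by_cases hy : y = u
    · subst hy; rw [f0]; exact (hu x hadj.symm).symm
    rw [f1 x hx, f1 y hy] at hxy ⊢
    have hxy' : f x ≠ f y := fun e => hxy (by rw [e])
    rw [sub_some]
    exact ⟨h.cross x y hxy' hadj, fun e => hx (h.uniq _ _ _ _ hxy' hadj huv e.1 e.2).1,
      fun e => hy (h.uniq _ _ _ _ hxy' hadj huv.symm e.1 e.2).2⟩
  · have hu : ∀ q, (Paper.subdivideEdge H (f u) (f v)).Adj none q → ∃ y, upd f u y = q ∧ S.Adj u y := by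
      intro q hq
      rcases sub_none.1 hq with rfl | rfl
      · exact ⟨w, by rw [f1 _ hwu, hw], huw⟩
      · exact ⟨v, f1 _ hvu, huv⟩
    rintro (_ | p) q hpq
    · obtain ⟨y, h1, h2⟩ := hu q hpq; exact ⟨u, y, f0, h1, h2⟩
    rcases q with _ | q
    · obtain ⟨y, h1, h2⟩ := hu _ hpq.symm; exact ⟨y, u, h1, f0, h2.symm⟩
    obtain ⟨h1, h2, h3⟩ := sub_some.1 hpq
    obtain ⟨x, y, rfl, rfl, hadj⟩ := h.ex p q h1
    have hne := h1.ne
    have hx : x ≠ u := by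
      rintro rfl
      rcases hn y hadj with rfl | rfl
      · exact h2 ⟨rfl, rfl⟩
      · exact hne hw.symm
    have hy : y ≠ u := by
      rintro rfl
      rcases hn x hadj.symm with rfl | rfl
      · exact h3 ⟨rfl, rfl⟩
      · exact hne hw
    exact ⟨x, y, f1 x hx, f1 y hy, hadj⟩
  · have hz : ∀ z, upd f u z = none → z = u := fun z hz => by
      by_contra hne; rw [f1 z hne] at hz; cases hz
    have hu : ∀ y y', S.Adj u y → S.Adj u y' → upd f u y = upd f u y' → y = y' := by
      intro y y' h1 h2 he
      rcases hn y h1 with rfl | rfl <;> rcases hn y' h2 with rfl | rfl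
      · rfl
      · rw [f1 _ hvu, f1 _ hwu, hw] at he; exact absurd (Option.some_injective _ he) hv
      · rw [f1 _ hvu, f1 _ hwu, hw] at he; exact absurd (Option.some_injective _ he).symm hv
      · rfl
    intro x y x' y' hxy h1 h2 hx hy
    by_cases e1 : x = u
    · subst e1
      have := hz x' (by rw [← hx, f0]); subst this
      exact ⟨rfl, hu y y' h1 h2 hy⟩
    by_cases e2 : y = u
    · subst e2
      have := hz y' (by rw [← hy, f0]); subst this
      exact ⟨hu x x' h1.symm h2.symm hx, rfl⟩
    have e1' : x' ≠ u := by rintro rfl; exact e1 (hz x (by rw [hx, f0]))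
    have e2' : y' ≠ u := by rintro rfl; exact e2 (hz y (by rw [hy, f0]))
    rw [f1 x e1, f1 y e2] at hxy
    rw [f1 x e1, f1 x' e1'] at hx
    rw [f1 y e2, f1 y' e2'] at hy
    exact h.uniq x y x' y' (fun e => hxy (by rw [e])) h1 h2 (Option.some_injective _ hx) (Option.some_injective _ hy)
  · rintro (_ | p) a ha hinj
    · have h0 := sub_none.1 (ha 0)
      have h1 := sub_none.1 (ha 1)
      have h2 := sub_none.1 (ha 2)
      have i01 : a 0 ≠ a 1 := fun e => absurd (hinj e) (by decide)
      have i02 : a 0 ≠ a 2 := fun e => absurd (hinj e) (by decide)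
      have i12 : a 1 ≠ a 2 := fun e => absurd (hinj e) (by decide)
      grind
    · have huv' := h.cross u v hv.symm huv
      let g : Option β → β := fun z => z.elim (if p = f u then f v else f u) id
      have hg : ∀ z, (Paper.subdivideEdge H (f u) (f v)).Adj (some p) z → H.Adj p (g z) := by
        rintro (_ | z) hz
        · rcases sub_none.1 hz.symm with e | e
          · have e := Option.some_injective _ e; subst e; simpa [g] using huv'
          · have e := Option.some_injective _ e; subst e; simpa [g, hv] using huv'.symm
        · exact (sub_some.1 hz).1
      have hgi : ∀ z z', (Paper.subdivideEdge H (f u) (f v)).Adj (some p) z →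
          (Paper.subdivideEdge H (f u) (f v)).Adj (some p) z' → g z = g z' → z = z' := by
        have aux : ∀ z, (Paper.subdivideEdge H (f u) (f v)).Adj (some p) none →
            (Paper.subdivideEdge H (f u) (f v)).Adj (some p) (some z) → g none ≠ z := by
          intro z h1 h2 h3
          have h2 := sub_some.1 h2
          rcases sub_none.1 h1.symm with e | e
          · have e := Option.some_injective _ e; subst e; simp [g] at h3; exact h2.2.1 ⟨rfl, h3.symm⟩
          · have e := Option.some_injective _ e; subst e; simp [g, hv] at h3; exact h2.2.2 ⟨rfl, h3.symm⟩
        rintro (_ | z) (_ | z') h1 h2 h3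
        · rfl
        · exact absurd h3 (aux z' h1 h2)
        · exact absurd h3.symm (aux z h2 h1)
        · exact congrArg some h3
      exact h.deg p (fun i => g (a i)) (fun i => hg _ (ha i)) (fun i j e => hinj (hgi _ _ (ha i) (ha j) e))
  · intro x hx
    by_cases e1 : x = u
    · subst e1
      rw [f0, p0] at hx
      obtain ⟨z, hz⟩ := hx.1
      exact absurd hz.1 hz.2
    rw [f1 x e1, p1] at hx
    have goal : ∀ z, f z ≠ f x → upd f u z ≠ upd f u x := by
      intro z hz
      rw [f1 x e1]
      by_cases e : z = u
      · rw [e, f0]; simp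
      · rw [f1 z e]; exact fun he => hz (Option.some_injective _ he)
    by_cases e2 : x = w
    · subst e2
      exact ⟨u, by rw [f0, f1 _ hwu]; simp, huw.symm⟩
    have : Conn S (f ⁻¹' {f x} \ {x}) := by
      by_cases e3 : f x = f u
      · rw [e3] at hx ⊢
        have : f ⁻¹' {f u} \ {x} = insert u ((f ⁻¹' {f u} \ {u}) \ {x}) := by
          ext z; by_cases hz : z = u <;> simp [hz, Ne.symm e1]
        rw [this]
        have hwm : w ∈ (f ⁻¹' {f u} \ {u}) \ {x} := ⟨⟨hw, hwu⟩, fun h => e2 h.symm⟩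
        refine conn_of_root (r := w) (Or.inr hwm) fun L hL hcl => ?_
        have h2 := hx.closed (L := L) ⟨w, hwm, hL⟩ (fun c hc' hcL d hd hcd => hcl c (Or.inr hc') hcL d (Or.inr hd) hcd)
        rintro z (rfl | hz)
        · exact hcl w (Or.inr hwm) hL _ (Or.inl rfl) huw.symm
        · exact h2 hz
      · have : f ⁻¹' {f x} \ {u} = f ⁻¹' {f x} := sdiff_singleton_eq_self (fun hh => e3 hh.symm)
        rwa [this] at hx
    obtain ⟨z, h1, h2⟩ := h.ext x this
    exact ⟨z, goal z h1, h2⟩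

theorem SubMap.isSubdivision {α : Type} [Finite α] {S : SimpleGraph α} (n : ℕ) : ∀ {β : Type} [Finite β]
    {H : SimpleGraph β} {f : α → β}, SubMap S H f → Nat.card α ≤ Nat.card β + n → Paper.IsSubdivision S H := by
  have base : ∀ {β : Type} {H : SimpleGraph β} {f : α → β}, SubMap S H f → Function.Injective f →
      Paper.IsSubdivision S H := by
    intro β H f h hf
    refine .base ⟨⟨Equiv.ofBijective f ⟨hf, fun p => (h.conn p).1⟩, ?_⟩⟩
    intro x y
    refine ⟨fun hadj => ?_, fun hadj => h.cross x y (fun e => hadj.ne (hf e)) hadj⟩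
    obtain ⟨x', y', h1, h2, h3⟩ := h.ex _ _ hadj
    rwa [hf h1, hf h2] at h3
  induction n with
  | zero =>
    intro β _ H f h hn
    exact base h ((Function.Surjective.bijective_of_nat_card_le (fun p => (h.conn p).1) hn).1)
  | succ n ih =>
    intro β _ H f h hn
    by_cases hf : Function.Injective f
    · exact base h hf
    obtain ⟨u, v, w, hv, hw, huv, huw, hc, hnb⟩ := h.pick hf
    refine .step (f u) (f v) (h.cross u v hv.symm huv) (ih (h.step hv hw huv huw hc hnb) ?_)
    rw [Finite.card_option]; omega

end GT

namespace GT
variable {V : Type} {G : SimpleGraph V}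

lemma conn_induce {s : Set V} {X : Set s} : Conn (G.induce s) X ↔ Conn G (Subtype.val '' X) := by
  refine ⟨fun h => h.image _ (fun _ _ _ _ h => h), fun h => ⟨?_, fun A hA hne hc x hx => ?_⟩⟩
  · obtain ⟨_, x, hx, rfl⟩ := h.1; exact ⟨x, hx⟩
  · have := h.2 (Subtype.val '' A) (Set.image_mono hA) (hne.image _) (by
      rintro _ ⟨a, ha, rfl⟩ _ ⟨b, hb, rfl⟩ hab
      exact ⟨b, hc a ha b hb hab, rfl⟩) ⟨x, hx, rfl⟩
    obtain ⟨y, hy, e⟩ := this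
    exact Subtype.ext e ▸ hy

lemma Forest.induce {s : Set V} {X : Set s} (h : Forest G (Subtype.val '' X)) : Forest (G.induce s) X := by
  intro Y hY x hx hc y hy z hz hxy hxz
  rw [conn_induce, Set.image_sdiff Subtype.val_injective, Set.image_singleton] at hc
  exact Subtype.ext (h _ (Set.image_mono hY) x ⟨x, hx, rfl⟩ hc y ⟨y, hy, rfl⟩ z ⟨z, hz, rfl⟩ hxy hxz)

lemma sym_choice {P : Type} [Nonempty V] (R : P → P → Prop) (hR : ∀ p q, R p q → ¬ R q p) (ψ : P → Set V)
    (h : ∀ p q, R p q → ∃ x y, x ∈ ψ p ∧ y ∈ ψ q ∧ G.Adj x y) :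
    ∃ pt : P → P → V, ∀ p q, (R p q ∨ R q p) → pt p q ∈ ψ p ∧ G.Adj (pt p q) (pt q p) := by
  classical
  choose! X Y h1 h2 h3 using h
  refine ⟨fun p q => if R p q then X p q else Y q p, ?_⟩
  rintro p q (hpq | hpq)
  · simp only [hpq, hR _ _ hpq, if_true, if_false]; exact ⟨h1 _ _ hpq, h3 _ _ hpq⟩
  · simp only [hpq, hR _ _ hpq, if_true, if_false]; exact ⟨h2 _ _ hpq, (h3 _ _ hpq).symm⟩

/-- right or down neighbour inside the grid -/
def GR (r : ℕ) (p q : ℕ × ℕ) : Prop :=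
  (p.1 < r ∧ p.2 < r) ∧ (q.1 < r ∧ q.2 < r) ∧ ((q.1 = p.1 + 1 ∧ q.2 = p.2) ∨ (q.1 = p.1 ∧ q.2 = p.2 + 1))

def nb (k : Fin 3) (p : ℕ × ℕ) : ℕ × ℕ :=
  if k = 0 then (p.1, p.2 - 1) else if k = 1 then (p.1, p.2 + 1) else
    if (p.1 + p.2) % 2 = 0 then (p.1 + 1, p.2) else (p.1 - 1, p.2)

def Int (r : ℕ) (p : ℕ × ℕ) : Prop := 1 ≤ p.1 ∧ p.1 + 1 < r ∧ 1 ≤ p.2 ∧ p.2 + 1 < r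

lemma nb_GR {r : ℕ} {p : ℕ × ℕ} (hp : Int r p) (k : Fin 3) : GR r p (nb k p) ∨ GR r (nb k p) p := by
  obtain ⟨i, j⟩ := p
  simp only [Int] at hp
  fin_cases k <;> simp only [nb, GR] <;> grind

lemma nb_inj {r : ℕ} {p : ℕ × ℕ} (hp : Int r p) {k l : Fin 3} (h : nb k p = nb l p) : k = l := by
  obtain ⟨i, j⟩ := p
  simp only [Int] at hp
  fin_cases k <;> fin_cases l <;> simp only [nb] at h <;> grind

lemma nb_symm {r : ℕ} {p : ℕ × ℕ} (hp : Int r p) (k : Fin 3) : ∃ l, nb l (nb k p) = p := by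
  obtain ⟨i, j⟩ := p
  simp only [Int] at hp
  fin_cases k
  · exact ⟨1, by simp only [nb]; grind⟩
  · exact ⟨0, by simp only [nb]; grind⟩
  · exact ⟨2, by simp only [nb]; grind⟩

def em {t : ℕ} (a : Fin t × Fin (2 * t)) : ℕ × ℕ := (a.1.val + 1, a.2.val + 1)

lemma em_inj {t : ℕ} {a b : Fin t × Fin (2 * t)} (h : em a = em b) : a = b := by
  simp only [em, Prod.mk.injEq] at h
  exact Prod.ext (Fin.ext (by omega)) (Fin.ext (by omega))

lemma em_int {t : ℕ} (a : Fin t × Fin (2 * t)) : Int (2 * t + 2) (em a) := by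
  have := a.1.isLt
  have := a.2.isLt
  simp only [Int, em]; omega

lemma wall_adj {t : ℕ} (a b : Fin t × Fin (2 * t)) : (Paper.Wall t).Adj a b ↔ ∃ k, em b = nb k (em a) := by
  obtain ⟨⟨a1, ha1⟩, ⟨a2, ha2⟩⟩ := a
  obtain ⟨⟨b1, hb1⟩, ⟨b2, hb2⟩⟩ := b
  rw [Fin.exists_fin_succ, Fin.exists_fin_succ, Fin.exists_fin_succ]
  simp only [Paper.Wall, SimpleGraph.fromRel_adj, em, nb, Fin.mk.injEq, Prod.mk.injEq, ne_eq]
  grind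

lemma conn_minus {r : ℕ} {ψ : ℕ × ℕ → Set V} (hc : ∀ p : ℕ × ℕ, p.1 < r → p.2 < r → Conn G (ψ p))
    (ha : ∀ p q, GR r p q → ∃ x y, x ∈ ψ p ∧ y ∈ ψ q ∧ G.Adj x y) {p : ℕ × ℕ} (hp : Int r p) :
    Conn G {v | ∃ q : ℕ × ℕ, q.1 < r ∧ q.2 < r ∧ q ≠ p ∧ v ∈ ψ q} := by
  obtain ⟨p1, p2⟩ := p
  simp only [Int] at hp
  obtain ⟨x0, hx0⟩ := (hc (0, 0) (by omega) (by omega)).1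
  have n0 : ((0, 0) : ℕ × ℕ) ≠ (p1, p2) := by simp; omega
  refine conn_of_root (r := x0) ⟨(0, 0), by omega, by omega, n0, hx0⟩ fun L hL hcl => ?_
  have c1 : ∀ q : ℕ × ℕ, q.1 < r → q.2 < r → q ≠ (p1, p2) → ∀ x ∈ ψ q, x ∈ L → ψ q ⊆ L :=
    fun q h1 h2 h3 x hx hxL => (hc q h1 h2).closed ⟨x, hx, hxL⟩ (fun a ha' haL b hb hab =>
      hcl a ⟨q, h1, h2, h3, ha'⟩ haL b ⟨q, h1, h2, h3, hb⟩ hab)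
  have c2 : ∀ q q' : ℕ × ℕ, GR r q q' → q ≠ (p1, p2) → q' ≠ (p1, p2) → ψ q ⊆ L → ψ q' ⊆ L := by
    intro q q' h h1 h2 h3
    obtain ⟨x, y, hx, hy, hxy⟩ := ha q q' h
    exact c1 q' h.2.1.1 h.2.1.2 h2 y hy (hcl x ⟨q, h.1.1, h.1.2, h1, hx⟩ (h3 hx) y
      ⟨q', h.2.1.1, h.2.1.2, h2, hy⟩ hxy)
  have c0 := c1 (0, 0) (by omega) (by omega) n0 x0 hx0 hL
  have col : ∀ j, j < r → j ≠ p2 → ψ (0, j) ⊆ L → ∀ i, i < r → ψ (i, j) ⊆ L := by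
    intro j hj hne h0 i
    induction i with
    | zero => exact fun _ => h0
    | succ i ih => exact fun hi => c2 (i, j) (i + 1, j) ⟨⟨by omega, hj⟩, ⟨hi, hj⟩, Or.inl ⟨rfl, rfl⟩⟩ (by simp [hne]) (by simp [hne]) (ih (by omega))
  have row : ∀ i, i < r → i ≠ p1 → ψ (i, 0) ⊆ L → ∀ j, j < r → ψ (i, j) ⊆ L := by
    intro i hi hne h0 j
    induction j with
    | zero => exact fun _ => h0
    | succ j ih => exact fun hj => c2 (i, j) (i, j + 1) ⟨⟨hi, by omega⟩, ⟨hi, hj⟩, Or.inr ⟨rfl, rfl⟩⟩ (by simp [hne]) (by simp [hne]) (ih (by omega))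
  rintro v ⟨⟨i, j⟩, h1, h2, h3, hv⟩
  by_cases hi : i = p1
  · have hj : j ≠ p2 := by rintro rfl; exact h3 (by rw [hi])
    exact col j h2 hj (row 0 (by omega) (by omega) c0 j h2) i h1 hv
  · exact row i h1 hi (col 0 (by omega) (by omega) c0 i h1) j h2 hv

theorem main (t : ℕ) : ∃ M : ℕ, ∀ (V : Type) [Fintype V] (G : SimpleGraph V), Paper.MemF t G →
    (¬∃ a v u : V, Paper.HeavySeagull G a v u) → ¬Paper.HasTreewidthAtMost G M →
    Paper.ContainsWallSubdiv G t := by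
  obtain ⟨M, hM⟩ := sat_grid (2 * t + 2) t
  refine ⟨M, fun V _ G ⟨⟨_, hpy, hpr⟩, hcl⟩ hs htw => ?_⟩
  obtain ⟨ψ₀, hconn, hdisj, hdown, hright, hsat⟩ := hM V G hcl hs htw
  set r := 2 * t + 2 with hr
  let ψ : ℕ × ℕ → Set V := fun p => ψ₀ p.1 p.2
  have hc : ∀ p : ℕ × ℕ, p.1 < r → p.2 < r → Conn G (ψ p) := fun p h1 h2 => hconn _ _ h1 h2
  have hd : ∀ p q : ℕ × ℕ, p.1 < r → p.2 < r → q.1 < r → q.2 < r → ∀ x, x ∈ ψ p → x ∈ ψ q → p = q := by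
    intro p q h1 h2 h3 h4 x hx hy
    by_contra hne
    exact Set.disjoint_left.1 (hdisj p.1 p.2 q.1 q.2 h1 h2 h3 h4 (fun e => hne (Prod.ext e.1 e.2))) hx hy
  have ha : ∀ p q, GR r p q → ∃ x y, x ∈ ψ p ∧ y ∈ ψ q ∧ G.Adj x y := by
    rintro ⟨i, j⟩ ⟨i', j'⟩ h
    simp only [GR] at h
    obtain ⟨h1, h2, ⟨e1, e2⟩ | ⟨e1, e2⟩⟩ := h <;> subst e1 <;> subst e2
    · obtain ⟨x, hx, y, hy, h⟩ := hdown i j' h2.1 h2.2; exact ⟨x, y, hx, hy, h⟩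
    · obtain ⟨x, hx, y, hy, h⟩ := hright i' j h2.1 h2.2; exact ⟨x, y, hx, hy, h⟩
  have : Nonempty V := by
    obtain ⟨x, _⟩ := (hconn 0 0 (by omega) (by omega)).1; exact ⟨x⟩
  obtain ⟨pt, hpt⟩ := sym_choice (G := G) (GR r) (fun p q h h' => by simp only [GR] at h h'; omega) ψ ha
  have hin : ∀ p, Int r p → p.1 < r ∧ p.2 < r := fun p h => by simp only [Int] at h; omega
  have hnbr : ∀ p, Int r p → ∀ k, (nb k p).1 < r ∧ (nb k p).2 < r := fun p h k => by
    rcases nb_GR h k with h | h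
    · exact h.2.1
    · exact h.1
  have hnbne : ∀ p, Int r p → ∀ k, nb k p ≠ p := fun p h k e => by
    have := nb_GR h k; rw [e] at this; simp only [GR] at this; omega
  have hcell : ∀ p, Int r p → ∃ C, C ⊆ ψ p ∧ Min G C (Set.range fun k => pt p (nb k p)) ∧ Forest G C := by
    intro p hp
    obtain ⟨C, hC, hmin⟩ := exists_min (hc p (hin p hp).1 (hin p hp).2) (P := Set.range fun k => pt p (nb k p))
      (by rintro _ ⟨k, rfl⟩; exact (hpt _ _ (nb_GR hp k)).1)
    refine ⟨C, hC, hmin, cell hpy hpr (conn_minus hc ha hp) ?_ ?_ (fun k => pt p (nb k p)) (fun k => pt (nb k p) p)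
      ?_ ?_ (fun k => (hpt _ _ (nb_GR hp k)).2) hmin⟩
    · rw [Set.disjoint_left]
      rintro x hx ⟨q, h1, h2, h3, h4⟩
      exact h3 (hd q p h1 h2 (hin p hp).1 (hin p hp).2 x h4 (hC hx))
    · rintro x hx y ⟨q, h1, h2, h3, h4⟩ hxy
      by_contra hcon
      push Not at hcon
      have := hsat x y hxy hcon.1 hcon.2 p.1 p.2 (hC hx)
      exact h3 (hd q p h1 h2 (hin p hp).1 (hin p hp).2 y h4 this)
    · intro k
      exact ⟨nb k p, (hnbr p hp k).1, (hnbr p hp k).2, hnbne p hp k, (hpt _ _ (nb_GR hp k).symm).1⟩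
    · intro k l hkl
      have hkl : pt (nb k p) p = pt (nb l p) p := hkl
      refine nb_inj hp (hd _ _ (hnbr p hp k).1 (hnbr p hp k).2 (hnbr p hp l).1 (hnbr p hp l).2 _
        (hpt _ _ (nb_GR hp k).symm).1 ?_)
      rw [hkl]; exact (hpt _ _ (nb_GR hp l).symm).1
  choose! C hCψ hCm hCf using hcell
  have port : ∀ p q, Int r p → Int r q → p ≠ q → ∀ x ∈ C p, ∀ y ∈ C q, G.Adj x y → Paper.deg G x ≤ 2 →
      (∃ k, q = nb k p) ∧ x = pt p q ∧ y = pt q p := by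
    intro p q hp hq hpq x hx y hy hxy hdx
    have := port_of_deg (q := fun k => pt (nb k p) p) (hCm p hp) ?_ ?_
      (fun k => (hpt _ _ (nb_GR hp k)).2) hx (v := y) ?_ hxy hdx
    · obtain ⟨k, h1, h2⟩ := this
      have : q = nb k p := hd _ _ (hin q hq).1 (hin q hq).2 (hnbr p hp k).1 (hnbr p hp k).2 y (hCψ q hq hy) (by
        rw [h2]; exact (hpt _ _ (nb_GR hp k).symm).1)
      subst this
      exact ⟨⟨k, rfl⟩, h1, h2⟩
    · intro k hk
      exact hnbne p hp k (hd _ _ (hnbr p hp k).1 (hnbr p hp k).2 (hin p hp).1 (hin p hp).2 _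
        (hpt _ _ (nb_GR hp k).symm).1 (hCψ p hp hk))
    · intro k l hkl
      have hkl : pt (nb k p) p = pt (nb l p) p := hkl
      refine nb_inj hp (hd _ _ (hnbr p hp k).1 (hnbr p hp k).2 (hnbr p hp l).1 (hnbr p hp l).2 _
        (hpt _ _ (nb_GR hp k).symm).1 ?_)
      rw [hkl]; exact (hpt _ _ (nb_GR hp l).symm).1
    · intro hy'
      exact hpq (hd _ _ (hin p hp).1 (hin p hp).2 (hin q hq).1 (hin q hq).2 y (hCψ p hp hy') (hCψ q hq hy))
  have cross : ∀ p q, Int r p → Int r q → p ≠ q → ∀ x ∈ C p, ∀ y ∈ C q, G.Adj x y →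
      (∃ k, q = nb k p) ∧ x = pt p q ∧ y = pt q p := by
    intro p q hp hq hpq x hx y hy hxy
    by_cases hdx : Paper.deg G x ≤ 2
    · exact port p q hp hq hpq x hx y hy hxy hdx
    by_cases hdy : Paper.deg G y ≤ 2
    · obtain ⟨⟨k, hk⟩, h1, h2⟩ := port q p hq hp hpq.symm y hy x hx hxy.symm hdy
      obtain ⟨l, hl⟩ := nb_symm hq k
      exact ⟨⟨l, by rw [hk, hl]⟩, h2, h1⟩
    · have := hsat x y hxy (by omega) (by omega) p.1 p.2 (hCψ p hp hx)
      exact absurd (hd _ _ (hin p hp).1 (hin p hp).2 (hin q hq).1 (hin q hq).2 y this (hCψ q hq hy)) hpq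
  have hdel : ∀ a : Fin t × Fin (2 * t), ∃ D, D ⊆ C (em a) ∧
      Min G D {x | ∃ b, (Paper.Wall t).Adj a b ∧ x = pt (em a) (em b)} := by
    intro a
    refine exists_min (hCm _ (em_int a)).1 ?_
    rintro _ ⟨b, hb, rfl⟩
    obtain ⟨k, hk⟩ := (wall_adj a b).1 hb
    rw [hk]; exact (hCm _ (em_int a)).2.1 ⟨k, rfl⟩
  choose D hDC hDm using hdel
  have hDd : ∀ a b x, x ∈ D a → x ∈ D b → a = b := fun a b x h1 h2 =>
    em_inj (hd _ _ (hin _ (em_int a)).1 (hin _ (em_int a)).2 (hin _ (em_int b)).1 (hin _ (em_int b)).2 x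
      (hCψ _ (em_int a) (hDC a h1)) (hCψ _ (em_int b) (hDC b h2)))
  let s : Set V := {v | ∃ a, v ∈ D a}
  choose f hf using fun x : s => x.2
  have hff : ∀ (x : s) a, f x = a ↔ x.1 ∈ D a := fun x a =>
    ⟨fun h => h ▸ hf x, fun h => hDd _ _ _ (hf x) h⟩
  have hfib : ∀ a, Subtype.val '' (f ⁻¹' {a}) = D a := by
    intro a; ext v
    refine ⟨?_, fun h => ⟨⟨v, a, h⟩, (hff _ _).2 h, rfl⟩⟩
    rintro ⟨x, hx, rfl⟩; exact (hff _ _).1 hx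
  have hcr : ∀ x y : s, f x ≠ f y → G.Adj x.1 y.1 → (Paper.Wall t).Adj (f x) (f y) ∧
      x.1 = pt (em (f x)) (em (f y)) ∧ y.1 = pt (em (f y)) (em (f x)) := by
    intro x y hxy hadj
    have := cross _ _ (em_int (f x)) (em_int (f y)) (fun e => hxy (em_inj e)) x.1 (hDC _ (hf x)) y.1
      (hDC _ (hf y)) hadj
    exact ⟨(wall_adj _ _).2 this.1, this.2⟩
  have hpD : ∀ a b, (Paper.Wall t).Adj a b → pt (em a) (em b) ∈ D a ∧ G.Adj (pt (em a) (em b)) (pt (em b) (em a)) := by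
    intro a b hab
    refine ⟨(hDm a).2.1 ⟨b, hab, rfl⟩, ?_⟩
    obtain ⟨k, hk⟩ := (wall_adj a b).1 hab
    rw [hk]; exact (hpt _ _ (nb_GR (em_int a) k)).2
  have hsub : SubMap (G.induce s) (Paper.Wall t) f := by
    refine ⟨fun a => ?_, fun a => ?_, fun x y h1 h2 => (hcr x y h1 h2).1, fun a b hab => ?_, ?_, ?_, fun u hu => ?_⟩
    · rw [conn_induce, hfib]; exact (hDm a).1
    · apply Forest.induce; rw [hfib]; exact (hCf _ (em_int a)).mono (hDC a)
    · have h1 := hpD a b hab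
      have h2 := hpD b a hab.symm
      exact ⟨⟨_, a, h1.1⟩, ⟨_, b, h2.1⟩, (hff _ _).2 h1.1, (hff _ _).2 h2.1, h1.2⟩
    · intro x y x' y' hne h1 h2 hx hy
      have e1 := hcr x y hne h1
      have e2 := hcr x' y' (by rwa [← hx, ← hy]) h2
      rw [← hx, ← hy] at e2
      exact ⟨Subtype.ext (e1.2.1.trans e2.2.1.symm), Subtype.ext (e1.2.2.trans e2.2.2.symm)⟩
    · intro p a hadj hinj
      choose k hk using fun i => (wall_adj p (a i)).1 (hadj i)
      have : Function.Injective k := fun i j hij => hinj (em_inj (by rw [hk, hk, hij]))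
      have := Fintype.card_le_of_injective k this
      simp at this
    · rw [conn_induce, Set.image_sdiff Subtype.val_injective, hfib, Set.image_singleton] at hu
      have hup : u.1 ∈ {x | ∃ b, (Paper.Wall t).Adj (f u) b ∧ x = pt (em (f u)) (em b)} := by
        by_contra hcon
        have := (hDm (f u)).2.2 _ sdiff_subset hu (fun x hx =>
          ⟨(hDm (f u)).2.1 hx, fun e => hcon (by rw [← (show x = u.1 from e)]; exact hx)⟩)
        have hm := hf u
        rw [← this] at hm
        exact hm.2 rfl
      obtain ⟨b, hb, hub⟩ := hup
      have h2 := hpD b (f u) hb.symm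
      refine ⟨⟨_, b, h2.1⟩, ?_, ?_⟩
      · rw [(hff _ b).2 h2.1]; exact hb.ne.symm
      · show G.Adj u.1 _
        rw [hub]; exact h2.2.symm
  exact ⟨s, G.induce s, hsub.isSubdivision (Nat.card s) (by omega), s, ⟨Iso.refl⟩⟩

end GT
namespace Paper

/-- Theorem `nobarbell`. -/
theorem statement18 (t : ℕ) :
    ∃ M : ℕ, ∀ (V : Type) [Fintype V] (G : SimpleGraph V),
      MemF t G → (¬∃ a v u : V, HeavySeagull G a v u) →
      ¬HasTreewidthAtMost G M → ContainsWallSubdiv G t := by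
  exact GT.main t

end Paper
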